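/- arXiv:1804.10014 — 5 statements merged into one kernel-verified Lean document; each statement's English description precedes it below -/
import Mathlib

section
/- Let ℓ ≥ 3, t ≥ 2, d ≥ 1 be integers, set Δ := (20ℓ)^{2ℓ}, and let G be a bipartite graph in which every vertex has degree at most Δd. Let L_0, L_1, …, L_k be pairwise disjoint vertex subsets of G and let 1 ≤ i < k be indices with k − i ≤ ℓ − 1 such that the pair of layers (L_{i−1}, L_k) is almost-regular. Let v ∈ L_{i−1}, let A be a nonempty subset of the neighbors of v lying in L_i, and let B be a nonempty subset of L_k. If P(A, B) > 2ℓt(Δd)^{k−i−1} · |A| and P(A, B) > R_{k−i} · |B|, then G contains Θ_{ℓ,t}. -/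
/-- `G` contains the theta graph `Θ_{ℓ,t}`. -/
def SimpleGraph.HasTheta {V : Type*} (G : SimpleGraph V) (ℓ t : ℕ) : Prop :=
  ∃ (x y : V) (p : Fin t → Fin (ℓ + 1) → V),
    x ≠ y ∧
    (∀ i, p i 0 = x) ∧
    (∀ i, p i (Fin.last ℓ) = y) ∧
    (∀ i, Function.Injective (p i)) ∧
    (∀ i (j : Fin ℓ), G.Adj (p i j.castSucc) (p i j.succ)) ∧
    (∀ i i', i ≠ i' → ∀ j j', p i j = p i' j' → p i j = x ∨ p i j = y)

/-- The number of linear paths from `u ∈ L i` to `v ∈ L j`: sequences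
`u = p i, p (i+1), …, p j = v` with `p s ∈ L s` for `i ≤ s ≤ j` and consecutive
vertices adjacent.  (Values of the sequence outside `[i, j]` are pinned to `u`, so
each linear path is counted exactly once.) -/
noncomputable def linPathCount {V : Type*} (G : SimpleGraph V) (L : ℕ → Finset V)
    (i j : ℕ) (u v : V) : ℕ :=
  Nat.card {p : ℕ → V // p i = u ∧ p j = v ∧ (∀ s, i ≤ s → s ≤ j → p s ∈ L s) ∧
    (∀ s, i ≤ s → s < j → G.Adj (p s) (p (s + 1))) ∧
    (∀ s, s < i ∨ j < s → p s = u)}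

/-- The number of linear paths from a vertex of `A ⊆ L i` to a vertex of `B ⊆ L j`. -/
noncomputable def linPathCountSet {V : Type*} (G : SimpleGraph V) (L : ℕ → Finset V)
    (i j : ℕ) (A B : Finset V) : ℕ :=
  ∑ u ∈ A, ∑ v ∈ B, linPathCount G L i j u v

/-- `R_m = (2ℓ)^m · C_m · t^m` where `C_m` is the `m`-th Catalan number. -/
def Rc (ℓ t m : ℕ) : ℕ := (2 * ℓ) ^ m * catalan m * t ^ m

/-- The pair of layers `(L i, L j)` is regular: every pair of vertices
`(u, v) ∈ L i × L j` is joined by at most `R_{j-i-1}` linear paths. -/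
def RegularPair {V : Type*} (G : SimpleGraph V) (L : ℕ → Finset V)
    (ℓ t i j : ℕ) : Prop :=
  ∀ u ∈ L i, ∀ v ∈ L j, linPathCount G L i j u v ≤ Rc ℓ t (j - i - 1)

/-- The pair of layers `(L i, L j)` is almost-regular: every pair `(L i', L j')` with
`i ≤ i' < j' ≤ j` and `(i', j') ≠ (i, j)` is regular. -/
def AlmostRegularPair {V : Type*} (G : SimpleGraph V) (L : ℕ → Finset V)
    (ℓ t i j : ℕ) : Prop :=
  ∀ i' j', i ≤ i' → i' < j' → j' ≤ j → (i', j') ≠ (i, j) → RegularPair G L ℓ t i' j'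

section LinearPaths

open Finset

variable {V : Type*} (G : SimpleGraph V) (L : ℕ → Finset V)

lemma linPathCount_self {i : ℕ} {u : V} (hu : u ∈ L i) : linPathCount G L i i u u = 1 := by
  rw [linPathCount, Nat.card_eq_one_iff_unique]
  refine ⟨⟨?_⟩, ⟨fun _ => u, rfl, rfl, ?_, ?_, fun _ _ => rfl⟩⟩
  · rintro ⟨p, hp, -, -, -, hp'⟩ ⟨q, hq, -, -, -, hq'⟩
    ext s
    rcases lt_trichotomy s i with h | rfl | h
    · simp [hp' s (.inl h), hq' s (.inl h)]
    · simp [hp, hq]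
    · simp [hp' s (.inr h), hq' s (.inr h)]
  · intro s h h'
    rwa [le_antisymm h' h]
  · intro s h h'
    omega

lemma linPathCount_self_of_ne {i : ℕ} {u v : V} (h : u ≠ v) :
    linPathCount G L i i u v = 0 := by
  rw [linPathCount, Nat.card_eq_zero]
  refine .inl ⟨?_⟩
  rintro ⟨p, hp, hp', -⟩
  exact h (hp.symm.trans hp')

lemma finite_linPaths [Finite V] (i j : ℕ) (u v : V) :
    Finite {p : ℕ → V // p i = u ∧ p j = v ∧ (∀ s, i ≤ s → s ≤ j → p s ∈ L s) ∧
      (∀ s, i ≤ s → s < j → G.Adj (p s) (p (s + 1))) ∧ (∀ s, s < i ∨ j < s → p s = u)} := by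
  refine Finite.of_injective (β := Fin (j + 1) → V) (fun p s => p.1 s) ?_
  rintro ⟨p, _, _, _, _, hp⟩ ⟨q, _, _, _, _, hq⟩ h
  refine Subtype.ext (funext fun s => ?_)
  rcases lt_or_ge j s with hs | hs
  · simp [hp s (.inr hs), hq s (.inr hs)]
  · exact congrFun h ⟨s, Nat.lt_succ_of_le hs⟩

/-- A linear path to `L (j + 1)` is a linear path to `L j` followed by an edge. -/
lemma linPathCount_succ [Fintype V] [DecidableRel G.Adj] {i j : ℕ} (hij : i ≤ j) (u : V) {b : V}
    (hb : b ∈ L (j + 1)) :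
    linPathCount G L i (j + 1) u b = ∑ c ∈ L j with G.Adj c b, linPathCount G L i j u c := by
  classical
  have := finite_linPaths G L i j u
  have e : {p : ℕ → V // p i = u ∧ p (j + 1) = b ∧ (∀ s, i ≤ s → s ≤ j + 1 → p s ∈ L s) ∧
      (∀ s, i ≤ s → s < j + 1 → G.Adj (p s) (p (s + 1))) ∧ (∀ s, s < i ∨ j + 1 < s → p s = u)} ≃
      Σ c : {c : V // c ∈ (L j).filter (G.Adj · b)},
        {p : ℕ → V // p i = u ∧ p j = c ∧ (∀ s, i ≤ s → s ≤ j → p s ∈ L s) ∧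
          (∀ s, i ≤ s → s < j → G.Adj (p s) (p (s + 1))) ∧ (∀ s, s < i ∨ j < s → p s = u)} :=
    { toFun := fun p => ⟨⟨p.1 j, by
          obtain ⟨p, h1, h2, h3, h4, h5⟩ := p
          have := h4 j hij (by omega)
          simp only [h2] at this
          simpa [this] using h3 j hij (by omega)⟩,
        ⟨Function.update p.1 (j + 1) u, by
          obtain ⟨p, h1, h2, h3, h4, h5⟩ := p
          have hne : ∀ s, s ≤ j → Function.update p (j + 1) u s = p s := fun s hs =>
            Function.update_of_ne (by omega) _ _
          refine ⟨by simp [hne i hij, h1], hne j le_rfl, fun s h h' => ?_, fun s h h' => ?_,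
            fun s h => ?_⟩
          · simpa only [hne s h'] using h3 s h (by omega)
          · simpa only [hne s h'.le, hne (s + 1) h'] using h4 s h (by omega)
          · by_cases hs : s = j + 1
            · simp [hs]
            · simpa [hs] using h5 s (by omega)⟩⟩
      invFun := fun x => ⟨Function.update x.2.1 (j + 1) b, by
          obtain ⟨⟨c, hc⟩, p, h1, h2, h3, h4, h5⟩ := x
          have hc' : G.Adj c b := (mem_filter.1 hc).2
          have hne : ∀ s, s ≤ j → Function.update p (j + 1) b s = p s := fun s hs =>
            Function.update_of_ne (by omega) _ _
          refine ⟨by simp [hne i hij, h1], by simp, fun s h h' => ?_, fun s h h' => ?_,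
            fun s h => ?_⟩
          · rcases h'.eq_or_lt with rfl | h'
            · simpa using hb
            · simpa only [hne s (by omega)] using h3 s h (by omega)
          · rcases (Nat.lt_succ_iff.1 h').eq_or_lt with rfl | h'
            · simpa [h2] using hc'
            · simpa only [hne s h'.le, hne (s + 1) h'] using h4 s h h'
          · simpa [show s ≠ j + 1 by omega] using h5 s (by omega)⟩
      left_inv := by
        rintro ⟨p, h1, h2, h3, h4, h5⟩
        simp [← h2]
      right_inv := by
        rintro ⟨⟨c, hc⟩, p, h1, h2, h3, h4, h5⟩
        obtain rfl : p j = c := h2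
        have hu : p (j + 1) = u := h5 _ (by omega)
        refine Sigma.subtype_ext ?_ ?_ <;> simp [← hu] }
  rw [linPathCount, Nat.card_congr e, Nat.card_sigma]
  exact Finset.sum_coe_sort ((L j).filter (G.Adj · b)) (fun c => linPathCount G L i j u c)

/-- The number of linear paths from a vertex of `A ⊆ L i` to the vertex `c ∈ L j`. -/
noncomputable def linPathCountFrom (A : Finset V) (i j : ℕ) (c : V) : ℕ :=
  ∑ a ∈ A, linPathCount G L i j a c

variable [Fintype V] [DecidableRel G.Adj]

lemma linPathCountFrom_succ (A : Finset V) {i j : ℕ} (hij : i ≤ j) {b : V} (hb : b ∈ L (j + 1)) :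
    linPathCountFrom G L A i (j + 1) b =
      ∑ c ∈ L j with G.Adj c b, linPathCountFrom G L A i j c := by
  simp only [linPathCountFrom, linPathCount_succ G L hij _ hb]
  exact sum_comm

lemma linPathCountSet_succ (A : Finset V) {B : Finset V} {i j : ℕ} (hij : i ≤ j)
    (hB : B ⊆ L (j + 1)) :
    linPathCountSet G L i (j + 1) A B =
      ∑ b ∈ B, ∑ c ∈ L j with G.Adj c b, linPathCountFrom G L A i j c := by
  rw [linPathCountSet, sum_comm]
  exact sum_congr rfl fun b hb => linPathCountFrom_succ G L A hij (hB hb)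

lemma sum_linPathCount_le {D : ℕ} (hD : ∀ u, G.degree u ≤ D) {i j : ℕ} (hij : i ≤ j) (u : V) :
    ∑ c ∈ L j, linPathCount G L i j u c ≤ D ^ (j - i) := by
  classical
  induction j, hij using Nat.le_induction with
  | base =>
    by_cases hu : u ∈ L i
    · rw [sum_eq_single_of_mem u hu fun c _ hc => linPathCount_self_of_ne G L hc.symm]
      simp [linPathCount_self G L hu]
    · rw [sum_eq_zero fun c hc => linPathCount_self_of_ne G L (ne_of_mem_of_not_mem hc hu).symm]
      exact Nat.zero_le _
  | succ j hij ih =>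
    calc ∑ b ∈ L (j + 1), linPathCount G L i (j + 1) u b
        = ∑ b ∈ L (j + 1), ∑ c ∈ L j, if G.Adj c b then linPathCount G L i j u c else 0 :=
          sum_congr rfl fun b hb => by rw [linPathCount_succ G L hij u hb, sum_filter]
      _ = ∑ c ∈ L j, #{b ∈ L (j + 1) | G.Adj c b} * linPathCount G L i j u c := by
          rw [sum_comm]
          exact sum_congr rfl fun c _ => by rw [← sum_filter, sum_const, smul_eq_mul]
      _ ≤ ∑ c ∈ L j, D * linPathCount G L i j u c := by
          refine sum_le_sum fun c _ => Nat.mul_le_mul_right _ ((card_le_card ?_).trans (hD c))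
          intro b hb
          simpa using (mem_filter.1 hb).2
      _ ≤ D * D ^ (j - i) := by
          rw [← mul_sum]
          exact Nat.mul_le_mul_left _ ih
      _ = D ^ (j + 1 - i) := by
          rw [Nat.succ_sub hij, pow_succ, mul_comm]

lemma linPathCountFrom_le {A : Finset V} {i j : ℕ} {v : V} (hv : v ∈ L i)
    (hA : ∀ a ∈ A, G.Adj v a) (hij : i + 1 ≤ j) {c : V} (hc : c ∈ L j) :
    linPathCountFrom G L A (i + 1) j c ≤ linPathCount G L i j v c := by
  classical
  induction j, hij using Nat.le_induction generalizing c with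
  | base =>
    by_cases hcA : c ∈ A
    · rw [linPathCountFrom, linPathCount_succ G L le_rfl v hc,
        sum_eq_single_of_mem c hcA fun a _ ha => linPathCount_self_of_ne G L ha,
        linPathCount_self G L hc, ← linPathCount_self G L hv]
      exact single_le_sum (f := fun x => linPathCount G L i i v x) (fun _ _ => Nat.zero_le _)
        (mem_filter.2 ⟨hv, hA c hcA⟩)
    · rw [linPathCountFrom, sum_eq_zero fun a ha => linPathCount_self_of_ne G L
        (ne_of_mem_of_not_mem ha hcA)]
      exact Nat.zero_le _
  | succ j hij ih =>
    rw [linPathCountFrom_succ G L A hij hc, linPathCount_succ G L (by omega) v hc]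
    exact sum_le_sum fun c' hc' => ih (mem_filter.1 hc').1

/-- If no linear path from `A` to `c` avoids `S`, then each of them passes through a vertex
of `S`, which bounds their number. -/
lemma exists_path_or_linPathCountFrom_le [DecidableEq V] {A : Finset V} (S : Finset V) {i j : ℕ}
    (hdisj : ∀ s s', s ≤ j → s' ≤ j → s ≠ s' → Disjoint (L s) (L s'))
    (hij : i ≤ j) {c : V} (hc : c ∈ L j) :
    (∃ a ∈ A, ∃ p : G.Walk c a, p.IsPath ∧ p.length + i = j ∧
      ∀ x ∈ p.support, x ∉ S ∧ ∃ s ≤ j, x ∈ L s) ∨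
    linPathCountFrom G L A i j c ≤
      ∑ s ∈ Icc i j, ∑ u ∈ S ∩ L s, linPathCountFrom G L A i s u * linPathCount G L s j u c := by
  have hself : ∀ j, i ≤ j → ∀ c ∈ L j, c ∈ S → linPathCountFrom G L A i j c ≤
      ∑ s ∈ Icc i j, ∑ u ∈ S ∩ L s, linPathCountFrom G L A i s u * linPathCount G L s j u c := by
    intro j hij c hc hcS
    calc linPathCountFrom G L A i j c
        = linPathCountFrom G L A i j c * linPathCount G L j j c c := by
          rw [linPathCount_self G L hc, mul_one]
      _ ≤ ∑ u ∈ S ∩ L j, linPathCountFrom G L A i j u * linPathCount G L j j u c :=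
          single_le_sum (f := fun u => linPathCountFrom G L A i j u * linPathCount G L j j u c)
            (fun _ _ => Nat.zero_le _) (mem_inter.2 ⟨hcS, hc⟩)
      _ ≤ _ := single_le_sum (f := fun s => ∑ u ∈ S ∩ L s,
            linPathCountFrom G L A i s u * linPathCount G L s j u c)
            (fun _ _ => Nat.zero_le _) (mem_Icc.2 ⟨hij, le_rfl⟩)
  induction j, hij using Nat.le_induction generalizing c with
  | base =>
    by_cases hcS : c ∈ S
    · exact .inr (hself i le_rfl c hc hcS)
    by_cases hcA : c ∈ A
    · refine .inl ⟨c, hcA, .nil, .nil, by simp, fun x hx => ?_⟩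
      obtain rfl : x = c := by simpa using hx
      exact ⟨hcS, i, le_rfl, hc⟩
    · right
      rw [linPathCountFrom, sum_eq_zero fun a ha => linPathCount_self_of_ne G L
        (ne_of_mem_of_not_mem ha hcA)]
      exact Nat.zero_le _
  | succ j hij ih =>
    by_cases hcS : c ∈ S
    · exact .inr (hself (j + 1) (by omega) c hc hcS)
    have ih' := fun c' (hc' : c' ∈ L j) =>
      ih (fun s s' hs hs' => hdisj s s' (by omega) (by omega)) hc'
    by_cases hex : ∃ c' ∈ L j, G.Adj c' c ∧ ∃ a ∈ A, ∃ p : G.Walk c' a, p.IsPath ∧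
        p.length + i = j ∧ ∀ x ∈ p.support, x ∉ S ∧ ∃ s ≤ j, x ∈ L s
    · obtain ⟨c', hc', hadj, a, ha, p, hp, hlen, hsupp⟩ := hex
      refine .inl ⟨a, ha, .cons hadj.symm p, hp.cons fun hmem => ?_, ?_, fun x hx => ?_⟩
      · obtain ⟨-, s, hs, hcs⟩ := hsupp c hmem
        exact disjoint_left.1 (hdisj s (j + 1) (by omega) le_rfl (by omega)) hcs hc
      · simp only [SimpleGraph.Walk.length_cons]
        omega
      · rcases List.mem_cons.1 (by simpa using hx) with rfl | hx
        · exact ⟨hcS, j + 1, le_rfl, hc⟩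
        · obtain ⟨h, s, hs, hxs⟩ := hsupp x hx
          exact ⟨h, s, by omega, hxs⟩
    · right
      calc linPathCountFrom G L A i (j + 1) c
          = ∑ c' ∈ L j with G.Adj c' c, linPathCountFrom G L A i j c' :=
            linPathCountFrom_succ G L A hij hc
        _ ≤ ∑ c' ∈ L j with G.Adj c' c, ∑ s ∈ Icc i j, ∑ u ∈ S ∩ L s,
              linPathCountFrom G L A i s u * linPathCount G L s j u c' := by
            refine sum_le_sum fun c' hc' => ?_
            obtain ⟨hc', hadj⟩ := mem_filter.1 hc'
            exact (ih' c' hc').resolve_left fun h => hex ⟨c', hc', hadj, h⟩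
        _ = ∑ s ∈ Icc i j, ∑ u ∈ S ∩ L s,
              linPathCountFrom G L A i s u * linPathCount G L s (j + 1) u c := by
            rw [sum_comm]
            refine sum_congr rfl fun s hs => ?_
            rw [sum_comm]
            refine sum_congr rfl fun u _ => ?_
            rw [linPathCount_succ G L (mem_Icc.1 hs).2 u hc, mul_sum]
        _ ≤ _ := sum_le_sum_of_subset (Icc_subset_Icc_right (Nat.le_succ j))

end LinearPaths

section Trimming

open Finset

/-- A weighted bipartite graph that is dense on average contains a nonempty part with large
minimum degree on one side and large minimum weight on the other. -/
lemma exists_trimmed_subsets {α β : Type*} (E : α → β → Prop) [∀ c b, Decidable (E c b)]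
    (w : α → ℕ) (r q : ℕ) (C : Finset α) (B : Finset β)
    (h : r * #B + q * ∑ c ∈ C, w c < 2 * ∑ b ∈ B, ∑ c ∈ C with E c b, w c) :
    ∃ C' ⊆ C, ∃ B' ⊆ B, (∃ c ∈ C', ∃ b ∈ B', E c b ∧ 0 < w c) ∧
      (∀ b ∈ B', r ≤ 2 * ∑ c ∈ C' with E c b, w c) ∧
      ∀ c ∈ C', 0 < w c → q ≤ 2 * #{b ∈ B' | E c b} := by
  classical
  induction hn : #B + #C using Nat.strong_induction_on generalizing B C with
  | _ n ih =>
    have hswap : ∀ C : Finset α, ∑ b ∈ B, ∑ c ∈ C with E c b, w c =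
        ∑ c ∈ C, #{b ∈ B | E c b} * w c := by
      intro C
      simp only [sum_filter]
      rw [sum_comm]
      exact sum_congr rfl fun c _ => by rw [← sum_filter, sum_const, smul_eq_mul]
    by_cases hb : ∃ b ∈ B, 2 * ∑ c ∈ C with E c b, w c < r
    · obtain ⟨b, hbB, hb⟩ := hb
      have h1 := add_sum_erase B (fun b => ∑ c ∈ C with E c b, w c) hbB
      have h2 := card_erase_add_one hbB
      obtain ⟨C', hC', B', hB', h⟩ := ih (#(B.erase b) + #C) (by omega) C (B.erase b) (by
        rw [← h1, ← h2] at h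
        linarith) rfl
      exact ⟨C', hC', B', hB'.trans (erase_subset b B), h⟩
    by_cases hc : ∃ c ∈ C, 0 < w c ∧ 2 * #{b ∈ B | E c b} < q
    · obtain ⟨c, hcC, hc0, hc⟩ := hc
      have h1 := add_sum_erase C w hcC
      have h2 := card_erase_add_one hcC
      have h3 := add_sum_erase C (fun c => #{b ∈ B | E c b} * w c) hcC
      obtain ⟨C', hC', B', hB', h⟩ := ih (#B + #(C.erase c)) (by omega) (C.erase c) B (by
        rw [hswap, ← h1, ← h3] at h
        rw [hswap]
        nlinarith [Nat.mul_le_mul_right (w c) hc.le]) rfl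
      exact ⟨C', hC'.trans (erase_subset c C), B', hB', h⟩
    push Not at hb hc
    refine ⟨C, Subset.rfl, B, Subset.rfl, ?_, hb, hc⟩
    have hpos : 0 < ∑ b ∈ B, ∑ c ∈ C with E c b, w c := by omega
    obtain ⟨b, hbB, hb0⟩ := exists_ne_zero_of_sum_ne_zero hpos.ne'
    obtain ⟨c, hc, hc0⟩ := exists_ne_zero_of_sum_ne_zero hb0
    obtain ⟨hcC, hE⟩ := mem_filter.1 hc
    exact ⟨c, hcC, b, hbB, hE, Nat.pos_of_ne_zero hc0⟩

end Trimming

lemma catalan_mul_catalan_le (a b : ℕ) : catalan a * catalan b ≤ catalan (a + b + 1) := by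
  rw [catalan_succ]
  have := Finset.single_le_sum
    (f := fun i : Fin (a + b).succ => catalan i * catalan (a + b - i))
    (fun _ _ => Nat.zero_le _) (Finset.mem_univ ⟨a, by omega⟩)
  simpa using this

lemma Rc_mul_Rc_le (ℓ t a b : ℕ) : 2 * ℓ * t * (Rc ℓ t a * Rc ℓ t b) ≤ Rc ℓ t (a + b + 1) := by
  calc 2 * ℓ * t * (Rc ℓ t a * Rc ℓ t b)
      = (2 * ℓ) ^ (a + b + 1) * (catalan a * catalan b) * t ^ (a + b + 1) := by
        simp only [Rc]
        ring
    _ ≤ _ := by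
        unfold Rc
        gcongr
        exact catalan_mul_catalan_le a b

lemma Rc_pos {ℓ t : ℕ} (hℓ : 0 < ℓ) (ht : 0 < t) (m : ℕ) : 0 < Rc ℓ t m := by
  have : 0 < catalan m := by
    rw [catalan_eq_centralBinom_div]
    exact Nat.div_pos (Nat.le_of_dvd (Nat.centralBinom_pos m) (Nat.succ_dvd_centralBinom m))
      m.succ_pos
  unfold Rc
  positivity

namespace SimpleGraph

open Finset

variable {V : Type*} {G : SimpleGraph V}

/-- Zigzag `n` times between `X` and `Y`, ending in `X`, then follow a path of length `m` to `A`,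
all the while avoiding `S`. -/
lemma exists_zigzag_path [DecidableEq V] {A : Finset V} {X Y : Set V} {N m : ℕ}
    (hX : ∀ b ∈ X, ∀ S : Finset V, #S < N → ∃ c ∈ Y, G.Adj b c ∧ c ∉ S)
    (hY : ∀ c ∈ Y, ∀ S : Finset V, #S < N → ∃ b ∈ X, G.Adj c b ∧ b ∉ S)
    (hXA : ∀ b ∈ X, ∀ S : Finset V, b ∉ S → #S < N →
      ∃ a ∈ A, ∃ p : G.Walk b a, p.IsPath ∧ p.length = m ∧ ∀ x ∈ p.support, x ∉ S)
    (n : ℕ) {y : V} (hy : (Even n ∧ y ∈ X) ∨ (Odd n ∧ y ∈ Y)) {S : Finset V} (hyS : y ∉ S)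
    (hS : #S + n < N) :
    ∃ a ∈ A, ∃ p : G.Walk y a, p.IsPath ∧ p.length = n + m ∧ ∀ x ∈ p.support, x ∉ S := by
  induction n generalizing y S with
  | zero => simpa using hXA y (by simpa using hy) S hyS (by simpa using hS)
  | succ n ih =>
    have hcard : #(insert y S) ≤ #S + 1 := card_insert_le y S
    obtain ⟨z, hz, hadj, hzS⟩ : ∃ z, ((Even n ∧ z ∈ X) ∨ (Odd n ∧ z ∈ Y)) ∧ G.Adj y z ∧
        z ∉ insert y S := by
      rcases hy with ⟨hn, hy⟩ | ⟨hn, hy⟩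
      · obtain ⟨c, hc, h⟩ := hX y hy (insert y S) (by omega)
        exact ⟨c, .inr ⟨by simpa [Nat.even_add_one] using hn, hc⟩, h⟩
      · obtain ⟨b, hb, h⟩ := hY y hy (insert y S) (by omega)
        exact ⟨b, .inl ⟨by simpa [Nat.odd_add_one] using hn, hb⟩, h⟩
    obtain ⟨a, ha, p, hp, hlen, hsupp⟩ := ih hz hzS (by omega)
    refine ⟨a, ha, .cons hadj p, hp.cons fun h => hsupp y h (mem_insert_self y S), ?_,
      fun x hx => ?_⟩
    · rw [Walk.length_cons, hlen]
      omega
    · rcases List.mem_cons.1 (by simpa using hx) with rfl | hx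
      · exact hyS
      · exact fun h => hsupp x hx (mem_insert_of_mem h)

/-- Greedily choosing paths of length `ℓ` between `x` and `y` yields a theta graph. -/
lemma hasTheta_of_forall_exists_path [DecidableEq V] {ℓ t : ℕ} {x y : V} (hxy : x ≠ y)
    (h : ∀ S : Finset V, #S ≤ (t - 1) * (ℓ - 1) → ∃ p : G.Walk x y, p.IsPath ∧ p.length = ℓ ∧
      ∀ z ∈ p.support, z ∈ S → z = x ∨ z = y) :
    G.HasTheta ℓ t := by
  have hinner : ∀ p : G.Walk x y, p.length = ℓ → #(p.support.toFinset \ {x, y}) ≤ ℓ - 1 := by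
    intro p hp
    have h1 := p.support.toFinset_card_le
    have h2 : ({x, y} : Finset V) ⊆ p.support.toFinset := by
      intro z hz
      rcases by simpa using hz with rfl | rfl <;> simp
    rw [card_sdiff_of_subset h2, card_pair hxy]
    simp only [Walk.length_support] at h1
    omega
  have hfam : ∀ n ≤ t, ∃ p : Fin n → G.Walk x y, (∀ i, (p i).IsPath ∧ (p i).length = ℓ) ∧
      ∀ i j, i ≠ j → ∀ z, z ∈ (p i).support → z ∈ (p j).support → z = x ∨ z = y := by
    intro n
    induction n with
    | zero => exact fun _ => ⟨Fin.elim0, fun i => i.elim0, fun i => i.elim0⟩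
    | succ n ih =>
      intro hn
      obtain ⟨p, hp, hdisj⟩ := ih (by omega)
      obtain ⟨q, hq, hqlen, hqS⟩ := h (univ.biUnion fun i => (p i).support.toFinset \ {x, y}) (by
        refine card_biUnion_le.trans ((sum_le_card_nsmul _ _ _ fun i _ => hinner _ (hp i).2).trans ?_)
        simp only [card_univ, Fintype.card_fin, smul_eq_mul]
        exact Nat.mul_le_mul_right _ (by omega))
      have hpq : ∀ i z, z ∈ (p i).support → z ∈ q.support → z = x ∨ z = y := by
        intro i z hz hzq
        by_contra hne
        exact hne (hqS z hzq (mem_biUnion.2 ⟨i, mem_univ i, by simpa [hz] using hne⟩))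
      refine ⟨Fin.snoc p q, fun i => ?_, fun i j => ?_⟩
      · refine Fin.lastCases ?_ (fun i => ?_) i
        · simpa using ⟨hq, hqlen⟩
        · simpa using hp i
      · refine Fin.lastCases ?_ (fun i => ?_) i <;> refine Fin.lastCases ?_ (fun j => ?_) j
        · simp
        · intro _ z hz hz'
          exact hpq j z (by simpa using hz') (by simpa using hz)
        · intro _ z hz hz'
          exact hpq i z (by simpa using hz) (by simpa using hz')
        · intro hij z hz hz'
          exact hdisj i j (by simpa using hij) z (by simpa using hz) (by simpa using hz')
  obtain ⟨p, hp, hdisj⟩ := hfam t le_rfl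
  refine ⟨x, y, fun i j => (p i).getVert j, hxy, fun i => by simp, fun i => ?_, fun i j j' hj => ?_,
    fun i j => ?_, fun i i' hi j j' hj => ?_⟩
  · simp [← (hp i).2]
  · exact Fin.ext ((hp i).1.getVert_injOn (by simp [(hp i).2]; omega)
      (by simp [(hp i).2]; omega) hj)
  · simpa using (p i).adj_getVert_succ (i := j) (by rw [(hp i).2]; exact j.2)
  · exact hdisj i i' hi _ ((p i).getVert_mem_support j)
      (hj ▸ (p i').getVert_mem_support j')

end SimpleGraph

open Finset in
/-- The embedding lemma: if `(L_{i-1}, L_k)` is almost-regular, `v ∈ L_{i-1}`,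
`A` is a nonempty set of neighbors of `v` in `L i`, `B ⊆ L k` is nonempty, and
`P(A,B) > 2ℓt(Δd)^{k-i-1}|A|` and `P(A,B) > R_{k-i}|B|`, then `G` contains `Θ_{ℓ,t}`. -/
theorem embedding_theta {V : Type} [Fintype V]
    (ℓ t d i k : ℕ) (hℓ : 3 ≤ ℓ) (ht : 2 ≤ t) (hd : 1 ≤ d)
    (hi : 1 ≤ i) (hik : i < k) (hkℓ : k - i ≤ ℓ - 1)
    (G : SimpleGraph V) [DecidableRel G.Adj] (hbip : G.Colorable 2)
    (hmax : ∀ v : V, G.degree v ≤ (20 * ℓ) ^ (2 * ℓ) * d)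
    (L : ℕ → Finset V)
    (hdisj : ∀ i' j', i' ≤ k → j' ≤ k → i' ≠ j' → Disjoint (L i') (L j'))
    (halmost : AlmostRegularPair G L ℓ t (i - 1) k)
    (v : V) (hv : v ∈ L (i - 1))
    (A B : Finset V) (hA0 : A.Nonempty) (hB0 : B.Nonempty)
    (hA : ∀ a ∈ A, a ∈ L i ∧ G.Adj v a) (hB : B ⊆ L k)
    (h1 : 2 * ℓ * t * ((20 * ℓ) ^ (2 * ℓ) * d) ^ (k - i - 1) * A.card
            < linPathCountSet G L i k A B)
    (h2 : Rc ℓ t (k - i) * B.card < linPathCountSet G L i k A B) :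
    G.HasTheta ℓ t := by
  classical
  obtain ⟨i, rfl⟩ : ∃ i', i = i' + 1 := ⟨i - 1, by omega⟩
  obtain ⟨k, rfl⟩ : ∃ k', k = k' + 1 := ⟨k - 1, by omega⟩
  obtain ⟨m, rfl⟩ : ∃ m, k = i + 1 + m := ⟨k - (i + 1), by omega⟩
  rw [Nat.add_sub_cancel] at hv halmost
  simp only [show i + 1 + m + 1 - (i + 1) = m + 1 by omega, Nat.add_sub_cancel] at h1 h2 hkℓ
  have hadjA : ∀ a ∈ A, G.Adj v a := fun a ha => (hA a ha).2
  set w := linPathCountFrom G L A (i + 1) (i + 1 + m) with hw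
  have hsum : ∑ c ∈ L (i + 1 + m), w c ≤ #A * ((20 * ℓ) ^ (2 * ℓ) * d) ^ m := by
    simp only [hw, linPathCountFrom]
    rw [sum_comm, ← smul_eq_mul]
    refine sum_le_card_nsmul _ _ _ fun a _ => ?_
    simpa using sum_linPathCount_le G L hmax (by omega : i + 1 ≤ i + 1 + m) a
  rw [linPathCountSet_succ G L A (by omega) hB] at h1 h2
  obtain ⟨C', hC', B', hB', ⟨c₀, hc₀, b₀, hb₀, -, hwc₀⟩, hdegB, hdegC⟩ :=
    exists_trimmed_subsets G.Adj w (Rc ℓ t (m + 1)) (2 * ℓ * t) (L (i + 1 + m)) B (by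
      have := Nat.mul_le_mul_left (2 * ℓ * t) hsum
      nlinarith)
  have hRpos : 0 < Rc ℓ t (m + 1) := Rc_pos (by omega) (by omega) _
  have hback : ∀ b ∈ B', ∀ S : Finset V, #S < ℓ * t → ∃ c ∈ C', 0 < w c ∧ G.Adj c b ∧
      ∃ a ∈ A, ∃ p : G.Walk c a, p.IsPath ∧ p.length = m ∧
        ∀ x ∈ p.support, x ∉ S ∧ ∃ s ≤ i + 1 + m, x ∈ L s := by
    intro b hb S hS
    have hbL := hB (hB' hb)
    by_contra! hno
    have hle : ∀ c ∈ C', G.Adj c b → w c ≤ ∑ s ∈ Icc (i + 1) (i + 1 + m), ∑ u ∈ S ∩ L s,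
        linPathCountFrom G L A (i + 1) s u * linPathCount G L s (i + 1 + m) u c := by
      intro c hc hcb
      rcases Nat.eq_zero_or_pos (w c) with h0 | h0
      · exact h0.le.trans (Nat.zero_le _)
      refine (exists_path_or_linPathCountFrom_le G L (A := A) S
        (fun s s' hs hs' => hdisj s s' (by omega) (by omega)) (by omega) (hC' hc)).resolve_left ?_
      rintro ⟨a, ha, p, hp, hlen, hsupp⟩
      obtain ⟨x, hx, hx'⟩ := hno c hc h0 hcb a ha p hp (by omega)
      obtain ⟨hxS, s, hs, hxs⟩ := hsupp x hx
      exact hx' hxS s hs hxs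
    have hterm : ∀ s ∈ Icc (i + 1) (i + 1 + m), ∀ u ∈ S ∩ L s,
        2 * ℓ * t * (linPathCountFrom G L A (i + 1) s u * linPathCount G L s (i + 1 + m + 1) u b) ≤
          Rc ℓ t (m + 1) := by
      intro s hs u hu
      obtain ⟨hs1, hs2⟩ := mem_Icc.1 hs
      obtain ⟨-, hu⟩ := mem_inter.1 hu
      have e1 := (linPathCountFrom_le G L hv hadjA hs1 hu).trans
        (halmost i s le_rfl (by omega) (by omega) (by simp; omega) v hv u hu)
      have e2 := halmost s (i + 1 + m + 1) (by omega) (by omega) le_rfl (by simp; omega) u hu b hbL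
      refine (Nat.mul_le_mul_left _ (Nat.mul_le_mul e1 e2)).trans ((Rc_mul_Rc_le ℓ t _ _).trans ?_)
      exact (congrArg (Rc ℓ t) (by omega)).le
    have hcard : ∑ s ∈ Icc (i + 1) (i + 1 + m), #(S ∩ L s) ≤ #S := by
      rw [← card_biUnion]
      · exact card_le_card (biUnion_subset.2 fun s _ => inter_subset_left)
      · intro s hs s' hs' hne
        rw [coe_Icc] at hs hs'
        exact (hdisj s s' (hs.2.trans (by omega)) (hs'.2.trans (by omega)) hne).mono
          inter_subset_right inter_subset_right
    have hbound : 2 * ℓ * t * ∑ c ∈ C' with G.Adj c b, w c ≤ #S * Rc ℓ t (m + 1) := by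
      calc 2 * ℓ * t * ∑ c ∈ C' with G.Adj c b, w c
          ≤ 2 * ℓ * t * ∑ c ∈ L (i + 1 + m) with G.Adj c b, ∑ s ∈ Icc (i + 1) (i + 1 + m),
              ∑ u ∈ S ∩ L s,
                linPathCountFrom G L A (i + 1) s u * linPathCount G L s (i + 1 + m) u c := by
            refine Nat.mul_le_mul_left _ ((sum_le_sum fun c hc => ?_).trans
              (sum_le_sum_of_subset (filter_subset_filter _ hC')))
            obtain ⟨hc, hcb⟩ := mem_filter.1 hc
            exact hle c hc hcb
        _ = ∑ s ∈ Icc (i + 1) (i + 1 + m), ∑ u ∈ S ∩ L s, 2 * ℓ * t *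
              (linPathCountFrom G L A (i + 1) s u * linPathCount G L s (i + 1 + m + 1) u b) := by
            rw [sum_comm, mul_sum]
            refine sum_congr rfl fun s hs => ?_
            rw [sum_comm, mul_sum]
            refine sum_congr rfl fun u _ => ?_
            rw [linPathCount_succ G L (mem_Icc.1 hs).2 u hbL,
              mul_sum (a := linPathCountFrom _ _ _ _ _ _)]
        _ ≤ ∑ s ∈ Icc (i + 1) (i + 1 + m), #(S ∩ L s) * Rc ℓ t (m + 1) :=
            sum_le_sum fun s hs => sum_le_card_nsmul _ _ _ (hterm s hs)
        _ ≤ #S * Rc ℓ t (m + 1) := by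
            rw [← sum_mul]
            exact Nat.mul_le_mul_right _ hcard
    have hb2 := Nat.mul_le_mul_left (ℓ * t) (hdegB b hb)
    have hlt := Nat.mul_lt_mul_of_pos_right hS hRpos
    nlinarith
  have hfwd : ∀ c ∈ C', 0 < w c → ∀ S : Finset V, #S < ℓ * t → ∃ b ∈ B', G.Adj c b ∧ b ∉ S := by
    intro c hc hwc S hS
    obtain ⟨b, hb, hbS⟩ := exists_mem_notMem_of_card_lt_card
      (show #S < #{b ∈ B' | G.Adj c b} by nlinarith [hdegC c hc hwc])
    exact ⟨b, (mem_filter.1 hb).1, (mem_filter.1 hb).2, hbS⟩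
  have hvL : ∀ s, i < s → s ≤ i + 1 + m + 1 → v ∉ L s := fun s hs hs' =>
    disjoint_left.1 (hdisj i s (by omega) hs' (by omega)) hv
  obtain ⟨n, hn⟩ : ∃ n, ℓ = n + (m + 1) + 1 := ⟨ℓ - (m + 2), by omega⟩
  obtain ⟨y, hyv, hy⟩ : ∃ y, y ≠ v ∧
      ((Even n ∧ y ∈ {b | b ∈ B'}) ∨ (Odd n ∧ y ∈ {c | c ∈ C' ∧ 0 < w c})) := by
    rcases Nat.even_or_odd n with hn | hn
    · exact ⟨b₀, ne_of_mem_of_not_mem (hB (hB' hb₀)) (hvL _ (by omega) le_rfl), .inl ⟨hn, hb₀⟩⟩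
    · exact ⟨c₀, ne_of_mem_of_not_mem (hC' hc₀) (hvL _ (by omega) (by omega)),
        .inr ⟨hn, hc₀, hwc₀⟩⟩
  refine SimpleGraph.hasTheta_of_forall_exists_path hyv fun S hS => ?_
  have hScard : #((insert v S).erase y) + n < ℓ * t := by
    have e1 := (card_le_card (erase_subset y (insert v S))).trans (card_insert_le v S)
    obtain ⟨t, rfl⟩ : ∃ t', t = t' + 1 := ⟨t - 1, by omega⟩
    rw [Nat.add_sub_cancel] at hS
    have e2 : t * (ℓ - 1) ≤ t * ℓ := Nat.mul_le_mul_left _ (Nat.sub_le _ _)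
    nlinarith
  obtain ⟨a, ha, p, hp, hlen, hsupp⟩ := SimpleGraph.exists_zigzag_path (A := A) (m := m + 1)
    (fun b hb S hS => by
      obtain ⟨c, hc, hwc, hcb, a, -, p, -, -, hsupp⟩ := hback b hb S hS
      exact ⟨c, ⟨hc, hwc⟩, hcb.symm, (hsupp c p.start_mem_support).1⟩)
    (fun c hc S hS => hfwd c hc.1 hc.2 S hS)
    (fun b hb S hbS hS => by
      obtain ⟨c, hc, -, hcb, a, ha, p, hp, hlen, hsupp⟩ := hback b hb S hS
      refine ⟨a, ha, .cons hcb.symm p, hp.cons fun hmem => ?_, by simp [hlen], fun x hx => ?_⟩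
      · obtain ⟨-, s, hs, hbs⟩ := hsupp b hmem
        exact disjoint_left.1 (hdisj s _ (by omega) le_rfl (by omega)) hbs (hB (hB' hb))
      · rcases List.mem_cons.1 (by simpa using hx) with rfl | hx
        · exact hbS
        · exact (hsupp x hx).1)
    n hy (notMem_erase y _) hScard
  refine ⟨p.concat (hadjA a ha).symm, hp.concat (fun h => hsupp v h ?_) _, ?_, fun z hz hzS => ?_⟩
  · exact mem_erase.2 ⟨hyv.symm, mem_insert_self v S⟩
  · rw [SimpleGraph.Walk.length_concat, hlen, hn]
  · by_contra! hne
    rw [SimpleGraph.Walk.support_concat, List.mem_append] at hz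
    rcases hz with hz | hz
    · exact hsupp z hz (mem_erase.2 ⟨hne.1, mem_insert_of_mem hzS⟩)
    · exact hne.2 (by simpa using hz)
end

section
/- Let ℓ ≥ 2, t ≥ 2, d ≥ 1 be integers, set Δ := (20ℓ)^{2ℓ}, R_m := (2ℓ)^m · C_m · t^m where C_m is the m-th Catalan number, τ_j := 2ℓt · Σ_{i=0}^{j−1} (i+1)Δ^i, and η_ℓ := Σ_{i=0}^{ℓ−2} ( (Δ+1)R_i + 2(i+1)ℓtΔ^i + τ_i ). Then every bipartite Θ_{ℓ,t}-free graph on n ≥ 1 vertices in which every vertex has degree at least d and at most Δd satisfies d^{ℓ−1} · ( d − η_ℓ − 2ℓ²tΔ^{ℓ−1} ) ≤ R_{ℓ−1} · n. -/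
/-- `Δ = (20ℓ)^{2ℓ}`. -/
def Δc (ℓ : ℕ) : ℕ := (20 * ℓ) ^ (2 * ℓ)

/-- `τ_j = 2ℓt · Σ_{i=0}^{j-1} (i+1)Δ^i`. -/
def τc (ℓ t j : ℕ) : ℕ := 2 * ℓ * t * ∑ i ∈ Finset.range j, (i + 1) * Δc ℓ ^ i

/-- `η_ℓ = Σ_{i=0}^{ℓ-2} ((Δ+1)R_i + 2(i+1)ℓtΔ^i + τ_i)`. -/
def ηc (ℓ t : ℕ) : ℕ :=
  ∑ i ∈ Finset.range (ℓ - 1),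
    ((Δc ℓ + 1) * Rc ℓ t i + 2 * (i + 1) * ℓ * t * Δc ℓ ^ i + τc ℓ t i)

open Finset in
/-- Edges of a relation whose nonempty subrelations all have a vertex of degree at most `K` can be
split so that every left vertex loses at most `K` edges and every right vertex keeps at most `K`. -/
theorem exists_removal_of_degenerate {α β : Type*} [DecidableEq α] [DecidableEq β] (K : ℕ)
    (r : α → β → Prop) [DecidableRel r] (D : Finset α) (W : Finset β)
    (h : ∀ D' ⊆ D, ∀ W' ⊆ W, (D'.Nonempty ∨ W'.Nonempty) →
      (∃ u ∈ D', #{w ∈ W' | r u w} ≤ K) ∨ (∃ w ∈ W', #{u ∈ D' | r u w} ≤ K)) :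
    ∃ rem : α → Finset β, (∀ u, #(rem u) ≤ K) ∧
      ∀ w ∈ W, #{u ∈ D | r u w ∧ w ∉ rem u} ≤ K := by
  induction hn : #D + #W using Nat.strong_induction_on generalizing D W with
  | _ n ih =>
    by_cases hne : D.Nonempty ∨ W.Nonempty
    · rcases h D subset_rfl W subset_rfl hne with ⟨u, hu, hK⟩ | ⟨w, hw, hK⟩
      · have hlt : #(D.erase u) < #D := card_erase_lt_of_mem hu
        obtain ⟨rem, hrem, hkeep⟩ := ih (#(D.erase u) + #W) (by omega) (D.erase u) W
          (fun D' hD' W' hW' => h D' (hD'.trans (erase_subset _ _)) W' hW') rfl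
        refine ⟨Function.update rem u {w ∈ W | r u w}, fun u' => ?_, fun w hw => ?_⟩
        · by_cases hu' : u' = u
          · subst hu'; simpa using hK
          · simpa [Function.update_of_ne hu'] using hrem u'
        · refine (card_le_card fun u' hu' => ?_).trans (hkeep w hw)
          simp only [mem_filter] at hu'
          obtain ⟨h1, h2, h3⟩ := hu'
          have hne : u' ≠ u := by
            rintro rfl
            simp [hw, h2] at h3
          rw [Function.update_of_ne hne] at h3
          simp [hne, h1, h2, h3]
      · have hlt : #(W.erase w) < #W := card_erase_lt_of_mem hw
        obtain ⟨rem, hrem, hkeep⟩ := ih (#D + #(W.erase w)) (by omega) D (W.erase w)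
          (fun D' hD' W' hW' => h D' hD' W' (hW'.trans (erase_subset _ _))) rfl
        refine ⟨rem, hrem, fun w' hw' => ?_⟩
        by_cases hww : w' = w
        · subst hww
          refine (card_le_card fun u' hu' => ?_).trans hK
          simp only [mem_filter] at hu' ⊢
          exact ⟨hu'.1, hu'.2.1⟩
        · exact hkeep w' (mem_erase.2 ⟨hww, hw'⟩)
    · refine ⟨fun _ => ∅, by simp, fun w hw => absurd (Or.inr ⟨w, hw⟩) hne⟩

/-- Among more than `B.card` pairwise disjoint lists, one avoids the set `B`. -/
theorem exists_mem_forall_notMem_of_card_lt {V : Type*} [DecidableEq V] (F : Finset (List V))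
    (B : Finset V) (hB : B.card < F.card)
    (hF : ∀ f ∈ F, ∀ f' ∈ F, f ≠ f' → ∀ x ∈ f, x ∉ f') : ∃ f ∈ F, ∀ x ∈ f, x ∉ B := by
  by_contra! hcon
  obtain ⟨f₀, hf₀⟩ := Finset.card_pos.1 (Nat.zero_lt_of_lt hB)
  obtain ⟨a₀, -⟩ := hcon f₀ hf₀
  have : Nonempty V := ⟨a₀⟩
  choose! a ha haB using hcon
  obtain ⟨f, hf, f', hf', hne, heq⟩ :=
    Finset.exists_ne_map_eq_of_card_lt_of_maps_to hB (f := a) (fun f hf => haB f hf)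
  exact hF f hf f' hf' hne (a f) (ha f hf) (heq ▸ ha f' hf')

namespace SimpleGraph

variable {V : Type*} {G : SimpleGraph V}

/-- A theta graph can be built greedily, one path at a time. The lists are the interiors of the
paths. -/
theorem hasTheta_of_forall_avoiding [DecidableEq V] {ℓ t : ℕ} {x y : V} (hxy : x ≠ y)
    (h : ∀ A : Finset V, A.card ≤ t * ℓ → ∃ q : List V, q.length + 1 = ℓ ∧
      (x :: (q ++ [y])).IsChain G.Adj ∧ (x :: (q ++ [y])).Nodup ∧ ∀ a ∈ q, a ∉ A) :
    G.HasTheta ℓ t := by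
  have key : ∀ n ≤ t, ∃ q : ℕ → List V, ∀ i < n, (q i).length + 1 = ℓ ∧
      (x :: (q i ++ [y])).IsChain G.Adj ∧ (x :: (q i ++ [y])).Nodup ∧
      ∀ j < i, ∀ a ∈ q i, a ∉ q j := by
    intro n
    induction n with
    | zero => exact fun _ => ⟨fun _ => [], by simp⟩
    | succ n ih =>
      intro hn
      obtain ⟨q, hq⟩ := ih (by omega)
      obtain ⟨p, hp1, hp2, hp3, hp4⟩ :=
        h ((Finset.range n).biUnion fun i => (q i).toFinset) (by
          refine (Finset.card_biUnion_le_card_mul _ _ ℓ fun i hi => ?_).trans ?_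
          · have := (hq i (Finset.mem_range.1 hi)).1
            exact (List.toFinset_card_le _).trans (by omega)
          · rw [Finset.card_range]
            exact Nat.mul_le_mul_right _ (by omega))
      refine ⟨Function.update q n p, fun i hi => ?_⟩
      rcases Nat.lt_succ_iff_lt_or_eq.1 hi with hi | rfl
      · rw [Function.update_of_ne (by omega)]
        refine ⟨(hq i hi).1, (hq i hi).2.1, (hq i hi).2.2.1, fun j hj => ?_⟩
        rw [Function.update_of_ne (by omega)]
        exact (hq i hi).2.2.2 j hj
      · rw [Function.update_self]
        refine ⟨hp1, hp2, hp3, fun j hj a ha haj => ?_⟩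
        rw [Function.update_of_ne (by omega)] at haj
        exact hp4 a ha (by simpa using ⟨j, hj, haj⟩)
  obtain ⟨q, hq⟩ := key t le_rfl
  have hlen : ∀ i : Fin t, (x :: (q i ++ [y])).length = ℓ + 1 := fun i => by
    have := (hq i i.2).1
    simp; omega
  have hdisj : ∀ i i' : Fin t, i ≠ i' → ∀ a ∈ q i, a ∉ q i' := by
    intro i i' hne a ha ha'
    rcases lt_or_gt_of_ne (Fin.val_ne_of_ne hne) with hlt | hlt
    · exact (hq i' i'.2).2.2.2 i hlt a ha' ha
    · exact (hq i i.2).2.2.2 i' hlt a ha ha'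
  refine ⟨x, y, fun i j => (x :: (q i ++ [y]))[(j : ℕ)]'(by rw [hlen i]; exact j.2), hxy,
    fun i => by simp, fun i => ?_, fun i j j' hjj => ?_, fun i j => ?_, fun i i' hne j j' hjj => ?_⟩
  · have h1 := (hq i i.2).1
    have : (x :: (q i ++ [y])) = (x :: q i) ++ [y] := rfl
    simp only [Fin.val_last, this]
    rw [List.getElem_append_right (by simp; omega)]
    simp
  · exact Fin.ext ((List.Nodup.getElem_inj_iff (hq i i.2).2.2.1).1 hjj)
  · exact List.isChain_iff_getElem.1 (hq i i.2).2.1 j (by rw [hlen i]; simp)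
  · set a := (x :: (q i ++ [y]))[(j : ℕ)]'(by rw [hlen i]; exact j.2) with ha
    have h1 : a ∈ x :: (q i ++ [y]) := List.getElem_mem _
    have h2 : a ∈ x :: (q i' ++ [y]) := by
      have h3 : a = (x :: (q i' ++ [y]))[(j' : ℕ)]'(by rw [hlen i']; exact j'.2) := hjj
      rw [h3]
      exact List.getElem_mem _
    simp only [List.mem_cons, List.mem_append, List.not_mem_nil, or_false] at h1 h2
    have := hdisj i i' hne a
    tauto

/-- Greedy paths of prescribed length alternating between two classes of large minimum degree,
avoiding a small set and ending in the second class. -/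
theorem exists_alternating_path [DecidableEq V] [DecidableRel G.Adj] (D W : Finset V) (K : ℕ)
    (hD : ∀ u ∈ D, K < (W.filter fun w => G.Adj u w).card)
    (hW : ∀ w ∈ W, K < (D.filter fun u => G.Adj u w).card) (s : ℕ) :
    ∀ (z : V) (A : Finset V), (Even s ∧ z ∈ W ∨ Odd s ∧ z ∈ D) → A.card + s ≤ K →
      ∃ q : List V, q.length = s ∧ (z :: q).IsChain G.Adj ∧ (z :: q).Nodup ∧
        (∀ a ∈ q, a ∉ A) ∧ ∃ w ∈ W, (z :: q).getLast? = some w := by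
  induction s with
  | zero =>
    intro z A hz _
    have hz : z ∈ W := by simpa using hz
    exact ⟨[], rfl, by simp, by simp, by simp, z, hz, by simp⟩
  | succ s ih =>
    intro z A hz hA
    have hcard : (insert z A).card ≤ A.card + 1 := Finset.card_insert_le _ _
    obtain ⟨y, hyA, hzy, hy⟩ : ∃ y, y ∉ insert z A ∧ G.Adj z y ∧
        (Even s ∧ y ∈ W ∨ Odd s ∧ y ∈ D) := by
      rcases hz with ⟨hs, hz⟩ | ⟨hs, hz⟩
      · obtain ⟨y, hy, hyA⟩ := Finset.exists_mem_notMem_of_card_lt_card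
          (show (insert z A).card < _ from lt_of_le_of_lt (by omega) (hW z hz))
        rw [Finset.mem_filter] at hy
        refine ⟨y, hyA, hy.2.symm, Or.inr ⟨?_, hy.1⟩⟩
        rwa [Nat.even_add_one, Nat.not_even_iff_odd] at hs
      · obtain ⟨y, hy, hyA⟩ := Finset.exists_mem_notMem_of_card_lt_card
          (show (insert z A).card < _ from lt_of_le_of_lt (by omega) (hD z hz))
        rw [Finset.mem_filter] at hy
        refine ⟨y, hyA, hy.2, Or.inl ⟨?_, hy.1⟩⟩
        rwa [Nat.odd_add_one, Nat.not_odd_iff_even] at hs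
    obtain ⟨q, h1, h2, h3, h4, w, hw, h5⟩ := ih y (insert z A) hy (by omega)
    refine ⟨y :: q, by simp [h1], ?_, ?_, ?_, w, hw, ?_⟩
    · exact List.isChain_cons_cons.2 ⟨hzy, h2⟩
    · refine List.nodup_cons.2 ⟨fun hmem => ?_, h3⟩
      rcases List.mem_cons.1 hmem with rfl | hmem
      · simp at hyA
      · exact h4 z hmem (by simp)
    · intro a ha
      rcases List.mem_cons.1 ha with rfl | ha
      · exact fun h => hyA (by simp [h])
      · exact fun h => h4 a ha (by simp [h])
    · rw [List.getLast?_cons_cons]; exact h5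

end SimpleGraph

namespace SimpleGraph

variable {V : Type*} {G : SimpleGraph V}

/-- A layered family of paths leaving `x₀`, written with the most recent vertex first, of length
at most `i`: vertices have well-defined levels, families of internally disjoint segments with at
least one interior vertex are small, and every path that is not of maximal length extends to all
but few of the neighbours of its end that lie on no earlier or equal level. -/
structure IsExploration (G : SimpleGraph V) (x₀ : V) (K i : ℕ) (Q : Finset (List V)) : Prop where
  root_mem : [x₀] ∈ Q
  ne_nil : [] ∉ Q
  length_le : ∀ l ∈ Q, l.length ≤ i + 1
  root_eq : ∀ y, [y] ∈ Q → y = x₀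
  adj : ∀ y u l, y :: u :: l ∈ Q → G.Adj y u
  tail_mem : ∀ y u l, y :: u :: l ∈ Q → u :: l ∈ Q
  level : ∀ y l l', y :: l ∈ Q → y :: l' ∈ Q → l.length = l'.length
  card_disjoint_le : ∀ (v w : V) (F : Finset (List V)),
    (∀ f ∈ F, f ≠ [] ∧ ∃ r, w :: (f ++ v :: r) ∈ Q) →
    (∀ f ∈ F, ∀ f' ∈ F, f ≠ f' → ∀ x ∈ f, x ∉ f') → F.card ≤ K
  card_missing_le : ∀ u l, u :: l ∈ Q → l.length < i → ∀ M : Finset V,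
    (∀ y ∈ M, G.Adj y u ∧ y :: u :: l ∉ Q ∧ ∀ l', y :: l' ∈ Q → l.length < l'.length) →
    M.card ≤ l.length * K

namespace IsExploration

variable {x₀ : V} {K i : ℕ} {Q : Finset (List V)}

theorem suffix_mem (hQ : IsExploration G x₀ K i Q) {a l : List V} {v : V}
    (h : a ++ v :: l ∈ Q) : v :: l ∈ Q := by
  induction a with
  | nil => exact h
  | cons b a ih =>
    apply ih
    cases a with
    | nil => exact hQ.tail_mem _ _ _ h
    | cons c a => exact hQ.tail_mem _ _ _ h

theorem isChain (hQ : IsExploration G x₀ K i Q) {l : List V} (h : l ∈ Q) : l.IsChain G.Adj := by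
  induction l with
  | nil => simp
  | cons y l ih =>
    cases l with
    | nil => simp
    | cons u l => exact List.isChain_cons_cons.2 ⟨hQ.adj _ _ _ h, ih (hQ.tail_mem _ _ _ h)⟩

theorem nodup (hQ : IsExploration G x₀ K i Q) {l : List V} (h : l ∈ Q) : l.Nodup := by
  induction l with
  | nil => simp
  | cons y l ih =>
    cases l with
    | nil => simp
    | cons u l =>
      refine List.nodup_cons.2 ⟨fun hy => ?_, ih (hQ.tail_mem _ _ _ h)⟩
      obtain ⟨a, b, hab⟩ := List.append_of_mem hy
      have h1 : y :: b ∈ Q := by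
        rw [hab] at h
        exact hQ.suffix_mem (a := y :: a) h
      have h2 := hQ.level _ _ _ h h1
      have h3 := congrArg List.length hab
      simp only [List.length_append, List.length_cons] at h2 h3
      omega

theorem eq_append_root (hQ : IsExploration G x₀ K i Q) {l : List V} (h : l ∈ Q) :
    ∃ f, l = f ++ [x₀] := by
  induction l with
  | nil => exact absurd h hQ.ne_nil
  | cons y l ih =>
    cases l with
    | nil => exact ⟨[], by simp [hQ.root_eq y h]⟩
    | cons u l =>
      obtain ⟨f, hf⟩ := ih (hQ.tail_mem _ _ _ h)
      exact ⟨y :: f, by simp [hf]⟩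

theorem color_eq (hQ : IsExploration G x₀ K i Q) (c : G.Coloring (Fin 2)) {y y' : V}
    {l l' : List V} (h : y :: l ∈ Q) (h' : y' :: l' ∈ Q) (hl : l.length = l'.length) :
    c y = c y' := by
  induction l generalizing y y' l' with
  | nil =>
    obtain rfl : l' = [] := List.length_eq_zero_iff.1 hl.symm
    rw [hQ.root_eq y h, hQ.root_eq y' h']
  | cons u l ih =>
    cases l' with
    | nil => simp at hl
    | cons u' l' =>
      have h1 := ih (hQ.tail_mem _ _ _ h) (hQ.tail_mem _ _ _ h') (by simpa using hl)
      have h2 := c.valid (hQ.adj _ _ _ h)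
      have h3 := c.valid (hQ.adj _ _ _ h')
      omega

/-- The number of segments with prescribed ends and `n` interior vertices is at most
`K ^ n * catalan n`. -/
theorem card_segments_le [DecidableEq V] (hQ : IsExploration G x₀ K i Q) (n : ℕ) :
    ∀ (v w : V) (S : Finset (List V)),
      (∀ f ∈ S, f.length = n ∧ ∃ r, w :: (f ++ v :: r) ∈ Q) → S.card ≤ K ^ n * catalan n := by
  classical
  induction n using Nat.strong_induction_on with
  | _ n ih =>
  intro v w S hS
  rcases n with _ | n
  · have : S ⊆ {[]} := fun f hf => by simpa using (hS f hf).1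
    simpa using Finset.card_le_card this
  let disj : Finset (List V) → Prop := fun F =>
    ∀ f ∈ F, ∀ f' ∈ F, f ≠ f' → ∀ x ∈ f, x ∉ f'
  obtain ⟨F, hFmem, hFmax⟩ := (S.powerset.filter disj).exists_max_image Finset.card
    ⟨∅, by simp [disj]⟩
  rw [Finset.mem_filter, Finset.mem_powerset] at hFmem
  obtain ⟨hFS, hFdisj⟩ := hFmem
  have hFcard : F.card ≤ K := by
    refine hQ.card_disjoint_le v w F (fun f hf => ⟨?_, (hS f (hFS hf)).2⟩) hFdisj
    rintro rfl
    simpa using (hS _ (hFS hf)).1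
  have hmeet : ∀ s ∈ S, ∃ f ∈ F, ∃ x ∈ s, x ∈ f := by
    intro s hs
    by_contra! hcon
    have hsF : s ∉ F := fun h => by
      cases s with
      | nil => simpa using (hS _ hs).1
      | cons x s => exact hcon _ h x (by simp) (by simp)
    have := hFmax (insert s F) (by
      rw [Finset.mem_filter, Finset.mem_powerset]
      refine ⟨Finset.insert_subset hs hFS, ?_⟩
      intro f hf f' hf' hne x hx hx'
      rcases Finset.mem_insert.1 hf with h1 | h1 <;> rcases Finset.mem_insert.1 hf' with h2 | h2
      · exact hne (h1.trans h2.symm)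
      · exact hcon f' h2 x (h1 ▸ hx) hx'
      · exact hcon f h1 x (h2 ▸ hx') hx
      · exact hFdisj f h1 f' h2 hne x hx hx')
    rw [Finset.card_insert_of_notMem hsF] at this
    omega
  -- segments whose interior passes through `x` at position `a`
  let T : List V → Fin (n + 1) → Finset (List V) := fun f a =>
    S.filter fun s => ∃ x s1 s2 f1 f2, f = f1 ++ x :: f2 ∧ s = s1 ++ x :: s2 ∧
      f1.length = (a : ℕ) ∧ s1.length = (a : ℕ)
  have hcover : S ⊆ F.biUnion fun f => Finset.univ.biUnion (T f) := by
    intro s hs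
    obtain ⟨f, hf, x, hxs, hxf⟩ := hmeet s hs
    obtain ⟨s1, s2, rfl⟩ := List.append_of_mem hxs
    obtain ⟨f1, f2, rfl⟩ := List.append_of_mem hxf
    obtain ⟨hsl, r, hr⟩ := hS _ hs
    obtain ⟨hfl, r', hr'⟩ := hS _ (hFS hf)
    simp only [List.append_assoc, List.cons_append] at hr hr'
    have h1 : x :: (s2 ++ v :: r) ∈ Q := hQ.suffix_mem (a := w :: s1) hr
    have h2 : x :: (f2 ++ v :: r') ∈ Q := hQ.suffix_mem (a := w :: f1) hr'
    have h3 := hQ.level _ _ _ (hQ.suffix_mem (a := x :: s2) h1)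
      (hQ.suffix_mem (a := x :: f2) h2)
    have h4 := hQ.level _ _ _ h1 h2
    simp only [List.length_append, List.length_cons] at h4 hsl hfl
    simp only [Finset.mem_biUnion, Finset.mem_univ, true_and]
    refine ⟨_, hf, ⟨s1.length, by omega⟩, Finset.mem_filter.2
      ⟨hs, x, s1, s2, f1, f2, rfl, rfl, ?_, rfl⟩⟩
    simp only
    omega
  have hT : ∀ f ∈ F, ∀ a : Fin (n + 1),
      (T f a).card ≤ (K ^ (a : ℕ) * catalan a) * (K ^ (n - a) * catalan (n - a)) := by
    intro f hf a
    have ha : (a : ℕ) < n + 1 := a.2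
    have hal : (a : ℕ) < f.length := by rw [(hS f (hFS hf)).1]; exact ha
    have hform : ∀ s ∈ T f a, ∃ s1 s2, s = s1 ++ f[a] :: s2 ∧ s1.length = (a : ℕ) ∧
        s2.length = n - a ∧ s ∈ S := by
      intro s hs
      obtain ⟨hsS, x, s1, s2, f1, f2, rfl, rfl, h1, h2⟩ := Finset.mem_filter.1 hs
      have := (hS _ hsS).1
      simp only [List.length_append, List.length_cons] at this
      refine ⟨s1, s2, ?_, h2, by omega, hsS⟩
      congr 2
      simp only [Fin.getElem_fin]
      rw [List.getElem_append_right (by omega)]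
      simp [h1]
    have hsplit : ∀ s1 s2 : List V, s1.length = (a : ℕ) → (s1 ++ f[a] :: s2).take a = s1 ∧
        (s1 ++ f[a] :: s2).drop (a + 1) = s2 := by
      intro s1 s2 h1
      constructor
      · rw [← h1, List.take_left]
      · rw [← h1, List.drop_append]; simp
    calc (T f a).card
        ≤ (((T f a).image (List.take a)) ×ˢ ((T f a).image (List.drop (a + 1)))).card := by
          refine Finset.card_le_card_of_injOn (fun s => (s.take a, s.drop (a + 1))) ?_ ?_
          · intro s hs
            exact Finset.mem_product.2
              ⟨Finset.mem_image_of_mem _ hs, Finset.mem_image_of_mem _ hs⟩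
          · intro s hs s' hs' heq
            obtain ⟨s1, s2, rfl, h1, -, -⟩ := hform s hs
            obtain ⟨s1', s2', rfl, h1', -, -⟩ := hform s' hs'
            simp only [Prod.mk.injEq] at heq
            rw [(hsplit _ _ h1).1, (hsplit _ _ h1).2, (hsplit _ _ h1').1,
              (hsplit _ _ h1').2] at heq
            rw [heq.1, heq.2]
      _ ≤ _ := by
          rw [Finset.card_product]
          refine Nat.mul_le_mul (ih a ha f[a] w _ fun g hg => ?_)
            (ih (n - a) (by omega) v f[a] _ fun g hg => ?_)
          · obtain ⟨s, hs, rfl⟩ := Finset.mem_image.1 hg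
            obtain ⟨s1, s2, rfl, h1, h2, hsS⟩ := hform s hs
            obtain ⟨-, r, hr⟩ := hS _ hsS
            rw [(hsplit _ _ h1).1]
            exact ⟨h1, s2 ++ v :: r, by simpa using hr⟩
          · obtain ⟨s, hs, rfl⟩ := Finset.mem_image.1 hg
            obtain ⟨s1, s2, rfl, h1, h2, hsS⟩ := hform s hs
            obtain ⟨-, r, hr⟩ := hS _ hsS
            rw [(hsplit _ _ h1).2]
            refine ⟨h2, r, hQ.suffix_mem (a := w :: s1) (by simpa using hr)⟩
  calc S.card ≤ ∑ f ∈ F, ∑ a, (T f a).card :=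
        (Finset.card_le_card hcover).trans (Finset.card_biUnion_le.trans
          (Finset.sum_le_sum fun f _ => Finset.card_biUnion_le))
    _ ≤ ∑ f ∈ F, ∑ a : Fin (n + 1), K ^ n * (catalan a * catalan (n - a)) := by
        refine Finset.sum_le_sum fun f hf => Finset.sum_le_sum fun a _ => (hT f hf a).trans ?_
        have : K ^ n = K ^ (a : ℕ) * K ^ (n - a) := by
          rw [← pow_add]; congr 1; have := a.2; omega
        rw [this]
        apply le_of_eq
        ring
    _ = F.card * (K ^ n * catalan (n + 1)) := by
        rw [Finset.sum_const, smul_eq_mul, catalan_succ, ← Finset.mul_sum]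
    _ ≤ K * (K ^ n * catalan (n + 1)) := Nat.mul_le_mul_right _ hFcard
    _ = K ^ (n + 1) * catalan (n + 1) := by ring

end IsExploration

end SimpleGraph

namespace SimpleGraph

variable {V : Type*} {G : SimpleGraph V}

theorem isExploration_zero (x₀ : V) (K : ℕ) : IsExploration G x₀ K 0 {[x₀]} where
  root_mem := by simp
  ne_nil := by simp
  length_le := by simp
  root_eq := by simp
  adj := by simp
  tail_mem := by simp
  level := by simp +contextual
  card_disjoint_le := by
    intro v w F hF _
    have : F = ∅ := Finset.eq_empty_of_forall_notMem fun f hf => by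
      obtain ⟨-, r, hr⟩ := hF f hf
      simp at hr
    simp [this]
  card_missing_le := by
    intro u l _ hl
    omega

namespace IsExploration

variable {x₀ : V} {K i : ℕ} {Q : Finset (List V)}

/-- The vertices of level `i` below `v`. -/
def Descendant (Q : Finset (List V)) (i : ℕ) (v u : V) : Prop :=
  ∃ f r, u :: (f ++ v :: r) ∈ Q ∧ f.length + r.length + 2 = i + 1

/-- The new vertices joined to `v` by many internally disjoint paths whose last interior vertex has
level `i`. The lists are the interiors of the paths. -/
def Rich (G : SimpleGraph V) (Q : Finset (List V)) (K i : ℕ) (v w : V) : Prop :=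
  (∀ l, w :: l ∉ Q) ∧ ∃ F : Finset (List V), K < F.card ∧
    (∀ g ∈ F, (∃ u ∈ g.head?, G.Adj w u) ∧ ∃ r, g ++ v :: r ∈ Q ∧ g.length + r.length + 1 = i + 1) ∧
    ∀ f ∈ F, ∀ f' ∈ F, f ≠ f' → ∀ x ∈ f, x ∉ f'

/-- A dense bipartite graph between descendants of `v` and rich vertices yields a theta graph. -/
theorem hasTheta_of_dense [DecidableEq V] [DecidableRel G.Adj] {ℓ t : ℕ} (ht : 2 ≤ t) (hi : i < ℓ)
    (hQ : IsExploration G x₀ (2 * ℓ * t) i Q) (v : V) (D W : Finset V)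
    (hne : D.Nonempty ∨ W.Nonempty)
    (hDv : ∀ u ∈ D, Descendant Q i v u) (hWv : ∀ w ∈ W, Rich G Q (2 * ℓ * t) i v w)
    (hD : ∀ u ∈ D, 2 * ℓ * t < (W.filter fun w => G.Adj u w).card)
    (hW : ∀ w ∈ W, 2 * ℓ * t < (D.filter fun u => G.Adj u w).card) : G.HasTheta ℓ t := by
  have hDne : D.Nonempty := by
    rcases hne with h | ⟨w, hw⟩
    · exact h
    · obtain ⟨u, hu⟩ := Finset.card_pos.1 (Nat.zero_lt_of_lt (hW w hw))
      exact ⟨u, (Finset.mem_filter.1 hu).1⟩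
  obtain ⟨u₀, hu₀⟩ := hDne
  have hWne : W.Nonempty := by
    obtain ⟨w, hw⟩ := Finset.card_pos.1 (Nat.zero_lt_of_lt (hD u₀ hu₀))
    exact ⟨w, (Finset.mem_filter.1 hw).1⟩
  obtain ⟨w₀, hw₀⟩ := hWne
  obtain ⟨f₀, r₀, h₀, hl₀⟩ := hDv u₀ hu₀
  have hv : v :: r₀ ∈ Q := hQ.suffix_mem (a := u₀ :: f₀) h₀
  have hvW : ∀ w ∈ W, w ≠ v := by
    rintro w hw rfl
    exact (hWv w hw).1 _ hv
  have hvD : ∀ u ∈ D, u ≠ v := by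
    rintro u hu rfl
    obtain ⟨f, r, h, hl⟩ := hDv u hu
    have := hQ.level _ _ _ h hv
    simp only [List.length_append, List.length_cons] at this
    omega
  -- all paths from `v` to level `i + 1` have `f₀.length + 1` interior vertices
  obtain ⟨s, hs⟩ : ∃ s, s + (f₀.length + 1) + 1 = ℓ := ⟨ℓ - (f₀.length + 2), by omega⟩
  obtain ⟨z, hz⟩ : ∃ z, Even s ∧ z ∈ W ∨ Odd s ∧ z ∈ D := by
    rcases Nat.even_or_odd s with h | h
    · exact ⟨w₀, Or.inl ⟨h, hw₀⟩⟩
    · exact ⟨u₀, Or.inr ⟨h, hu₀⟩⟩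
  have hzv : z ≠ v := by
    rcases hz with ⟨-, h⟩ | ⟨-, h⟩
    · exact hvW z h
    · exact hvD z h
  have hbig : t * ℓ + 1 + (ℓ + 1) ≤ 2 * ℓ * t := by nlinarith
  refine hasTheta_of_forall_avoiding hzv fun A hA => ?_
  have hAv : (insert v A).card ≤ A.card + 1 := Finset.card_insert_le _ _
  obtain ⟨q, hq1, hq2, hq3, hq4, w, hw, hq5⟩ :=
    exists_alternating_path D W (2 * ℓ * t) hD hW s z (insert v A) hz (by omega)
  obtain ⟨-, F, hFcard, hF, hFdisj⟩ := hWv w hw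
  obtain ⟨g, hgF, hg⟩ := exists_mem_forall_notMem_of_card_lt F (A ∪ (z :: q).toFinset) (by
    have h1 := Finset.card_union_le A (z :: q).toFinset
    have h2 := List.toFinset_card_le (z :: q)
    simp only [List.length_cons] at h2
    omega) hFdisj
  obtain ⟨⟨u, hu, hwu⟩, r, hr, hgl⟩ := hF g hgF
  have hrr := hQ.level _ _ _ (hQ.suffix_mem hr) hv
  have hgchain := hQ.isChain hr
  have hgnodup := hQ.nodup hr
  have hgr : g ++ v :: r = (g ++ [v]) ++ r := by simp
  rw [hgr] at hgchain hgnodup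
  have hg1 := (List.isChain_append.1 hgchain).1
  have hg2 := (List.nodup_append.1 hgnodup).1
  have heq : z :: ((q ++ g) ++ [v]) = (z :: q) ++ (g ++ [v]) := by simp
  refine ⟨q ++ g, by simp only [List.length_append]; omega, ?_, ?_, ?_⟩
  · rw [heq]
    refine List.isChain_append.2 ⟨hq2, hg1, fun a ha b hb => ?_⟩
    rw [hq5] at ha
    obtain rfl : w = a := by simpa using ha
    cases g with
    | nil => simp at hu
    | cons c g =>
      obtain rfl : c = u := by simpa using hu
      obtain rfl : c = b := by simpa using hb
      exact hwu
  · rw [heq]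
    refine List.nodup_append.2 ⟨hq3, hg2, ?_⟩
    rintro a ha b hb rfl
    rcases List.mem_append.1 hb with hb | hb
    · exact hg a hb (Finset.mem_union_right _ (by simpa using ha))
    · obtain rfl : a = v := by simpa using hb
      rcases List.mem_cons.1 ha with rfl | ha
      · exact hzv rfl
      · exact hq4 a ha (Finset.mem_insert_self _ _)
  · intro a ha haA
    rcases List.mem_append.1 ha with ha | ha
    · exact hq4 a ha (Finset.mem_insert_of_mem haA)
    · exact hg a ha (Finset.mem_union_left _ haA)

/-- An exploration of a theta-free graph can be prolonged by one level. -/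
theorem exists_succ [Fintype V] [DecidableRel G.Adj] {ℓ t : ℕ} (ht : 2 ≤ t)
    (hi : i < ℓ) (hfree : ¬ G.HasTheta ℓ t) (hQ : IsExploration G x₀ (2 * ℓ * t) i Q) :
    ∃ Q', IsExploration G x₀ (2 * ℓ * t) (i + 1) Q' := by
  classical
  set K := 2 * ℓ * t with hK
  have hrem : ∀ v : V, ∃ rem : V → Finset V, (∀ u, (rem u).card ≤ K) ∧
      ∀ w, Rich G Q K i v w → (Finset.univ.filter fun u =>
        Descendant Q i v u ∧ G.Adj u w ∧ w ∉ rem u).card ≤ K := by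
    intro v
    obtain ⟨rem, h1, h2⟩ := exists_removal_of_degenerate K G.Adj
      (Finset.univ.filter (Descendant Q i v)) (Finset.univ.filter (Rich G Q K i v)) (by
        intro D hD W hW hne
        by_contra! hcon
        exact hfree (hQ.hasTheta_of_dense ht hi v D W hne
          (fun u hu => (Finset.mem_filter.1 (hD hu)).2)
          (fun w hw => (Finset.mem_filter.1 (hW hw)).2) hcon.1 hcon.2))
    refine ⟨rem, h1, fun w hw => ?_⟩
    have := h2 w (by simpa using hw)
    rwa [Finset.filter_filter] at this
  choose rem hrem1 hrem2 using hrem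
  let new : Finset (List V) := (Finset.univ ×ˢ Q).image (fun p => p.1 :: p.2) |>.filter fun l =>
    ∃ y u l', l = y :: u :: l' ∧ u :: l' ∈ Q ∧ l'.length = i ∧ (∀ m, y :: m ∉ Q) ∧ G.Adj y u ∧
      ∀ v ∈ l', y ∉ rem v u
  have hnew : ∀ y l, y :: l ∈ Q ∪ new ↔ y :: l ∈ Q ∨ ∃ u l', l = u :: l' ∧ u :: l' ∈ Q ∧
      l'.length = i ∧ (∀ m, y :: m ∉ Q) ∧ G.Adj y u ∧ ∀ v ∈ l', y ∉ rem v u := by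
    intro y l
    rw [Finset.mem_union]
    refine or_congr_right ?_
    simp only [new, Finset.mem_filter, Finset.mem_image, Finset.mem_product, Finset.mem_univ,
      true_and, Prod.exists]
    constructor
    · rintro ⟨-, y', u, l', heq, h⟩
      obtain ⟨rfl, rfl⟩ := List.cons_eq_cons.1 heq
      exact ⟨u, l', rfl, h⟩
    · rintro ⟨u, l', rfl, h⟩
      exact ⟨⟨y, _, h.1, rfl⟩, y, u, l', rfl, h⟩
  have hold : ∀ y l, y :: l ∈ Q ∪ new → l.length < i + 1 → y :: l ∈ Q := by
    intro y l h hl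
    rcases (hnew y l).1 h with h | ⟨u, l', rfl, -, h, -⟩
    · exact h
    · simp at hl; omega
  have hlen : ∀ y l, y :: l ∈ Q → l.length ≤ i := fun y l h => by
    simpa using hQ.length_le _ h
  refine ⟨Q ∪ new, ?_, ?_, ?_, ?_, ?_, ?_, ?_, ?_, ?_⟩
  · exact Finset.mem_union_left _ hQ.root_mem
  · intro h
    rcases Finset.mem_union.1 h with h | h
    · exact hQ.ne_nil h
    · simp [new] at h
  · intro l h
    cases l with
    | nil => simp
    | cons y l =>
      rcases (hnew y l).1 h with h | ⟨u, l', rfl, -, h, -⟩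
      · have := hlen _ _ h; simp; omega
      · simp [h]
  · intro y h
    exact hQ.root_eq y (hold _ _ h (by simp))
  · intro y u l h
    rcases (hnew _ _).1 h with h | ⟨u', l', heq, -, -, -, h, -⟩
    · exact hQ.adj _ _ _ h
    · obtain ⟨rfl, rfl⟩ := List.cons_eq_cons.1 heq
      exact h
  · intro y u l h
    rcases (hnew _ _).1 h with h | ⟨u', l', heq, h, -⟩
    · exact Finset.mem_union_left _ (hQ.tail_mem _ _ _ h)
    · rw [heq]
      exact Finset.mem_union_left _ h
  · intro y l l' h h'
    rcases (hnew _ _).1 h with h | ⟨u, m, rfl, -, h1, h2, -⟩ <;>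
      rcases (hnew _ _).1 h' with h' | ⟨u', m', rfl, -, h1', h2', -⟩
    · exact hQ.level _ _ _ h h'
    · exact absurd h (h2' _)
    · exact absurd h' (h2 _)
    · simp [h1, h1']
  · intro v w F hF hFdisj
    by_cases hw : ∃ m, w :: m ∈ Q
    · obtain ⟨m, hm⟩ := hw
      refine hQ.card_disjoint_le v w F (fun f hf => ⟨(hF f hf).1, ?_⟩) hFdisj
      obtain ⟨-, r, hr⟩ := hF f hf
      refine ⟨r, ?_⟩
      rcases (hnew _ _).1 hr with hr | ⟨_, _, _, _, _, hr, _⟩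
      · exact hr
      · exact absurd hm (hr m)
    push Not at hw
    have hF' : ∀ f ∈ F, ∃ u f' r, f = u :: f' ∧ u :: (f' ++ v :: r) ∈ Q ∧
        f'.length + r.length + 1 = i ∧ G.Adj w u ∧ w ∉ rem v u := by
      intro f hf
      obtain ⟨hne, r, hr⟩ := hF f hf
      obtain ⟨u, f', rfl⟩ := List.exists_cons_of_ne_nil hne
      rcases (hnew _ _).1 hr with hr | ⟨u', l', heq, h1, h2, -, h3, h4⟩
      · exact absurd hr (hw _)
      · obtain ⟨rfl, rfl⟩ := List.cons_eq_cons.1 heq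
        refine ⟨u, f', r, rfl, h1, ?_, h3, h4 v (by simp)⟩
        simp at h2; omega
    by_contra! hcard
    have hrich : Rich G Q K i v w := by
      refine ⟨hw, F, hcard, fun f hf => ?_, hFdisj⟩
      obtain ⟨u, f', r, rfl, h1, h2, h3, -⟩ := hF' f hf
      exact ⟨⟨u, by simp, h3⟩, r, h1, by simp; omega⟩
    refine absurd (hrem2 v w hrich) (not_le.2 (hcard.trans_le ?_))
    refine Finset.card_le_card_of_injOn (fun f => f.headD w) ?_ ?_
    · intro f hf
      obtain ⟨u, f', r, rfl, h1, h2, h3, h4⟩ := hF' f hf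
      simp only [Finset.coe_filter, Finset.mem_univ, true_and, Set.mem_ofPred_eq, List.headD_cons]
      exact ⟨⟨f', r, h1, by omega⟩, h3.symm, h4⟩
    · intro f hf g hg heq
      by_contra hne
      obtain ⟨u, f', r, rfl, -⟩ := hF' f hf
      obtain ⟨u', g', r', rfl, -⟩ := hF' g hg
      obtain rfl : u = u' := heq
      exact hFdisj _ hf _ hg hne u (by simp) (by simp)
  · intro u l hul hl M hM
    have hul' := hold _ _ hul hl
    rcases Nat.lt_succ_iff_lt_or_eq.1 hl with hl' | hl'
    · refine hQ.card_missing_le u l hul' hl' M fun y hy => ?_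
      obtain ⟨h1, h2, h3⟩ := hM y hy
      exact ⟨h1, fun h => h2 (Finset.mem_union_left _ h),
        fun l' h => h3 l' (Finset.mem_union_left _ h)⟩
    · have hsub : M ⊆ l.toFinset.biUnion fun v => rem v u := by
        intro y hy
        obtain ⟨h1, h2, h3⟩ := hM y hy
        by_contra hcon
        simp only [Finset.mem_biUnion, List.mem_toFinset, not_exists, not_and] at hcon
        refine h2 ((hnew _ _).2 (Or.inr ⟨u, l, rfl, hul', hl', fun m hm => ?_, h1, hcon⟩))
        have := h3 m (Finset.mem_union_left _ hm)
        have := hlen _ _ hm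
        omega
      refine (Finset.card_le_card hsub).trans ((Finset.card_biUnion_le_card_mul _ _ K
        fun v _ => hrem1 v u).trans (Nat.mul_le_mul_right _ (List.toFinset_card_le _)))

end IsExploration

theorem exists_isExploration [Fintype V] [DecidableRel G.Adj] {ℓ t : ℕ} (ht : 2 ≤ t)
    (hfree : ¬ G.HasTheta ℓ t) (x₀ : V) :
    ∀ i ≤ ℓ, ∃ Q, IsExploration G x₀ (2 * ℓ * t) i Q := by
  intro i
  induction i with
  | zero => exact fun _ => ⟨_, isExploration_zero x₀ _⟩
  | succ i ih =>
    intro hi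
    obtain ⟨Q, hQ⟩ := ih (by omega)
    exact hQ.exists_succ ht hi hfree

end SimpleGraph

namespace SimpleGraph.IsExploration

open Finset

variable {V : Type*} {G : SimpleGraph V} {x₀ : V} {K ℓ : ℕ} {Q : Finset (List V)}

/-- The paths with `i + 1` edges ending at `w` number at most `K ^ i * catalan i`. -/
theorem card_ending_le [DecidableEq V] (hQ : IsExploration G x₀ K ℓ Q) (i : ℕ) (w : V) :
    #{l ∈ Q | l.length = i + 2 ∧ l.headD x₀ = w} ≤ K ^ i * catalan i := by
  set E := {l ∈ Q | l.length = i + 2 ∧ l.headD x₀ = w} with hE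
  have hform : ∀ l ∈ E, ∃ f, l = w :: (f ++ [x₀]) ∧ f.length = i ∧ l ∈ Q := by
    intro l hl
    obtain ⟨hlQ, hlen, hw⟩ := mem_filter.1 hl
    cases l with
    | nil => simp at hlen
    | cons y l =>
      obtain rfl : y = w := hw
      cases l with
      | nil => simp at hlen
      | cons u l =>
        obtain ⟨f, hf⟩ := hQ.eq_append_root (hQ.tail_mem _ _ _ hlQ)
        refine ⟨f, by rw [hf], ?_, hlQ⟩
        rw [hf] at hlen
        simpa using hlen
  calc #E ≤ #(E.image fun l => l.tail.dropLast) := by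
        refine (card_image_of_injOn fun l hl l' hl' heq => ?_).ge
        obtain ⟨f, rfl, -⟩ := hform l hl
        obtain ⟨f', rfl, -⟩ := hform l' hl'
        simp only [List.tail_cons, List.dropLast_concat] at heq
        rw [heq]
    _ ≤ _ := by
        refine hQ.card_segments_le i x₀ w _ fun f hf => ?_
        obtain ⟨l, hl, rfl⟩ := mem_image.1 hf
        obtain ⟨f, rfl, hfl, hfQ⟩ := hform l hl
        simp only [List.tail_cons, List.dropLast_concat]
        exact ⟨hfl, [], hfQ⟩

/-- The number of paths with `i` edges. -/
def count (Q : Finset (List V)) (i : ℕ) : ℕ := #{l ∈ Q | l.length = i + 1}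

theorem le_count_one [Fintype V] [DecidableRel G.Adj] (hQ : IsExploration G x₀ K ℓ Q) (hℓ : 1 ≤ ℓ)
    {d : ℕ}
    (hd : d ≤ G.degree x₀) : d ≤ count Q 1 := by
  classical
  have hsub : ∀ y ∈ G.neighborFinset x₀, [y, x₀] ∈ Q := by
    intro y hy
    by_contra hcon
    rw [mem_neighborFinset] at hy
    have := hQ.card_missing_le x₀ [] hQ.root_mem (by simpa using Nat.lt_of_succ_le hℓ) {y} (by
      simp only [mem_singleton, forall_eq]
      refine ⟨hy.symm, hcon, fun l' hl' => ?_⟩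
      cases l' with
      | nil => exact absurd (hQ.root_eq y hl') hy.symm.ne
      | cons => simp)
    simp at this
  refine hd.trans ?_
  rw [← card_neighborFinset_eq_degree]
  refine card_le_card_of_injOn (fun y => [y, x₀]) (fun y hy => ?_) (fun y _ y' _ h => ?_)
  · simpa using hsub y hy
  · simpa using h

/-- The vertices that fail to prolong `l` although they lie on a later level, or on no level. -/
noncomputable def missing [Fintype V] (G : SimpleGraph V) (Q : Finset (List V)) :
    List V → Finset V
  | [] => ∅
  | u :: l => by
    classical
    exact {y | G.Adj y u ∧ y :: u :: l ∉ Q ∧ ∀ l', y :: l' ∈ Q → l.length < l'.length}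

theorem mem_missing [Fintype V] {u y : V} {l : List V} : y ∈ missing G Q (u :: l) ↔
    G.Adj y u ∧ y :: u :: l ∉ Q ∧ ∀ l', y :: l' ∈ Q → l.length < l'.length := by
  simp [missing]

theorem card_missing_le' [Fintype V] (hQ : IsExploration G x₀ K ℓ Q) {l : List V} (hl : l ∈ Q)
    (hlen : l.length ≤ ℓ) : #(missing G Q l) ≤ (l.length - 1) * K := by
  cases l with
  | nil => simp [missing]
  | cons u l =>
    exact hQ.card_missing_le u l hl (by simpa using hlen) _ fun y hy => mem_missing.1 hy

theorem degree_le [Fintype V] [DecidableEq V] [DecidableRel G.Adj]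
    (hQ : IsExploration G x₀ K ℓ Q) (c : G.Coloring (Fin 2))
    {i P : ℕ} (hi : i < ℓ) (hP : ∀ w, #{l ∈ Q | l.length = i + 1 ∧ l.headD x₀ = w} ≤ P)
    {w : V} {l : List V} (hl : w :: l ∈ Q) (hlen : l.length = i) :
    G.degree w ≤ #{y | y :: w :: l ∈ Q} + (i * K + P) +
      #{l' ∈ {l' ∈ Q | l'.length ≤ i} | w ∈ missing G Q l'} := by
  set P' := {l ∈ Q | l.length = i + 1 ∧ l.headD x₀ = w}
  set B := {l' ∈ {l' ∈ Q | l'.length ≤ i} | w ∈ missing G Q l'}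
  have hsub : G.neighborFinset w ⊆ ({y | y :: w :: l ∈ Q} : Finset V) ∪ missing G Q (w :: l) ∪
      P'.image (fun m => m.tail.headD x₀) ∪ B.image (fun m => m.headD x₀) := by
    intro y hy
    rw [mem_neighborFinset] at hy
    by_contra hcon
    simp only [mem_union, not_or, mem_filter, mem_univ, true_and, mem_missing, not_and,
      not_forall, not_lt] at hcon
    obtain ⟨⟨⟨h1, h2⟩, h3⟩, h4⟩ := hcon
    obtain ⟨l', hl', hll⟩ := h2 hy.symm h1
    have hlt : l'.length < l.length := by
      refine lt_of_le_of_ne hll fun h => c.valid hy (hQ.color_eq c hl hl' h.symm)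
    by_cases hgood : w :: y :: l' ∈ Q
    · refine h3 (mem_image.2 ⟨_, mem_filter.2 ⟨hgood, ?_, rfl⟩, rfl⟩)
      have := hQ.level _ _ _ hgood hl
      simp only [List.length_cons] at this ⊢
      omega
    · refine h4 (mem_image.2 ⟨y :: l', mem_filter.2 ⟨mem_filter.2 ⟨hl', ?_⟩, ?_⟩, rfl⟩)
      · simp only [List.length_cons]
        omega
      · refine mem_missing.2 ⟨hy, hgood, fun m hm => ?_⟩
        rw [hQ.level _ _ _ hm hl]
        exact hlt
  rw [← card_neighborFinset_eq_degree]
  have h0 := card_le_card hsub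
  have h1 := card_union_le (({y | y :: w :: l ∈ Q} : Finset V) ∪ missing G Q (w :: l) ∪
      P'.image (fun m => m.tail.headD x₀)) (B.image (fun m => m.headD x₀))
  have h2 := card_union_le (({y | y :: w :: l ∈ Q} : Finset V) ∪ missing G Q (w :: l))
      (P'.image (fun m => m.tail.headD x₀))
  have h3 := card_union_le ({y | y :: w :: l ∈ Q} : Finset V) (missing G Q (w :: l))
  have h4 := hQ.card_missing_le' hl (by simp only [List.length_cons]; omega)
  have h5 : #(P'.image (fun m => m.tail.headD x₀)) ≤ P := card_image_le.trans (hP w)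
  have h6 : #(B.image (fun m => m.headD x₀)) ≤ #B := card_image_le
  rw [List.length_cons, hlen, Nat.add_sub_cancel] at h4
  omega

theorem sum_card_missing_le [Fintype V] (hQ : IsExploration G x₀ K ℓ Q) {i : ℕ}
    (hi : i ≤ ℓ) : ∑ l ∈ Q with l.length ≤ i, #(missing G Q l) ≤
      K * ∑ a ∈ range i, a * count Q a := by
  have hmaps : ∀ l ∈ {l ∈ Q | l.length ≤ i}, l.length - 1 ∈ range i := by
    intro l hl
    obtain ⟨hl, hlen⟩ := mem_filter.1 hl
    have : l.length ≠ 0 := fun h => hQ.ne_nil (List.length_eq_zero_iff.1 h ▸ hl)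
    rw [mem_range]
    omega
  rw [← sum_fiberwise_of_maps_to hmaps, mul_sum]
  refine sum_le_sum fun a _ => ?_
  calc _ ≤ ∑ l ∈ {l ∈ {l ∈ Q | l.length ≤ i} | l.length - 1 = a}, a * K := by
        refine sum_le_sum fun l hl => ?_
        obtain ⟨hl', rfl⟩ := mem_filter.1 hl
        obtain ⟨hlQ, hlen⟩ := mem_filter.1 hl'
        exact hQ.card_missing_le' hlQ (hlen.trans hi)
    _ ≤ count Q a * (a * K) := by
        rw [sum_const, smul_eq_mul]
        refine Nat.mul_le_mul_right _ (card_le_card fun l hl => ?_)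
        obtain ⟨hl', rfl⟩ := mem_filter.1 hl
        obtain ⟨hlQ, hlen⟩ := mem_filter.1 hl'
        have : l.length ≠ 0 := fun h => hQ.ne_nil (List.length_eq_zero_iff.1 h ▸ hlQ)
        exact mem_filter.2 ⟨hlQ, by omega⟩
    _ = _ := by ring

/-- The number of paths grows by almost a factor `d` in every step. -/
theorem mul_count_le [Fintype V] [DecidableRel G.Adj]
    (hQ : IsExploration G x₀ K ℓ Q) (c : G.Coloring (Fin 2)) {d i : ℕ} (hd : ∀ v, d ≤ G.degree v)
    (hi : i + 1 < ℓ) :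
    d * count Q (i + 1) ≤ count Q (i + 2) +
      ((i + 1) * K + K ^ i * catalan i) * count Q (i + 1) +
      K ^ i * catalan i * (K * ∑ a ∈ range (i + 1), a * count Q a) := by
  classical
  set P := K ^ i * catalan i with hPdef
  have hP := hQ.card_ending_le i
  set L := {l ∈ Q | l.length = i + 1 + 1} with hL
  set L' := {l ∈ Q | l.length ≤ i + 1} with hL'
  have hdeg : ∀ l ∈ L, d ≤ #{y | y :: l ∈ Q} + ((i + 1) * K + P) +
      #{l' ∈ L' | l.headD x₀ ∈ missing G Q l'} := by
    intro l hl
    obtain ⟨hlQ, hlen⟩ := mem_filter.1 hl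
    obtain ⟨w, l, rfl⟩ := List.exists_cons_of_length_eq_add_one hlen
    exact (hd w).trans (hQ.degree_le c hi hP hlQ (by simpa using hlen))
  have h1 : ∑ l ∈ L, #{y | y :: l ∈ Q} ≤ count Q (i + 2) := by
    rw [← card_sigma]
    refine card_le_card_of_injOn (fun p => p.2 :: p.1) ?_ ?_
    · rintro ⟨l, y⟩ h
      simp only [hL, coe_sigma, Set.mem_sigma_iff, mem_coe, mem_filter, mem_univ, true_and] at h
      simp only [mem_coe, mem_filter]
      exact ⟨h.2, by simp [h.1.2]⟩
    · rintro ⟨l, y⟩ - ⟨l', y'⟩ - heq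
      obtain ⟨rfl, rfl⟩ := List.cons_eq_cons.1 heq
      rfl
  have h2 : ∑ l ∈ L, #{l' ∈ L' | l.headD x₀ ∈ missing G Q l'} ≤
      P * ∑ l' ∈ L', #(missing G Q l') := by
    have := sum_card_bipartiteAbove_eq_sum_card_bipartiteBelow (s := L) (t := L')
      (fun l l' => l.headD x₀ ∈ missing G Q l')
    simp only [bipartiteAbove, bipartiteBelow] at this
    rw [this, mul_sum]
    refine sum_le_sum fun l' _ => ?_
    refine card_le_mul_card_image_of_maps_to (f := fun l : List V => l.headD x₀)
      (fun l hl => (mem_filter.1 hl).2) P fun w _ => ?_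
    refine (card_le_card fun l hl => ?_).trans (hP w)
    simp only [hL, mem_filter] at hl ⊢
    exact ⟨hl.1.1.1, hl.1.1.2, hl.2⟩
  have h3 := hQ.sum_card_missing_le hi.le
  calc d * count Q (i + 1) = ∑ l ∈ L, d := by rw [sum_const, smul_eq_mul, mul_comm]; rfl
    _ ≤ ∑ l ∈ L, (#{y | y :: l ∈ Q} + ((i + 1) * K + P) +
        #{l' ∈ L' | l.headD x₀ ∈ missing G Q l'}) := sum_le_sum hdeg
    _ = ∑ l ∈ L, #{y | y :: l ∈ Q} + ((i + 1) * K + P) * count Q (i + 1) +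
        ∑ l ∈ L, #{l' ∈ L' | l.headD x₀ ∈ missing G Q l'} := by
      rw [sum_add_distrib, sum_add_distrib, sum_const, smul_eq_mul, mul_comm (#L)]; rfl
    _ ≤ _ := Nat.add_le_add (Nat.add_le_add_right h1 _) (h2.trans (Nat.mul_le_mul_left _ h3))

theorem count_le_mul_card [Fintype V] (hQ : IsExploration G x₀ K ℓ Q) (i : ℕ) :
    count Q (i + 1) ≤ K ^ i * catalan i * Fintype.card V := by
  classical
  refine card_le_mul_card_image_of_maps_to (f := fun l : List V => l.headD x₀) (t := univ)
    (fun l _ => mem_univ _) _ fun w _ => ?_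
  rw [filter_filter]
  exact hQ.card_ending_le i w

end SimpleGraph.IsExploration

/-- The growth recursion for path counts, solved. -/
theorem pow_mul_sub_sum_le {N b R : ℕ → ℕ} {m d K D : ℕ} (h1 : d ≤ N 1)
    (hD : 2 ≤ D)
    (hb : ∀ i < m, (D + 1) * R i + (i + 1) * K ≤ b i)
    (hd : ∀ i < m, b i + K * (m + 1) + 1 ≤ d)
    (hN : ∀ i < m, d * N (i + 1) ≤ N (i + 2) + ((i + 1) * K + R i) * N (i + 1) +
      R i * (K * ∑ a ∈ Finset.range (i + 1), a * N a)) :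
    (d : ℤ) ^ m * (d - ∑ i ∈ Finset.range m, (b i : ℤ)) ≤ N (m + 1) := by
  have hstep : ∀ i ≤ m, (K * ∑ a ∈ Finset.range (i + 1), a * N a ≤ D * N (i + 1)) ∧
      (d : ℤ) ^ i * (d - ∑ j ∈ Finset.range i, (b j : ℤ)) ≤ N (i + 1) := by
    intro i
    induction i with
    | zero =>
      intro _
      simpa using h1
    | succ i ih =>
      intro hi
      obtain ⟨ih1, ih2⟩ := ih (by omega)
      have hbi := hb i hi
      have hdi := hd i hi
      have hNi := hN i hi
      have hstep : d * N (i + 1) ≤ N (i + 2) + b i * N (i + 1) := by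
        have h1 := Nat.mul_le_mul_left (R i) ih1
        have h2 := Nat.mul_le_mul_right (N (i + 1)) hbi
        nlinarith
      have hgrow : (K * (m + 1) + 1) * N (i + 1) ≤ N (i + 2) := by
        have := Nat.mul_le_mul_right (N (i + 1)) hdi
        nlinarith
      refine ⟨?_, ?_⟩
      · rw [Finset.sum_range_succ, mul_add]
        have h2 : K * ((i + 1) * N (i + 1)) ≤ K * (m + 1) * N (i + 1) := by
          rw [mul_assoc]
          exact Nat.mul_le_mul_left _ (Nat.mul_le_mul_right _ (by omega))
        have h3 := Nat.mul_le_mul_left D hgrow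
        have h4 : K * (m + 1) * N (i + 1) ≤ D * (K * (m + 1) * N (i + 1)) :=
          Nat.le_mul_of_pos_left _ (by omega)
        nlinarith
      · rw [Finset.sum_range_succ]
        have hle : (d : ℤ) * N (i + 1) ≤ N (i + 2) + b i * N (i + 1) := by exact_mod_cast hstep
        have hpos : (0 : ℤ) ≤ d - b i := by
          have : (b i : ℤ) ≤ d := by exact_mod_cast (by omega : b i ≤ d)
          linarith
        have hS : (0 : ℤ) ≤ ∑ j ∈ Finset.range i, (b j : ℤ) :=
          Finset.sum_nonneg fun _ _ => by positivity
        have h5 := mul_le_mul_of_nonneg_right ih2 hpos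
        have h6 : (0 : ℤ) ≤ (d : ℤ) ^ i * ((∑ j ∈ Finset.range i, (b j : ℤ)) * b i) := by
          positivity
        calc (d : ℤ) ^ (i + 1) * (d - (∑ j ∈ Finset.range i, (b j : ℤ) + b i))
            = (d : ℤ) ^ i * (d - ∑ j ∈ Finset.range i, (b j : ℤ)) * (d - b i) -
              (d : ℤ) ^ i * ((∑ j ∈ Finset.range i, (b j : ℤ)) * b i) := by ring
          _ ≤ N (i + 1) * (d - b i) := by linarith
          _ ≤ _ := by linarith
  exact (hstep m le_rfl).2

theorem Rc_eq (ℓ t m : ℕ) : Rc ℓ t m = (2 * ℓ * t) ^ m * catalan m := by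
  rw [Rc, mul_pow (2 * ℓ)]
  ring

/-- Every bipartite `Θ_{ℓ,t}`-free graph on `n ≥ 1` vertices whose degrees all lie
between `d` and `Δd` satisfies `d^{ℓ-1}(d - η_ℓ - 2ℓ²tΔ^{ℓ-1}) ≤ R_{ℓ-1} n`. -/
theorem theta_degree_count_bound {V : Type} [Fintype V]
    (ℓ t d n : ℕ) (hℓ : 2 ≤ ℓ) (ht : 2 ≤ t) (hd : 1 ≤ d) (hn : 1 ≤ n)
    (G : SimpleGraph V) [DecidableRel G.Adj] (hcard : Fintype.card V = n)
    (hbip : G.Colorable 2) (hfree : ¬ G.HasTheta ℓ t)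
    (hmin : ∀ v : V, d ≤ G.degree v)
    (hmax : ∀ v : V, G.degree v ≤ Δc ℓ * d) :
    (d : ℤ) ^ (ℓ - 1) *
        ((d : ℤ) - (ηc ℓ t : ℤ) - 2 * (ℓ : ℤ) ^ 2 * (t : ℤ) * (Δc ℓ : ℤ) ^ (ℓ - 1))
      ≤ (Rc ℓ t (ℓ - 1) : ℤ) * (n : ℤ) := by
  by_cases htriv : (d : ℤ) ≤ ηc ℓ t + 2 * (ℓ : ℤ) ^ 2 * t * (Δc ℓ : ℤ) ^ (ℓ - 1)
  · have h1 : (d : ℤ) - ηc ℓ t - 2 * (ℓ : ℤ) ^ 2 * t * (Δc ℓ : ℤ) ^ (ℓ - 1) ≤ 0 := by linarith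
    exact (mul_nonpos_of_nonneg_of_nonpos (by positivity) h1).trans (by positivity)
  push Not at htriv
  obtain ⟨m, rfl⟩ : ∃ m, ℓ = m + 1 := ⟨ℓ - 1, by omega⟩
  simp only [Nat.add_sub_cancel] at htriv ⊢
  obtain ⟨c⟩ := hbip
  obtain ⟨x₀⟩ : Nonempty V := Fintype.card_pos_iff.1 (by omega)
  obtain ⟨Q, hQ⟩ := SimpleGraph.exists_isExploration ht hfree x₀ (m + 1) le_rfl
  set K := 2 * (m + 1) * t with hK
  set b : ℕ → ℕ := fun i => (Δc (m + 1) + 1) * Rc (m + 1) t i +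
    2 * (i + 1) * (m + 1) * t * Δc (m + 1) ^ i + τc (m + 1) t i with hb
  have hΔ : 2 ≤ Δc (m + 1) := by
    have : 20 ≤ 20 * (m + 1) := by omega
    exact (by omega : 2 ≤ 20 * (m + 1)).trans (Nat.le_self_pow (by omega) _)
  have hη : ηc (m + 1) t = ∑ i ∈ Finset.range m, b i := by simp [ηc, hb]
  have hd' : ∑ i ∈ Finset.range m, b i + K * (m + 1) + 1 ≤ d := by
    have h1 : 2 * (m + 1) ^ 2 * t ≤ 2 * (m + 1) ^ 2 * t * Δc (m + 1) ^ m :=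
      Nat.le_mul_of_pos_right _ (Nat.pow_pos (by omega))
    have h2 : ∑ i ∈ Finset.range m, b i + 2 * (m + 1) ^ 2 * t * Δc (m + 1) ^ m < d := by
      rw [← hη]
      exact_mod_cast htriv
    have h3 : K * (m + 1) = 2 * (m + 1) ^ 2 * t := by rw [hK]; ring
    omega
  have hone := hQ.le_count_one (by omega) (hmin x₀)
  have hmain := pow_mul_sub_sum_le (N := SimpleGraph.IsExploration.count Q) (b := b)
    (R := Rc (m + 1) t) (m := m) (d := d) (K := K) (D := Δc (m + 1)) hone hΔ
    (fun i _ => by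
      have h1 : (i + 1) * K ≤ 2 * (i + 1) * (m + 1) * t * Δc (m + 1) ^ i := by
        rw [show (i + 1) * K = 2 * (i + 1) * (m + 1) * t by rw [hK]; ring]
        exact Nat.le_mul_of_pos_right _ (Nat.pow_pos (by omega))
      simp only [hb]
      omega)
    (fun i hi => by
      have := Finset.single_le_sum (f := b) (fun _ _ => Nat.zero_le _) (Finset.mem_range.2 hi)
      omega)
    (fun i hi => by
      rw [Rc_eq]
      exact hQ.mul_count_le c hmin (by omega))
  have hend : (SimpleGraph.IsExploration.count Q (m + 1) : ℤ) ≤ Rc (m + 1) t m * n := by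
    rw [Rc_eq, ← hcard]
    exact_mod_cast hQ.count_le_mul_card m
  have hηZ : (ηc (m + 1) t : ℤ) = ∑ i ∈ Finset.range m, (b i : ℤ) := by
    rw [hη]; push_cast; rfl
  rw [hηZ]
  refine le_trans (mul_le_mul_of_nonneg_left ?_ (by positivity)) (hmain.trans hend)
  have : (0 : ℤ) ≤ 2 * ((m + 1 : ℕ) : ℤ) ^ 2 * t * (Δc (m + 1) : ℤ) ^ m := by positivity
  linarith
end

section
/- Let ℓ ≥ 2 be an integer and c ≥ 1 a real number. Every graph on n ≥ 1 vertices with at least 6ℓ·c·n^{1+1/ℓ} edges contains a subgraph G' such that G' has at least c·n^{1/(2ℓ)} vertices and the degree (in G') of every vertex of G' is at least c·v(G')^{1/ℓ} and at most (20ℓ)^{2ℓ}·c·v(G')^{1/ℓ}, where v(G') denotes the number of vertices of G'. -/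
open Finset in
/-- Hall's theorem with capacities: if every `J ⊆ S` satisfies `#J ≤ M * #(⋃ x ∈ J, R x)`, then one
can choose `f x ∈ R x` for all `x ∈ S` so that no value is taken more than `M` times on `S`. -/
theorem exists_choice_of_card_le_mul_card_biUnion {V : Type*} [DecidableEq V] (S : Finset V)
    (R : V → Finset V) (M : ℕ) (h : ∀ J ⊆ S, #J ≤ M * #(J.biUnion R)) :
    ∃ f : V → V, (∀ x ∈ S, f x ∈ R x) ∧ ∀ y, #{x ∈ S | f x = y} ≤ M := by
  classical
  obtain ⟨g, hg, hgR⟩ := (Finset.all_card_le_biUnion_card_iff_exists_injective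
    (fun x : S => R x ×ˢ (univ : Finset (Fin M)))).1 (by
      intro s
      have h1 := h (s.map (Function.Embedding.subtype _)) (by
        intro x hx
        obtain ⟨y, -, rfl⟩ := Finset.mem_map.1 hx
        exact y.2)
      have h2 : s.biUnion (fun x : S => R x ×ˢ (univ : Finset (Fin M)))
          = ((s.map (Function.Embedding.subtype _)).biUnion R) ×ˢ univ := by
        ext ⟨a, b⟩
        simp
      rw [h2, card_product, card_univ, Fintype.card_fin, mul_comm]
      simpa using h1)
  refine ⟨fun x => if hx : x ∈ S then (g ⟨x, hx⟩).1 else x, ?_, ?_⟩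
  · intro x hx
    have := hgR ⟨x, hx⟩
    simp only [mem_product] at this
    simpa [hx] using this.1
  · intro y
    have hinj : Set.InjOn (fun x => if hx : x ∈ S then some (g ⟨x, hx⟩).2 else none)
        ({x ∈ S | (if hx : x ∈ S then (g ⟨x, hx⟩).1 else x) = y} : Finset V) := by
      intro a ha b hb hab
      simp only [coe_filter, Set.mem_ofPred_eq] at ha hb
      obtain ⟨haS, ha⟩ := ha
      obtain ⟨hbS, hb⟩ := hb
      simp only [haS, hbS, dite_true, Option.some.injEq] at ha hb hab
      have := hg (Prod.ext (ha.trans hb.symm) hab)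
      simpa using this
    have := card_le_card_of_injOn (t := (univ : Finset (Fin M)).map Function.Embedding.some) _
      (by
        intro x hx
        simp only [coe_filter, Set.mem_ofPred_eq] at hx
        simp [hx.1]) hinj
    simpa using this

open Finset in
/-- If small sets `T ⊆ S` cannot absorb, for every vertex of some `J ⊆ S` with `#J = #T`, all but
`k` of its neighbours in `S`, then `G` restricted to `S` has an orientation-like selection in which
every vertex chooses `k` neighbours and is itself chosen at most `M * k` times. -/
theorem SimpleGraph.exists_neighbor_selection {V : Type*} [DecidableEq V] (G : SimpleGraph V)
    [DecidableRel G.Adj] (S : Finset V) (k M : ℕ) (hM : 1 ≤ M)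
    (hdeg : ∀ x ∈ S, k < #{y ∈ S | G.Adj x y})
    (h : ∀ J ⊆ S, ∀ T ⊆ S, #J = #T → T.Nonempty → M * #T < #S →
      ∃ x ∈ J, #{y ∈ T | G.Adj x y} + k < #{y ∈ S | G.Adj x y}) (i : ℕ) (hi : i ≤ k) :
    ∃ N : V → Finset V, (∀ x ∈ S, N x ⊆ {y ∈ S | G.Adj x y} ∧ #(N x) = i) ∧
      ∀ y, #{x ∈ S | y ∈ N x} ≤ M * i := by
  induction i with
  | zero => exact ⟨fun _ => ∅, by simp, by simp⟩
  | succ i ih =>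
    obtain ⟨N, hN, hin⟩ := ih (by omega)
    obtain ⟨f, hf, hfM⟩ := exists_choice_of_card_le_mul_card_biUnion S
      (fun x => {y ∈ S | G.Adj x y} \ N x) M (by
        intro J hJ
        by_contra! hlt
        set T := J.biUnion (fun x => {y ∈ S | G.Adj x y} \ N x) with hT
        have hTS : T ⊆ S := by
          intro y hy
          simp only [hT, mem_biUnion, mem_sdiff, mem_filter] at hy
          obtain ⟨_, -, ⟨hy, -⟩, -⟩ := hy
          exact hy
        have hJne : J.Nonempty := card_pos.1 (by omega)
        have hTJ : #T ≤ #J := (Nat.le_mul_of_pos_left _ hM).trans hlt.le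
        obtain ⟨J', hJ', hcard⟩ := exists_subset_card_eq hTJ
        have hrem : ∀ x ∈ J, #{y ∈ S | G.Adj x y} ≤ #{y ∈ T | G.Adj x y} + i := by
          intro x hx
          rw [← (hN x (hJ hx)).2, add_comm]
          refine (card_le_card (t := N x ∪ {y ∈ T | G.Adj x y}) ?_).trans (card_union_le _ _)
          intro y hy
          by_cases hyN : y ∈ N x
          · exact mem_union_left _ hyN
          · exact mem_union_right _ (mem_filter.2
              ⟨mem_biUnion.2 ⟨x, hx, mem_sdiff.2 ⟨hy, hyN⟩⟩, (mem_filter.1 hy).2⟩)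
        have hTne : T.Nonempty := by
          obtain ⟨x, hx⟩ := hJne
          have h1 := hrem x hx
          have h2 := hdeg x (hJ hx)
          have h3 := card_filter_le T (fun y => G.Adj x y)
          exact card_pos.1 (by omega)
        obtain ⟨x, hx, hlt'⟩ := h J' (hJ'.trans hJ) T hTS hcard hTne
          (hlt.trans_le (card_le_card hJ))
        have := hrem x (hJ' hx)
        omega)
    refine ⟨fun x => insert (f x) (N x), ?_, ?_⟩
    · intro x hx
      have h1 := mem_sdiff.1 (hf x hx)
      exact ⟨insert_subset h1.1 (hN x hx).1, by
        rw [card_insert_of_notMem h1.2, (hN x hx).2]⟩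
    · intro y
      have : ({x ∈ S | y ∈ insert (f x) (N x)} : Finset V)
          ⊆ {x ∈ S | f x = y} ∪ {x ∈ S | y ∈ N x} := by
        intro x
        simp only [mem_filter, mem_insert, mem_union]
        rintro ⟨hx, rfl | hy⟩ <;> tauto
      have h1 := (card_le_card this).trans (card_union_le _ _)
      have h2 := hfM y
      have h3 := hin y
      rw [mul_add, mul_one]
      exact h1.trans (by omega)

open Finset in
/-- The number of ordered adjacent pairs drops by exactly twice the degree when a vertex is
removed. -/
theorem SimpleGraph.sum_card_filter_adj_erase {V : Type*} [DecidableEq V] (G : SimpleGraph V)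
    [DecidableRel G.Adj] (S : Finset V) {x : V} (hx : x ∈ S) :
    ∑ u ∈ S, #{w ∈ S | G.Adj u w}
      = ∑ u ∈ S.erase x, #{w ∈ S.erase x | G.Adj u w} + 2 * #{w ∈ S | G.Adj x w} := by
  have h1 : ∀ u, #{w ∈ S | G.Adj u w}
      = #{w ∈ S.erase x | G.Adj u w} + if G.Adj u x then 1 else 0 := by
    intro u
    simp only [card_filter]
    rw [← sum_erase_add _ _ hx]
  rw [← sum_erase_add _ _ hx, sum_congr rfl (fun u _ => h1 u), sum_add_distrib]
  have h2 : ∑ u ∈ S.erase x, (if G.Adj u x then 1 else 0) = #{w ∈ S | G.Adj x w} := by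
    rw [h1 x]
    simp only [SimpleGraph.irrefl, if_false, add_zero, card_filter]
    exact sum_congr rfl fun u _ => by simp only [G.adj_comm u x]
  rw [h2]
  ring

open Finset in
/-- A nonempty vertex set maximising `2 e(S) / |S| ^ (1 + b)`. All vertices have degree at least
`φ / 2 * |S| ^ b` inside it, where `φ` is the maximal value. -/
theorem SimpleGraph.exists_densest_vertexSet {V : Type*} [DecidableEq V] [Fintype V] [Nonempty V]
    (G : SimpleGraph V) [DecidableRel G.Adj] (b : ℝ) (hb : 0 < b) :
    ∃ (S : Finset V) (φ : ℝ), S.Nonempty ∧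
      (∀ T : Finset V,
        ((∑ u ∈ T, #{w ∈ T | G.Adj u w} : ℕ) : ℝ) ≤ φ * (#T : ℝ) ^ (1 + b)) ∧
      ∀ x ∈ S, φ / 2 * (#S : ℝ) ^ b ≤ (#{w ∈ S | G.Adj x w} : ℝ) := by
  obtain ⟨S, hS, hmax⟩ := exists_max_image ((univ : Finset (Finset V)).filter Finset.Nonempty)
    (fun T => ((∑ u ∈ T, #{w ∈ T | G.Adj u w} : ℕ) : ℝ) / (#T : ℝ) ^ (1 + b))
    ⟨univ, mem_filter.2 ⟨mem_univ _, univ_nonempty⟩⟩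
  have hSne : S.Nonempty := (mem_filter.1 hS).2
  obtain ⟨φ, hφ⟩ :
      ∃ φ, φ = ((∑ u ∈ S, #{w ∈ S | G.Adj u w} : ℕ) : ℝ) / (#S : ℝ) ^ (1 + b) := ⟨_, rfl⟩
  have hφ0 : 0 ≤ φ :=
    hφ ▸ div_nonneg (Nat.cast_nonneg _) (Real.rpow_nonneg (Nat.cast_nonneg _) _)
  have hle : ∀ T : Finset V,
      ((∑ u ∈ T, #{w ∈ T | G.Adj u w} : ℕ) : ℝ) ≤ φ * (#T : ℝ) ^ (1 + b) := by
    intro T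
    rcases T.eq_empty_or_nonempty with rfl | hT
    · simp only [sum_empty, Nat.cast_zero]
      positivity
    · have hpos : (0 : ℝ) < #T := by exact_mod_cast hT.card_pos
      rw [← div_le_iff₀ (by positivity)]
      exact (hmax T (mem_filter.2 ⟨mem_univ _, hT⟩)).trans_eq hφ.symm
  refine ⟨S, φ, hSne, hle, ?_⟩
  intro x hx
  have hpos : (0 : ℝ) < #S := by exact_mod_cast hSne.card_pos
  have heq : ((∑ u ∈ S, #{w ∈ S | G.Adj u w} : ℕ) : ℝ) = φ * (#S : ℝ) ^ (1 + b) := by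
    rw [hφ, div_mul_cancel₀]
    positivity
  have herase := hle (S.erase x)
  rw [G.sum_card_filter_adj_erase S hx, Nat.cast_add] at heq
  have hc : ((#(S.erase x) : ℕ) : ℝ) = #S - 1 := by
    rw [card_erase_of_mem hx, Nat.cast_sub hSne.card_pos, Nat.cast_one]
  have hc0 : (0 : ℝ) ≤ #S - 1 := hc ▸ Nat.cast_nonneg _
  have hpow : ((#(S.erase x) : ℕ) : ℝ) ^ (1 + b) ≤ (#S - 1) * (#S : ℝ) ^ b := by
    rw [hc, Real.rpow_add' hc0 (by positivity), Real.rpow_one]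
    gcongr
    linarith
  rw [Real.rpow_add hpos, Real.rpow_one] at heq
  have := mul_le_mul_of_nonneg_left hpow hφ0
  push_cast at heq herase
  nlinarith

open Finset in
/-- A set of density at most `φ` contains few edges, so a small set `T` cannot contain most of the
neighbours of all vertices of a set `J` of the same size. -/
theorem SimpleGraph.exists_card_filter_adj_lt_of_card_eq {V : Type*} [DecidableEq V]
    (G : SimpleGraph V) [DecidableRel G.Adj] {b φ v : ℝ} (hb : 0 < b) (hb1 : b ≤ 1) (hφ : 0 < φ)
    (h : ∀ T : Finset V,
      ((∑ u ∈ T, #{w ∈ T | G.Adj u w} : ℕ) : ℝ) ≤ φ * (#T : ℝ) ^ (1 + b))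
    {J T : Finset V} (hJT : #J = #T) (hT : T.Nonempty) (hv : 10 * (#T : ℝ) ^ b ≤ v) :
    ∃ x ∈ J, (#{w ∈ T | G.Adj x w} : ℝ) < 5 / 12 * φ * v := by
  by_contra! hcon
  have hpos : (0 : ℝ) < #T := by exact_mod_cast hT.card_pos
  have h1 : (#T : ℝ) * (5 / 12 * φ * v)
      ≤ ((∑ u ∈ J ∪ T, #{w ∈ J ∪ T | G.Adj u w} : ℕ) : ℝ) := by
    push_cast
    calc (#T : ℝ) * (5 / 12 * φ * v) = ∑ u ∈ J, 5 / 12 * φ * v := by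
          rw [sum_const, nsmul_eq_mul, hJT]
      _ ≤ ∑ u ∈ J, (#{w ∈ J ∪ T | G.Adj u w} : ℝ) := by
          refine sum_le_sum fun u hu => (hcon u hu).trans ?_
          exact_mod_cast card_le_card (filter_subset_filter _ subset_union_right)
      _ ≤ _ := sum_le_sum_of_subset_of_nonneg subset_union_left fun _ _ _ => Nat.cast_nonneg _
  have hcard : (#(J ∪ T) : ℝ) ≤ 2 * #T := by
    have := card_union_le J T
    exact_mod_cast (by omega : #(J ∪ T) ≤ 2 * #T)
  have h2 : (#(J ∪ T) : ℝ) ^ (1 + b) ≤ 2 * #T * (2 * (#T : ℝ) ^ b) := by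
    calc (#(J ∪ T) : ℝ) ^ (1 + b) ≤ (2 * #T : ℝ) ^ (1 + b) := by gcongr
      _ = 2 * #T * ((2 : ℝ) ^ b * (#T : ℝ) ^ b) := by
          rw [Real.rpow_add (by positivity), Real.rpow_one, Real.mul_rpow (by norm_num) hpos.le]
      _ ≤ _ := by
          gcongr
          simpa using Real.rpow_le_rpow_of_exponent_le (by norm_num : (1 : ℝ) ≤ 2) hb1
  have h3 := h1.trans ((h (J ∪ T)).trans (mul_le_mul_of_nonneg_left h2 hφ.le))
  have hp : (0 : ℝ) < (#T : ℝ) ^ b := by positivity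
  have h4 : (#T : ℝ) * φ * (5 / 12 * v) ≤ (#T : ℝ) * φ * (4 * (#T : ℝ) ^ b) := by linarith
  have h5 := le_of_mul_le_mul_left h4 (by positivity)
  linarith


/-- Every graph on `n ≥ 1` vertices with at least `6ℓ·c·n^{1+1/ℓ}` edges contains a
subgraph `G'` with at least `c·n^{1/(2ℓ)}` vertices in which every vertex has degree
between `c·v(G')^{1/ℓ}` and `(20ℓ)^{2ℓ}·c·v(G')^{1/ℓ}`. -/
theorem subgraph_degree_control (ℓ : ℕ) (hℓ : 2 ≤ ℓ) (c : ℝ) (hc : 1 ≤ c)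
    {V : Type} [Fintype V] (n : ℕ) (hn : 1 ≤ n) (hcard : Fintype.card V = n)
    (G : SimpleGraph V) [DecidableRel G.Adj]
    (hE : 6 * (ℓ : ℝ) * c * (n : ℝ) ^ (1 + 1 / (ℓ : ℝ)) ≤ (G.edgeFinset.card : ℝ)) :
    ∃ G' : G.Subgraph,
      c * (n : ℝ) ^ (1 / (2 * (ℓ : ℝ))) ≤ (G'.verts.ncard : ℝ) ∧
      ∀ v ∈ G'.verts,
        c * (G'.verts.ncard : ℝ) ^ (1 / (ℓ : ℝ)) ≤ ((G'.neighborSet v).ncard : ℝ) ∧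
        ((G'.neighborSet v).ncard : ℝ)
          ≤ ((20 * ℓ : ℕ) : ℝ) ^ (2 * ℓ) * c * (G'.verts.ncard : ℝ) ^ (1 / (ℓ : ℝ)) := by
  classical
  subst hcard
  have : Nonempty V := Fintype.card_pos_iff.1 hn
  have hℓ' : (2 : ℝ) ≤ ℓ := by exact_mod_cast hℓ
  have hn' : (1 : ℝ) ≤ Fintype.card V := by exact_mod_cast hn
  set b : ℝ := 1 / (2 * (ℓ : ℝ)) with hb
  have hb0 : 0 < b := by positivity
  have hb1 : b ≤ 1 := by
    rw [hb, div_le_one (by positivity)]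
    linarith
  have hbb : 1 / (ℓ : ℝ) = b + b := by
    rw [hb]
    field_simp
    norm_num
  obtain ⟨S, φ, hSne, hle, hmin⟩ := G.exists_densest_vertexSet b hb0
  have hv1 : (1 : ℝ) ≤ S.card := by exact_mod_cast hSne.card_pos
  have hv0 : (0 : ℝ) < S.card := by linarith
  have hvn : (S.card : ℝ) ≤ Fintype.card V := by exact_mod_cast S.card_le_univ
  have hφ : 24 * c * (Fintype.card V : ℝ) ^ b ≤ φ := by
    have h1 := hle Finset.univ
    have h2 : ∑ u : V, (Finset.univ.filter (G.Adj u)).card = 2 * G.edgeFinset.card := by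
      rw [← G.sum_degrees_eq_twice_card_edges]
      exact Finset.sum_congr rfl fun u _ => by
        rw [← G.card_neighborFinset_eq_degree, G.neighborFinset_eq_filter]
    rw [h2, Finset.card_univ] at h1
    rw [hbb, ← add_assoc, add_comm _ b, Real.rpow_add (by linarith)] at hE
    push_cast at h1
    have hp : (0 : ℝ) < (Fintype.card V : ℝ) ^ (1 + b) := by positivity
    have h3 : 12 * c * (Fintype.card V : ℝ) ^ b ≤ 6 * (ℓ : ℝ) * c * (Fintype.card V : ℝ) ^ b := by
      gcongr
      linarith
    have h4 := mul_le_mul_of_nonneg_right h3 hp.le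
    refine le_of_mul_le_mul_right ?_ hp
    linarith
  have hnb : (S.card : ℝ) ^ b ≤ (Fintype.card V : ℝ) ^ b := by gcongr
  have hSb : 1 ≤ (S.card : ℝ) ^ b := Real.one_le_rpow hv1 hb0.le
  have hφ0 : 0 < φ := lt_of_lt_of_le (by positivity) hφ
  have hlow : 12 * (c * (S.card : ℝ) ^ (1 / (ℓ : ℝ))) ≤ φ / 2 * (S.card : ℝ) ^ b := by
    rw [hbb, Real.rpow_add hv0]
    have : 12 * (c * (S.card : ℝ) ^ b) ≤ φ / 2 := by
      have := mul_le_mul_of_nonneg_left hnb (by linarith : 0 ≤ c)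
      linarith
    have := mul_le_mul_of_nonneg_right this (by linarith : 0 ≤ (S.card : ℝ) ^ b)
    linarith
  have hq1 : 1 ≤ c * (S.card : ℝ) ^ (1 / (ℓ : ℝ)) :=
    one_le_mul_of_one_le_of_one_le hc (Real.one_le_rpow hv1 (by positivity))
  set q : ℝ := c * (S.card : ℝ) ^ (1 / (ℓ : ℝ)) with hq
  set k := ⌈q⌉₊ with hk
  have hkq : (q : ℝ) ≤ k := Nat.le_ceil q
  have hk2 : (k : ℝ) ≤ 2 * q := by
    have := Nat.ceil_lt_add_one (by linarith : 0 ≤ q)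
    linarith
  obtain ⟨N, hN, hin⟩ := G.exists_neighbor_selection S k (10 ^ (2 * ℓ)) (Nat.one_le_pow _ _ (by norm_num))
    (by
      intro x hx
      have := hmin x hx
      exact_mod_cast (by linarith : (k : ℝ) < (S.filter (G.Adj x)).card))
    (by
      intro J hJ T _ hJT hT hlt
      have h10 : 10 * (T.card : ℝ) ^ b ≤ (S.card : ℝ) ^ b := by
        have h1 : (10 : ℝ) ^ (2 * ℓ) * T.card ≤ S.card := by exact_mod_cast hlt.le
        have h2 : ((10 : ℝ) ^ (2 * ℓ)) ^ b = 10 := by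
          rw [← Real.rpow_natCast, ← Real.rpow_mul (by norm_num), hb]
          push_cast
          rw [mul_one_div_cancel (by positivity), Real.rpow_one]
        calc 10 * (T.card : ℝ) ^ b = ((10 : ℝ) ^ (2 * ℓ) * T.card) ^ b := by
              rw [Real.mul_rpow (by positivity) (by positivity), h2]
          _ ≤ _ := by gcongr
      obtain ⟨x, hx, hx'⟩ := G.exists_card_filter_adj_lt_of_card_eq hb0 hb1 hφ0 hle hJT hT h10
      refine ⟨x, hx, ?_⟩
      have := hmin x (hJ hx)
      have hr : ((T.filter (G.Adj x)).card : ℝ) + k < (S.filter (G.Adj x)).card := by linarith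
      exact_mod_cast hr) k le_rfl
  let G' : G.Subgraph :=
    { verts := S
      Adj := fun u w => u ∈ S ∧ w ∈ S ∧ (w ∈ N u ∨ u ∈ N w)
      adj_sub := by
        rintro u w ⟨hu, hw, h | h⟩
        · exact (Finset.mem_filter.1 ((hN u hu).1 h)).2
        · exact (Finset.mem_filter.1 ((hN w hw).1 h)).2.symm
      edge_vert := fun h => h.1
      symm := ⟨fun u w h => ⟨h.2.1, h.1, h.2.2.symm⟩⟩ }
  have hverts : G'.verts.ncard = S.card := Set.ncard_coe_finset S
  refine ⟨G', ?_, ?_⟩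
  · rw [hverts]
    obtain ⟨x, hx⟩ := hSne
    have h1 := hmin x hx
    have h2 : ((S.filter (G.Adj x)).card : ℝ) ≤ S.card := by
      exact_mod_cast Finset.card_filter_le _ _
    have h3 : φ / 2 * 1 ≤ φ / 2 * (S.card : ℝ) ^ b := by gcongr
    have h4 : 0 < c * (Fintype.card V : ℝ) ^ b := by positivity
    linarith
  · intro x hx
    have hxS : x ∈ S := hx
    have hnbr : G'.neighborSet x = (N x ∪ S.filter (fun y => x ∈ N y) : Finset V) := by
      ext y
      simp only [SimpleGraph.Subgraph.mem_neighborSet, G', Finset.coe_union, Set.mem_union,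
        Finset.mem_coe, Finset.mem_filter]
      have := fun h => (Finset.mem_filter.1 ((hN x hxS).1 h : y ∈ _)).1
      tauto
    rw [hverts, hnbr, Set.ncard_coe_finset, mul_assoc, ← hq]
    have hcardN := (hN x hxS).2
    constructor
    · refine hkq.trans ?_
      rw [← hcardN]
      exact_mod_cast Finset.card_le_card Finset.subset_union_left
    · have h1 := (Finset.card_union_le (N x) (S.filter (fun y => x ∈ N y)))
      have h2 := hin x
      have h3 : ((N x ∪ S.filter (fun y => x ∈ N y)).card : ℝ) ≤ k + 10 ^ (2 * ℓ) * k := by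
        exact_mod_cast h1.trans (by omega)
      have h4 : (4 : ℝ) * 10 ^ (2 * ℓ) ≤ ((20 * ℓ : ℕ) : ℝ) ^ (2 * ℓ) := by
        calc (4 : ℝ) * 10 ^ (2 * ℓ) ≤ 4 ^ (2 * ℓ) * 10 ^ (2 * ℓ) := by
              gcongr
              exact le_self_pow₀ (by norm_num) (by omega)
          _ = 40 ^ (2 * ℓ) := by
              rw [← mul_pow]
              norm_num
          _ ≤ _ := by
              gcongr
              push_cast
              linarith
      have h5 : (1 : ℝ) ≤ 10 ^ (2 * ℓ) := one_le_pow₀ (by norm_num)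
      calc _ ≤ (k : ℝ) + 10 ^ (2 * ℓ) * k := h3
        _ ≤ 2 * 10 ^ (2 * ℓ) * k := by nlinarith
        _ ≤ 2 * 10 ^ (2 * ℓ) * (2 * q) := by gcongr
        _ = 4 * 10 ^ (2 * ℓ) * q := by ring
        _ ≤ _ := by gcongr
end

section
/- For every integer ℓ ≥ 2 there exist a constant T = T(ℓ) and an integer n_0 = n_0(ℓ) such that for every n ≥ n_0 there is a bipartite graph on n vertices with at least (1/4)·n^{1+1/ℓ} edges in which every pair of distinct vertices is joined by fewer than T paths of length at most ℓ. -/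
/-- The number of paths of length exactly `r` from `x` to `y` in `G`: sequences
`x = p 0, p 1, …, p r = y` of pairwise distinct vertices with consecutive vertices
adjacent.  (A path and its reverse start at different endpoints, so each path is
counted exactly once.) -/
noncomputable def SimpleGraph.pathCount {V : Type*} (G : SimpleGraph V)
    (r : ℕ) (x y : V) : ℕ :=
  Nat.card {p : Fin (r + 1) → V // p 0 = x ∧ p (Fin.last r) = y ∧
    Function.Injective p ∧ ∀ j : Fin r, G.Adj (p j.castSucc) (p j.succ)}

open MvPolynomial in
/-- An infinite algebraic set has a generic point, over an extension field, on a component of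
positive dimension; this point specializes to some point of the set. -/
theorem exists_generic_point {K σ : Type} [Field K] [Finite σ] {A : Set (σ → K)}
    (hA : A.Infinite) :
    ∃ (L : Type) (_ : Field L) (_ : Algebra K L) (z : σ → L), ∃ v ∈ A,
      (∀ h : MvPolynomial σ K, (∀ a ∈ A, eval a h = 0) → aeval z h = 0) ∧
      (∀ h : MvPolynomial σ K, aeval z h = 0 → eval v h = 0) ∧
      ∃ t, Transcendental K (z t) := by
  let I : Ideal (MvPolynomial σ K) := ⨅ a : A, RingHom.ker (eval (a : σ → K))
  have hfin := I.finite_minimalPrimes_of_isNoetherianRing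
  have hker : ∀ a : σ → K, (RingHom.ker (eval a)).IsPrime := fun a => RingHom.ker_isPrime _
  have hinj : Function.Injective fun a : σ → K => RingHom.ker (eval a) := by
    intro a b hab
    funext t
    have : (X t - C (b t) : MvPolynomial σ K) ∈ RingHom.ker (eval a) := by
      simp only at hab
      rw [hab, RingHom.mem_ker]; simp
    rw [RingHom.mem_ker] at this
    simpa [sub_eq_zero] using this
  obtain ⟨v, hv, hvI⟩ : ∃ v ∈ A, RingHom.ker (eval v) ∉ I.minimalPrimes := by
    by_contra! hcon
    exact hA (Set.Finite.of_finite_image (hfin.subset (Set.image_subset_iff.2 hcon)) hinj.injOn)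
  obtain ⟨Q, hQ, hQv⟩ := Ideal.exists_minimalPrimes_le
    (show I ≤ RingHom.ker (eval v) from iInf_le_of_le ⟨v, hv⟩ le_rfl)
  have hQp : Q.IsPrime := hQ.1.1
  let B := MvPolynomial σ K ⧸ Q
  refine ⟨FractionRing B, inferInstance, inferInstance,
    fun t => algebraMap B _ (Ideal.Quotient.mk Q (X t)), v, hv, ?_⟩
  have haeval : ∀ h : MvPolynomial σ K,
      aeval (fun t => algebraMap B (FractionRing B) (Ideal.Quotient.mk Q (X t))) h =
        algebraMap B (FractionRing B) (Ideal.Quotient.mk Q h) := by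
    intro h
    have : aeval (fun t => algebraMap B (FractionRing B) (Ideal.Quotient.mk Q (X t))) =
        (IsScalarTower.toAlgHom K B (FractionRing B)).comp (Ideal.Quotient.mkₐ K Q) := by
      ext t; simp [B]
    rw [this]; rfl
  have hzero : ∀ h : MvPolynomial σ K, algebraMap B (FractionRing B) (Ideal.Quotient.mk Q h) = 0 ↔
      h ∈ Q := by
    intro h
    rw [FaithfulSMul.algebraMap_eq_zero_iff, Ideal.Quotient.eq_zero_iff_mem]
  refine ⟨fun h hh => ?_, fun h hh => ?_, ?_⟩
  · rw [haeval, hzero]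
    refine hQ.1.2 ?_
    simp only [I, Ideal.mem_iInf, RingHom.mem_ker]
    exact fun a => hh a a.2
  · rw [haeval, hzero] at hh
    exact hQv hh
  · by_contra! hcon
    have hint : Algebra.IsIntegral K B := by
      refine ⟨fun b => ?_⟩
      obtain ⟨p, rfl⟩ := Ideal.Quotient.mk_surjective b
      induction p using MvPolynomial.induction_on with
      | C a => exact isIntegral_algebraMap (R := K) (A := B) (x := a)
      | add p q hp hq => rw [map_add]; exact hp.add hq
      | mul_X p t hp =>
        rw [map_mul]
        refine hp.mul ?_
        rw [← isIntegral_algebraMap_iff (IsFractionRing.injective B (FractionRing B))]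
        exact (not_not.1 (hcon t)).isIntegral
    have hfld : IsField B := isField_of_isIntegral_of_isField' (Field.toIsField K)
    have hmax := Ideal.Quotient.maximal_of_isField Q hfld
    exact hvI ((hmax.eq_of_le (hker v).ne_top hQv) ▸ hQ)

/-- Algebraically independent elements are at most as many as the elements of any finite set over
which they are algebraic. -/
theorem AlgebraicIndependent.card_le_of_isAlgebraic_adjoin {k K ι : Type} [Field k] [Field K]
    [Algebra k K] [Fintype ι] {h : ι → K} (hh : AlgebraicIndependent k h) (Y : Finset K)
    (hY : ∀ i, IsAlgebraic (Algebra.adjoin k (Y : Set K)) (h i)) :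
    Fintype.card ι ≤ Y.card := by
  let M := AlgebraicIndependent.matroid k K
  have h1 : M.Indep (Set.range h) := hh.coe_range
  have h2 : Set.range h ⊆ M.closure Y := by
    rw [AlgebraicIndependent.matroid_closure_eq]
    rintro _ ⟨i, rfl⟩
    exact hY i
  have h3 : (Set.range h).encard ≤ (Y : Set K).encard := by
    calc _ ≤ M.eRk (M.closure Y) := h1.encard_le_eRk_of_subset h2
      _ = M.eRk Y := M.eRk_closure_eq _
      _ ≤ _ := M.eRk_le_encard _
  have h4 := hh.injective.encard_range.trans h3
  rw [Set.encard_coe_eq_coe_finsetCard] at h4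
  simpa using h4

open MvPolynomial in
/-- A polynomial of degree less than the number of points separates a point from the others. -/
theorem exists_separating_polynomial {K σ : Type} [Field K] [DecidableEq (σ → K)]
    (E : Finset (σ → K)) (e : σ → K) :
    ∃ p : MvPolynomial σ K, p.totalDegree ≤ (E.erase e).card ∧ eval e p ≠ 0 ∧
      ∀ e' ∈ E, e' ≠ e → eval e' p = 0 := by
  have : ∀ e' : σ → K, ∃ q : MvPolynomial σ K, q.totalDegree ≤ 1 ∧
      (e' ≠ e → eval e q ≠ 0 ∧ eval e' q = 0) := by
    intro e'
    by_cases h : e' = e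
    · exact ⟨0, by simp, fun h' => (h' h).elim⟩
    · obtain ⟨t, ht⟩ := Function.ne_iff.1 h
      refine ⟨X t - C (e' t), ?_, fun _ => ⟨?_, by simp⟩⟩
      · exact (totalDegree_sub_C_le _ _).trans (by simp)
      · simpa [sub_eq_zero] using Ne.symm ht
  choose q hq1 hq2 using this
  refine ⟨∏ e' ∈ E.erase e, q e', ?_, ?_, ?_⟩
  · refine (totalDegree_finsetProd _ _).trans ?_
    exact (Finset.sum_le_sum fun e' _ => hq1 e').trans (by simp)
  · rw [map_prod, Finset.prod_ne_zero_iff]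
    exact fun e' he' => (hq2 e' (Finset.ne_of_mem_erase he')).1
  · intro e' he' hne
    rw [map_prod]
    exact Finset.prod_eq_zero (Finset.mem_erase.2 ⟨hne, he'⟩) (hq2 e' hne).2

/-- The value at `z` of the monomial with exponent vector `m`. -/
def monomialValue {σ K : Type} [Fintype σ] [CommRing K] {d : ℕ} (m : σ → Fin (d + 1))
    (z : σ → K) : K := ∏ t, z t ^ (m t : ℕ)

theorem span_monomialValue_eq_top {K σ : Type} [Field K] [Fintype σ] {d : ℕ}
    (E : Finset (σ → K)) (hE : E.card ≤ d + 1) :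
    Submodule.span K (Set.range fun (m : σ → Fin (d + 1)) (e : E) =>
      monomialValue m (e : σ → K)) = ⊤ := by
  classical
  rw [eq_top_iff, ← (Pi.basisFun K E).span_eq, Submodule.span_le]
  rintro _ ⟨e, rfl⟩
  obtain ⟨p, hp1, hp2, hp3⟩ := exists_separating_polynomial E (e : σ → K)
  have hcard : (E.erase (e : σ → K)).card ≤ d := by
    rw [Finset.card_erase_of_mem e.2]; omega
  have key : (Pi.basisFun K E) e = ∑ m ∈ p.support, ((MvPolynomial.eval (e : σ → K) p)⁻¹ *
      p.coeff m) • fun e' : E => ∏ t, (e' : σ → K) t ^ m t := by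
    funext e'
    have : ∑ m ∈ p.support, ((MvPolynomial.eval (e : σ → K) p)⁻¹ *
      p.coeff m) * ∏ t, (e' : σ → K) t ^ m t = (MvPolynomial.eval (e : σ → K) p)⁻¹ *
        MvPolynomial.eval (e' : σ → K) p := by
      rw [MvPolynomial.eval_eq' (e' : σ → K), Finset.mul_sum]
      simp only [mul_assoc]
    simp only [Finset.sum_apply, Pi.smul_apply, smul_eq_mul, this, Pi.basisFun_apply]
    by_cases h : e' = e
    · subst h; simp [hp2]
    · rw [Pi.single_eq_of_ne h, hp3 _ e'.2 (fun h' => h (Subtype.ext h')), mul_zero]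
  rw [key]
  refine Submodule.sum_mem _ fun m hm => Submodule.smul_mem _ _ (Submodule.subset_span ?_)
  refine ⟨fun t => ⟨m t, ?_⟩, rfl⟩
  have h1 := (MvPolynomial.monomial_le_degreeOf t hm).trans
    (MvPolynomial.degreeOf_le_totalDegree p t)
  omega

theorem exists_nonsingular_monomialValue {K σ : Type} [Field K] [Fintype σ] {d : ℕ}
    [DecidableEq (σ → K)] (E : Finset (σ → K)) (hE : E.card ≤ d + 1) :
    ∃ a : E → (σ → Fin (d + 1)), Function.Injective a ∧
      IsUnit (Matrix.of fun e e' : E => monomialValue (a e') (e : σ → K)) := by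
  obtain ⟨κ, a, ha, hs, hli⟩ := exists_linearIndependent' K
    (fun (m : σ → Fin (d + 1)) (e : E) => monomialValue m (e : σ → K))
  rw [span_monomialValue_eq_top E hE] at hs
  let b := Module.Basis.mk hli hs.ge
  let φ : E ≃ κ := (Pi.basisFun K E).indexEquiv b
  refine ⟨a ∘ φ, ha.comp φ.injective, ?_⟩
  rw [← Matrix.linearIndependent_cols_iff_isUnit]
  exact hli.comp φ φ.injective

theorem Subfield.inv_matrix_mem {K n : Type} [Field K] [Fintype n] [DecidableEq n]
    (L : Subfield K) {A : Matrix n n K} (hA : ∀ i j, A i j ∈ L) (i j : n) : A⁻¹ i j ∈ L := by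
  have hdet : ∀ B : Matrix n n K, (∀ i j, B i j ∈ L) → B.det ∈ L := by
    intro B hB
    rw [Matrix.det_apply]
    refine sum_mem fun τ _ => ?_
    rw [Units.smul_def, zsmul_eq_mul]
    exact mul_mem (intCast_mem _ _) (prod_mem fun _ _ => hB _ _)
  rw [Matrix.inv_def, Matrix.smul_apply, smul_eq_mul, Ring.inverse_eq_inv', Matrix.adjugate_apply]
  refine mul_mem (inv_mem (hdet A hA)) (hdet _ fun i' j' => ?_)
  rw [Matrix.updateRow_apply]
  split_ifs
  · by_cases h : j' = i
    · subst h; simp [one_mem]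
    · simp [h, zero_mem]
  · exact hA _ _

/-- The value at `z` of the polynomial with coefficients `f`. -/
def polyValue {σ K : Type} [Fintype σ] [DecidableEq σ] [CommRing K] {d : ℕ}
    (f : (σ → Fin (d + 1)) → K) (z : σ → K) : K := ∑ m, f m * monomialValue m z

/-- The coefficients of a polynomial are determined, rationally, by its values on a finite set `E`
and by all but `E.card` of them. -/
theorem exists_determining_monomials {K σ : Type} [Field K] [Fintype σ] [DecidableEq σ] {d : ℕ}
    (E : Finset (σ → K)) (hE : E.card ≤ d + 1) :
    ∃ D : Finset (σ → Fin (d + 1)), D.card = E.card ∧ ∀ (L : Subfield K)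
      (f : (σ → Fin (d + 1)) → K), (∀ e ∈ E, ∀ t, e t ∈ L) → (∀ e ∈ E, polyValue f e ∈ L) →
      (∀ m ∉ D, f m ∈ L) → ∀ m, f m ∈ L := by
  classical
  obtain ⟨a, ha, hu⟩ := exists_nonsingular_monomialValue E hE
  set A := Matrix.of fun e e' : E => monomialValue (a e') (e : σ → K)
  refine ⟨Finset.univ.image a, by simp [Finset.card_image_of_injective _ ha], ?_⟩
  intro L f hEL hv hf m
  by_cases hm : m ∈ Finset.univ.image a
  swap
  · exact hf m hm
  obtain ⟨e, -, rfl⟩ := Finset.mem_image.1 hm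
  have hmon : ∀ m : σ → Fin (d + 1), ∀ e ∈ E, monomialValue m e ∈ L := fun m e he =>
    prod_mem fun t _ => pow_mem (hEL e he t) _
  have hA : ∀ i j, A i j ∈ L := fun i j => hmon _ _ i.2
  have hAv : ∀ i, A.mulVec (f ∘ a) i ∈ L := by
    intro i
    have h1 : A.mulVec (f ∘ a) i = polyValue f (i : σ → K) -
        ∑ m ∈ (Finset.univ.image a)ᶜ, f m * monomialValue m (i : σ → K) := by
      rw [polyValue, ← Finset.sum_add_sum_compl (Finset.univ.image a), add_sub_cancel_right,
        Finset.sum_image ha.injOn]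
      simp [Matrix.mulVec, dotProduct, A, mul_comm]
    rw [h1]
    exact sub_mem (hv _ i.2) (sum_mem fun m hm => mul_mem (hf m (Finset.mem_compl.1 hm))
      (hmon _ _ i.2))
  have h2 : f ∘ a = A⁻¹.mulVec (A.mulVec (f ∘ a)) := by
    rw [Matrix.mulVec_mulVec, Matrix.nonsing_inv_mul _ ((Matrix.isUnit_iff_isUnit_det _).1 hu),
      Matrix.one_mulVec]
  have h3 := congrFun h2 e
  rw [Function.comp_apply] at h3
  rw [h3]
  exact sum_mem fun j _ => mul_mem (L.inv_matrix_mem hA _ _) (hAv j)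

theorem map_monomialValue {σ R S : Type} [Fintype σ] [CommRing R] [CommRing S] (φ : R →+* S)
    {d : ℕ} (m : σ → Fin (d + 1)) (z : σ → R) :
    φ (monomialValue m z) = monomialValue m (φ ∘ z) := by
  simp [monomialValue]

theorem map_polyValue {σ R S : Type} [Fintype σ] [DecidableEq σ] [CommRing R] [CommRing S]
    (φ : R →+* S) {d : ℕ} (f : (σ → Fin (d + 1)) → R) (z : σ → R) :
    φ (polyValue f z) = polyValue (φ ∘ f) (φ ∘ z) := by
  simp [polyValue, map_monomialValue]

/-- On a path of length at most `ℓ` with both ends in `W`, the vertices outside `W` are at most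
`(ℓ - 1) / ℓ` times as many as the edges that meet the complement of `W`. -/
theorem card_new_vertices_mul_le {α : Type} [DecidableEq α] {r ℓ : ℕ} (hr : r ≤ ℓ)
    (p : Fin (r + 1) → α) (W : Finset α) (h0 : p 0 ∈ W) (hl : p (Fin.last r) ∈ W) :
    (Finset.univ.filter fun j => p j ∉ W).card * ℓ ≤
      (Finset.univ.filter fun j : Fin r => p j.castSucc ∉ W ∨ p j.succ ∉ W).card * (ℓ - 1) := by
  set J := Finset.univ.filter fun j => p j ∉ W with hJ
  set T := Finset.univ.filter fun j : Fin r => p j.castSucc ∉ W ∨ p j.succ ∉ W with hT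
  rcases J.eq_empty_or_nonempty with h | h
  · simp [h]
  have hpos : ∀ j ∈ J, 0 < (j : ℕ) ∧ (j : ℕ) < r := by
    intro j hj
    have hj' : p j ∉ W := (Finset.mem_filter.1 hj).2
    constructor
    · rcases Nat.eq_zero_or_pos (j : ℕ) with h | h
      · exact absurd (by rwa [show j = 0 from Fin.ext h]) hj'
      · exact h
    · by_contra hc
      have : j = Fin.last r := Fin.ext (by have := j.2; simp; omega)
      exact hj' (by rwa [this])
  have hJr : J.card ≤ r - 1 := by
    have : J.image (fun j : Fin (r + 1) => (j : ℕ)) ⊆ Finset.Ioo 0 r := by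
      intro i hi
      obtain ⟨j, hj, rfl⟩ := Finset.mem_image.1 hi
      exact Finset.mem_Ioo.2 (hpos j hj)
    have := Finset.card_le_card this
    rwa [Finset.card_image_of_injective _ Fin.val_injective, Nat.card_Ioo, Nat.sub_zero] at this
  have hJT : J.card + 1 ≤ T.card := by
    have hm := J.max'_mem h
    set j0 := J.max' h
    have hsub : insert (j0 : ℕ) (J.image fun j : Fin (r + 1) => (j : ℕ) - 1) ⊆
        T.image fun j : Fin r => (j : ℕ) := by
      intro i hi
      rcases Finset.mem_insert.1 hi with rfl | hi
      · refine Finset.mem_image.2 ⟨⟨j0, (hpos j0 hm).2⟩, ?_, rfl⟩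
        exact Finset.mem_filter.2 ⟨Finset.mem_univ _, Or.inl (Finset.mem_filter.1 hm).2⟩
      · obtain ⟨j, hj, rfl⟩ := Finset.mem_image.1 hi
        have hj' := hpos j hj
        refine Finset.mem_image.2 ⟨⟨(j : ℕ) - 1, by omega⟩, ?_, rfl⟩
        refine Finset.mem_filter.2 ⟨Finset.mem_univ _, Or.inr ?_⟩
        have : (⟨(j : ℕ) - 1, by omega⟩ : Fin r).succ = j := Fin.ext (by simp; omega)
        rw [this]
        exact (Finset.mem_filter.1 hj).2
    have hnot : (j0 : ℕ) ∉ J.image fun j : Fin (r + 1) => (j : ℕ) - 1 := by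
      intro hc
      obtain ⟨j, hj, hjj⟩ := Finset.mem_image.1 hc
      have h1 := hpos j hj
      have h2 : (j : ℕ) ≤ j0 := J.le_max' j hj
      omega
    have hc := Finset.card_le_card hsub
    rw [Finset.card_insert_of_notMem hnot, Finset.card_image_of_injective _ Fin.val_injective,
      Finset.card_image_of_injOn] at hc
    · exact hc
    · intro a ha b hb hab
      have h1 := hpos a ha
      have h2 := hpos b hb
      exact Fin.ext (by simp only at hab; omega)
  obtain ⟨m, rfl⟩ : ∃ m, ℓ = m + 1 := ⟨ℓ - 1, by
    have := Finset.card_pos.2 h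
    omega⟩
  simp only [Nat.add_sub_cancel]
  nlinarith [Nat.mul_le_mul_right m hJT, show J.card ≤ m by omega]

/-- The vertex of index `j` of the alternating path with sides `s` and coordinates `u`. -/
def pathVertex {r ℓ : ℕ} {K : Type} (s : Fin (r + 1) → Bool) (u : Fin (r + 1) × Fin ℓ → K)
    (j : Fin (r + 1)) : Bool × (Fin ℓ → K) := (s j, fun t => u (j, t))

/-- The coordinates of the edge of index `j` of an alternating path, sorted by side. -/
def edgeIndex {r ℓ : ℕ} (s : Fin (r + 1) → Bool) (j : Fin r) (p : Bool × Fin ℓ) :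
    Fin (r + 1) × Fin ℓ := (if s j.castSucc = p.1 then j.castSucc else j.succ, p.2)

/-- The end vertex on side `b` of an edge. -/
def edgeEnd {ℓ : ℕ} {K : Type} (e : Bool × Fin ℓ → K) (b : Bool) : Bool × (Fin ℓ → K) :=
  (b, fun t => e (b, t))

theorem edgeEnd_castSucc {r ℓ : ℕ} {K : Type} (s : Fin (r + 1) → Bool)
    (u : Fin (r + 1) × Fin ℓ → K) (j : Fin r) :
    edgeEnd (u ∘ edgeIndex s j) (s j.castSucc) = pathVertex s u j.castSucc := by
  simp [edgeEnd, edgeIndex, pathVertex]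

theorem edgeEnd_succ {r ℓ : ℕ} {K : Type} {s : Fin (r + 1) → Bool}
    (hs : ∀ j : Fin r, s j.castSucc ≠ s j.succ) (u : Fin (r + 1) × Fin ℓ → K) (j : Fin r) :
    edgeEnd (u ∘ edgeIndex s j) (s j.succ) = pathVertex s u j.succ := by
  simp [edgeEnd, edgeIndex, pathVertex, hs]

theorem edgeEnd_eq_or {r ℓ : ℕ} {K : Type} {s : Fin (r + 1) → Bool}
    (hs : ∀ j : Fin r, s j.castSucc ≠ s j.succ) (u : Fin (r + 1) × Fin ℓ → K) (j : Fin r)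
    (b : Bool) : edgeEnd (u ∘ edgeIndex s j) b = pathVertex s u j.castSucc ∨
      edgeEnd (u ∘ edgeIndex s j) b = pathVertex s u j.succ := by
  have : b = s j.castSucc ∨ b = s j.succ := by
    have := hs j
    revert this
    cases b <;> cases s j.castSucc <;> cases s j.succ <;> simp
  rcases this with rfl | rfl
  · exact Or.inl (edgeEnd_castSucc s u j)
  · exact Or.inr (edgeEnd_succ hs u j)

theorem edge_injective {r ℓ : ℕ} {K : Type} {s : Fin (r + 1) → Bool}
    (hs : ∀ j : Fin r, s j.castSucc ≠ s j.succ) {u : Fin (r + 1) × Fin ℓ → K}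
    (hu : Function.Injective (pathVertex s u)) :
    Function.Injective fun j : Fin r => u ∘ edgeIndex s j := by
  intro i j hij
  simp only at hij
  have h1 := edgeEnd_eq_or hs u j (s i.castSucc)
  have h2 := edgeEnd_eq_or hs u j (s i.succ)
  rw [← hij, edgeEnd_castSucc, hu.eq_iff, hu.eq_iff] at h1
  rw [← hij, edgeEnd_succ hs, hu.eq_iff, hu.eq_iff] at h2
  simp only [Fin.ext_iff, Fin.val_castSucc, Fin.val_succ] at h1 h2 ⊢
  omega

/-- The coordinates `u` form a path with sides `s` from `x` to `y`, whose `j`-th edge takes the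
value `c (lab j)` under the polynomial map with coefficients `f`. -/
structure IsPathPoint {ℓ r d : ℕ} {I κ K : Type} [CommRing K]
    (f : I → (Bool × Fin ℓ → Fin (d + 1)) → K) (c : κ → I → K) (s : Fin (r + 1) → Bool)
    (lab : Fin r → κ) (x y : Fin ℓ → K) (u : Fin (r + 1) × Fin ℓ → K) : Prop where
  first : ∀ t, u (0, t) = x t
  last : ∀ t, u (Fin.last r, t) = y t
  injective : Function.Injective (pathVertex s u)
  value : ∀ j i, polyValue (f i) (u ∘ edgeIndex s j) = c (lab j) i

theorem IsPathPoint.map {ℓ r d : ℕ} {I κ K L : Type} [Field K] [Field L]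
    {f : I → (Bool × Fin ℓ → Fin (d + 1)) → K} {c : κ → I → K} {s : Fin (r + 1) → Bool}
    {lab : Fin r → κ} {x y : Fin ℓ → K} {u : Fin (r + 1) × Fin ℓ → K}
    (h : IsPathPoint f c s lab x y u) (φ : K →+* L) :
    IsPathPoint (fun i => φ ∘ f i) (fun b => φ ∘ c b) s lab (φ ∘ x) (φ ∘ y) (φ ∘ u) where
  first t := by simp [h.first]
  last t := by simp [h.last]
  injective i j hij := by
    refine h.injective ?_
    simp only [pathVertex, Prod.mk.injEq, funext_iff, Function.comp_apply, φ.injective.eq_iff]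
      at hij ⊢
    exact hij
  value j i := by
    rw [Function.comp_assoc, ← map_polyValue, h.value, Function.comp_apply]

open MvPolynomial in
/-- A generic point of a set of paths is again a path. -/
theorem IsPathPoint.generic {ℓ r d : ℕ} {I κ K L : Type} [Field K] [Field L] [Algebra K L]
    {f : I → (Bool × Fin ℓ → Fin (d + 1)) → K} {c : κ → I → K} {s : Fin (r + 1) → Bool}
    {lab : Fin r → κ} {x y : Fin ℓ → K} {A : Set (Fin (r + 1) × Fin ℓ → K)}
    (hA : ∀ u ∈ A, IsPathPoint f c s lab x y u) {z : Fin (r + 1) × Fin ℓ → L}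
    {v : Fin (r + 1) × Fin ℓ → K} (hv : v ∈ A)
    (hz : ∀ h : MvPolynomial (Fin (r + 1) × Fin ℓ) K, (∀ a ∈ A, eval a h = 0) → aeval z h = 0)
    (hzv : ∀ h : MvPolynomial (Fin (r + 1) × Fin ℓ) K, aeval z h = 0 → eval v h = 0) :
    IsPathPoint (fun i => algebraMap K L ∘ f i) (fun b => algebraMap K L ∘ c b) s lab
      (algebraMap K L ∘ x) (algebraMap K L ∘ y) z where
  first t := by
    have := hz (X (0, t) - C (x t)) fun a ha => by simp [(hA a ha).first]
    simpa [sub_eq_zero] using this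
  last t := by
    have := hz (X (Fin.last r, t) - C (y t)) fun a ha => by simp [(hA a ha).last]
    simpa [sub_eq_zero] using this
  injective i j hij := by
    refine (hA v hv).injective ?_
    simp only [pathVertex, Prod.mk.injEq, funext_iff] at hij ⊢
    refine ⟨hij.1, fun t => ?_⟩
    have := hzv (X (i, t) - X (j, t)) (by simp [hij.2 t])
    simpa [sub_eq_zero] using this
  value j i := by
    let h : MvPolynomial (Fin (r + 1) × Fin ℓ) K :=
      polyValue (C ∘ f i) (X ∘ edgeIndex s j) - C (c (lab j) i)
    have h1 : ∀ a, eval a h = polyValue (f i) (a ∘ edgeIndex s j) - c (lab j) i := by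
      intro a
      simp only [h, map_sub, map_polyValue, eval_C]
      congr 2 <;> funext <;> simp
    have h2 : aeval z h = polyValue (algebraMap K L ∘ f i) (z ∘ edgeIndex s j) -
        algebraMap K L (c (lab j) i) := by
      let ψ : MvPolynomial (Fin (r + 1) × Fin ℓ) K →ₐ[K] L := aeval z
      have h3 := map_polyValue ψ.toRingHom (C ∘ f i) (X ∘ edgeIndex s j)
      have hC : ψ.toRingHom ∘ C ∘ f i = algebraMap K L ∘ f i := by funext; simp [ψ]
      have hX : ψ.toRingHom ∘ X ∘ edgeIndex s j = z ∘ edgeIndex s j := by funext; simp [ψ]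
      rw [hC, hX] at h3
      rw [← h3]
      simp only [h, map_sub, aeval_C]
      rfl
    have h3 := hz h fun a ha => by rw [h1, (hA a ha).value, sub_self]
    rw [h2, sub_eq_zero] at h3
    exact h3

/-- A finite graph in the algebraic graph given by `f` and `c`, grown from the roots `x` and `y`
with at least `ℓ / (ℓ - 1)` edges for each new vertex, whose vertices together with the
coefficients of `f` have transcendence degree at least `n` larger than the number of
coefficients. -/
def IsConfiguration (k : Type) {ℓ d : ℕ} {κ K : Type} [Field k] [Field K] [Algebra k K]
    (f : Fin (ℓ - 1) → (Bool × Fin ℓ → Fin (d + 1)) → K) (c : κ → Fin (ℓ - 1) → K)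
    (x y : Bool × (Fin ℓ → K)) (n : ℕ) : Prop :=
  ∃ (V : Finset (Bool × (Fin ℓ → K))) (E : Finset (Bool × Fin ℓ → K)), x ∈ V ∧ y ∈ V ∧
    V.card * ℓ ≤ 2 * ℓ + E.card * (ℓ - 1) ∧ E.card ≤ n * ℓ ∧ (∀ e ∈ E, ∀ b, edgeEnd e b ∈ V) ∧
    (∀ e ∈ E, ∃ b, ∀ i, polyValue (f i) e = c b i) ∧
    ∃ (ι : Type) (_ : Fintype ι) (h : ι → K),
      Fintype.card ι = (ℓ - 1) * Fintype.card (Bool × Fin ℓ → Fin (d + 1)) + n ∧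
      AlgebraicIndependent k h ∧ ∀ a, (∃ i m, h a = f i m) ∨ ∃ v ∈ V, ∃ t, h a = v.2 t

theorem IsConfiguration.zero {k : Type} {ℓ d : ℕ} {κ K : Type} [Field k] [Field K] [Algebra k K]
    {f : Fin (ℓ - 1) → (Bool × Fin ℓ → Fin (d + 1)) → K}
    (hf : AlgebraicIndependent k (Function.uncurry f)) (c : κ → Fin (ℓ - 1) → K)
    (x y : Bool × (Fin ℓ → K)) : IsConfiguration k f c x y 0 := by
  classical
  refine ⟨{x, y}, ∅, by simp, by simp, ?_, by simp, by simp, by simp, _, inferInstance, _,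
    ?_, hf, fun a => Or.inl ⟨a.1, a.2, rfl⟩⟩
  · have := Nat.mul_le_mul_right ℓ (Finset.card_le_two (a := x) (b := y))
    simpa using this
  · rw [Fintype.card_prod, Fintype.card_fin]; rfl

/-- Configurations cannot be too generic: their edges determine many coefficients of `f`. -/
theorem IsConfiguration.bound {k : Type} {ℓ d : ℕ} {κ K : Type} [Field k] [Field K] [Algebra k K]
    [Fintype κ] {f : Fin (ℓ - 1) → (Bool × Fin ℓ → Fin (d + 1)) → K} {c : κ → Fin (ℓ - 1) → K}
    {x y : Bool × (Fin ℓ → K)} {n : ℕ} (h : IsConfiguration k f c x y n) (hd : n * ℓ ≤ d + 1) :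
    n ≤ 2 * ℓ + Fintype.card κ * (ℓ - 1) := by
  classical
  obtain ⟨V, E, -, -, hVE, hE, hEV, hval, ι, _, w, hcard, hw, hwm⟩ := h
  obtain ⟨D, hD, hdet⟩ := exists_determining_monomials E (hE.trans hd)
  let Y1 : Finset K := (V ×ˢ Finset.univ).image fun p => p.1.2 p.2
  let Y2 : Finset K := Finset.univ.image fun p : κ × Fin (ℓ - 1) => c p.1 p.2
  let Y3 : Finset K := (Finset.univ ×ˢ Dᶜ).image fun p => f p.1 p.2
  let Y := Y1 ∪ Y2 ∪ Y3
  have hY : Y.card ≤ V.card * ℓ + Fintype.card κ * (ℓ - 1) +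
      (ℓ - 1) * (Fintype.card (Bool × Fin ℓ → Fin (d + 1)) - E.card) := by
    refine (Finset.card_union_le _ _).trans (add_le_add ((Finset.card_union_le _ _).trans
      (add_le_add ?_ ?_)) ?_)
    · exact Finset.card_image_le.trans (by simp)
    · exact Finset.card_image_le.trans (by simp)
    · exact Finset.card_image_le.trans (by rw [Finset.card_product, Finset.card_compl, hD]; simp)
  let L : Subfield K :=
    { (Subalgebra.algebraicClosure (Algebra.adjoin k (Y : Set K)) K).toSubring with
      inv_mem' := fun a ha => IsAlgebraic.inv ha }
  have hL : ∀ a, a ∈ L ↔ IsAlgebraic (Algebra.adjoin k (Y : Set K)) a := fun a => Iff.rfl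
  have hYL : ∀ a ∈ Y, a ∈ L := fun a ha =>
    isAlgebraic_algebraMap (⟨a, Algebra.subset_adjoin ha⟩ : Algebra.adjoin k (Y : Set K))
  have hVL : ∀ v ∈ V, ∀ t, v.2 t ∈ L := fun v hv t => hYL _ <|
    Finset.mem_union_left _ <| Finset.mem_union_left _ <|
      Finset.mem_image.2 ⟨(v, t), by simp [hv], rfl⟩
  have hfL : ∀ i m, f i m ∈ L := by
    intro i
    refine hdet L (f i) (fun e he p => ?_) (fun e he => ?_) fun m hm => ?_
    · exact hVL _ (hEV e he p.1) p.2
    · obtain ⟨b, hb⟩ := hval e he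
      rw [hb i]
      exact hYL _ <| Finset.mem_union_left _ <| Finset.mem_union_right _ <|
        Finset.mem_image.2 ⟨(b, i), Finset.mem_univ _, rfl⟩
    · exact hYL _ <| Finset.mem_union_right _ <|
        Finset.mem_image.2 ⟨(i, m), by simp [hm], rfl⟩
  have hle := hw.card_le_of_isAlgebraic_adjoin Y fun a => by
    rw [← hL]
    rcases hwm a with ⟨i, m, h⟩ | ⟨v, hv, t, h⟩
    · rw [h]; exact hfL i m
    · rw [h]; exact hVL v hv t
  have hED : E.card ≤ Fintype.card (Bool × Fin ℓ → Fin (d + 1)) := hD ▸ Finset.card_le_univ D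
  obtain ⟨g, hg⟩ := Nat.exists_eq_add_of_le hED
  rw [hcard, hg] at hle
  rw [hg, Nat.add_sub_cancel_left] at hY
  nlinarith [hle.trans hY]

/-- An infinite family of paths makes it possible to enlarge a configuration by a generic path. -/
theorem IsConfiguration.succ {k : Type} {ℓ r d : ℕ} {κ K : Type} [Field k] [Field K]
    [Algebra k K] {f : Fin (ℓ - 1) → (Bool × Fin ℓ → Fin (d + 1)) → K} {c : κ → Fin (ℓ - 1) → K}
    {s : Fin (r + 1) → Bool} {lab : Fin r → κ} {x y : Fin ℓ → K} {n : ℕ} (hr : r ≤ ℓ)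
    (hs : ∀ j : Fin r, s j.castSucc ≠ s j.succ)
    (h : IsConfiguration k f c (s 0, x) (s (Fin.last r), y) n)
    {A : Set (Fin (r + 1) × Fin ℓ → K)} (hA : A.Infinite)
    (hAp : ∀ u ∈ A, IsPathPoint f c s lab x y u) :
    ∃ (L : Type) (_ : Field L) (_ : Algebra k L) (φ : K →ₐ[k] L),
      IsConfiguration k (fun i => φ ∘ f i) (fun b => φ ∘ c b) (s 0, φ ∘ x)
        (s (Fin.last r), φ ∘ y) (n + 1) := by
  classical
  obtain ⟨L, _, _, z, v, hv, hz, hzv, t₀, ht₀⟩ := exists_generic_point hA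
  let _ : Algebra k L := ((algebraMap K L).comp (algebraMap k K)).toAlgebra
  have : IsScalarTower k K L := IsScalarTower.of_algebraMap_eq fun _ => rfl
  refine ⟨L, inferInstance, inferInstance, IsScalarTower.toAlgHom k K L, ?_⟩
  have hp := IsPathPoint.generic hAp hv hz hzv
  obtain ⟨V, E, hxV, hyV, hVE, hE, hEV, hval, ι, _, w, hcard, hw, hwm⟩ := h
  let φ := algebraMap K L
  have hφ : Function.Injective φ := φ.injective
  let W : Finset (Bool × (Fin ℓ → L)) := V.image fun v => (v.1, φ ∘ v.2)
  let E₀ : Finset (Bool × Fin ℓ → L) := E.image fun e => φ ∘ e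
  have hx : pathVertex s z 0 ∈ W := by
    refine Finset.mem_image.2 ⟨_, hxV, ?_⟩
    simp only [pathVertex, Prod.mk.injEq, true_and]
    exact funext fun t => (hp.first t).symm
  have hy : pathVertex s z (Fin.last r) ∈ W := by
    refine Finset.mem_image.2 ⟨_, hyV, ?_⟩
    simp only [pathVertex, Prod.mk.injEq, true_and]
    exact funext fun t => (hp.last t).symm
  have hE₀ : ∀ e ∈ E₀, ∀ b, edgeEnd e b ∈ W := by
    intro e he b
    obtain ⟨e, he', rfl⟩ := Finset.mem_image.1 he
    exact Finset.mem_image.2 ⟨_, hEV e he' b, rfl⟩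
  have hnew := card_new_vertices_mul_le hr (pathVertex s z) W hx hy
  set J := Finset.univ.filter fun j => pathVertex s z j ∉ W with hJ
  set T := Finset.univ.filter fun j : Fin r => pathVertex s z j.castSucc ∉ W ∨
    pathVertex s z j.succ ∉ W with hT
  have hdisj : Disjoint E₀ (T.image fun j => z ∘ edgeIndex s j) := by
    rw [Finset.disjoint_left]
    intro e he he'
    obtain ⟨j, hj, rfl⟩ := Finset.mem_image.1 he'
    have h1 := hE₀ _ he (s j.castSucc)
    have h2 := hE₀ _ he (s j.succ)
    rw [edgeEnd_castSucc] at h1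
    rw [edgeEnd_succ hs] at h2
    rcases (Finset.mem_filter.1 hj).2 with h | h
    · exact h h1
    · exact h h2
  have hcardE : (E₀ ∪ T.image fun j => z ∘ edgeIndex s j).card = E.card + T.card := by
    rw [Finset.card_union_of_disjoint hdisj, Finset.card_image_of_injective _ hφ.comp_left,
      Finset.card_image_of_injective _ (edge_injective hs hp.injective)]
  have hcardV : (W ∪ J.image (pathVertex s z)).card ≤ V.card + J.card :=
    (Finset.card_union_le _ _).trans (add_le_add Finset.card_image_le Finset.card_image_le)
  have hmem : ∀ j, pathVertex s z j ∈ W ∪ J.image (pathVertex s z) := by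
    intro j
    by_cases hj : pathVertex s z j ∈ W
    · exact Finset.mem_union_left _ hj
    · exact Finset.mem_union_right _ (Finset.mem_image_of_mem _ (Finset.mem_filter.2
        ⟨Finset.mem_univ _, hj⟩))
  have hTr : T.card ≤ r := (Finset.card_le_univ T).trans (by simp)
  refine ⟨W ∪ J.image (pathVertex s z), E₀ ∪ T.image fun j => z ∘ edgeIndex s j,
    Finset.mem_union_left _ (Finset.mem_image.2 ⟨_, hxV, rfl⟩),
    Finset.mem_union_left _ (Finset.mem_image.2 ⟨_, hyV, rfl⟩), ?_, ?_, ?_, ?_,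
    ι ⊕ Unit, inferInstance, Sum.elim (φ ∘ w) fun _ => z t₀, ?_, ?_, ?_⟩
  · rw [hcardE]
    have := Nat.mul_le_mul_right ℓ hcardV
    rw [add_mul] at this ⊢
    omega
  · rw [hcardE, add_mul]
    omega
  · intro e he b
    rcases Finset.mem_union.1 he with he | he
    · exact Finset.mem_union_left _ (hE₀ e he b)
    · obtain ⟨j, hj, rfl⟩ := Finset.mem_image.1 he
      rcases edgeEnd_eq_or hs z j b with h | h <;> rw [h] <;> exact hmem _
  · intro e he
    rcases Finset.mem_union.1 he with he | he
    · obtain ⟨e, he', rfl⟩ := Finset.mem_image.1 he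
      obtain ⟨b, hb⟩ := hval e he'
      refine ⟨b, fun i => ?_⟩
      have := map_polyValue φ (f i) e
      rw [hb i] at this
      exact this.symm
    · obtain ⟨j, hj, rfl⟩ := Finset.mem_image.1 he
      exact ⟨lab j, hp.value j⟩
  · simp only [Fintype.card_sum, Fintype.card_unit, hcard]; omega
  · have h1 : AlgebraicIndependent K fun _ : Unit => z t₀ :=
      algebraicIndependent_unique_type_iff.2 ht₀
    have h2 := (hw.sumElim_comp h1).comp _ Sum.swap_leftInverse.injective
    convert h2 using 1
    funext a
    rcases a with a | a <;> rfl
  · rintro (a | a)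
    · rcases hwm a with ⟨i, m, h⟩ | ⟨v, hv, t, h⟩
      · exact Or.inl ⟨i, m, congrArg φ h⟩
      · exact Or.inr ⟨_, Finset.mem_union_left _ (Finset.mem_image_of_mem _ hv), t, congrArg φ h⟩
    · exact Or.inr ⟨_, hmem t₀.1, t₀.2, rfl⟩

/-- If the coefficients of `f` are algebraically independent, then there are only finitely many
paths of a given shape between two given vertices. -/
theorem finite_setOf_isPathPoint {k : Type} {ℓ r d : ℕ} {κ K : Type} [Field k] [Field K]
    [Algebra k K] [Fintype κ] {f : Fin (ℓ - 1) → (Bool × Fin ℓ → Fin (d + 1)) → K}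
    (hf : AlgebraicIndependent k (Function.uncurry f))
    (hd : (2 * ℓ + Fintype.card κ * (ℓ - 1) + 1) * ℓ ≤ d + 1) (hr : r ≤ ℓ)
    {s : Fin (r + 1) → Bool} (hs : ∀ j : Fin r, s j.castSucc ≠ s j.succ)
    (c : κ → Fin (ℓ - 1) → K) (lab : Fin r → κ) (x y : Fin ℓ → K) :
    {u | IsPathPoint f c s lab x y u}.Finite := by
  by_contra hA
  have main : ∀ n : ℕ, ∃ (L : Type) (_ : Field L) (_ : Algebra k L) (φ : K →ₐ[k] L),
      IsConfiguration k (fun i => φ ∘ f i) (fun b => φ ∘ c b) (s 0, φ ∘ x)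
        (s (Fin.last r), φ ∘ y) n := by
    intro n
    induction n with
    | zero => exact ⟨K, inferInstance, inferInstance, AlgHom.id k K, .zero hf c _ _⟩
    | succ n ih =>
      obtain ⟨L, _, _, φ, h⟩ := ih
      have hφ : Function.Injective φ := φ.toRingHom.injective
      obtain ⟨M, _, _, ψ, h'⟩ := h.succ (lab := lab) hr hs
        (Set.Infinite.image hφ.comp_left.injOn hA)
        (by rintro _ ⟨u, hu, rfl⟩; exact hu.map φ.toRingHom)
      exact ⟨M, inferInstance, inferInstance, ψ.comp φ, h'⟩
  obtain ⟨L, _, _, φ, h⟩ := main (2 * ℓ + Fintype.card κ * (ℓ - 1) + 1)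
  have := h.bound hd
  omega

open Filter MvPolynomial in
/-- An ultraproduct argument: over one field, the solution sets of the path equations of a given
shape are uniformly bounded for all coefficients that avoid a suitable hypersurface. -/
theorem exists_bound_card_isPathPoint {k Ω : Type} [Field k] [Countable k] [Field Ω] [Algebra k Ω]
    {ℓ r d : ℕ} {κ : Type} [Fintype κ]
    (hd : (2 * ℓ + Fintype.card κ * (ℓ - 1) + 1) * ℓ ≤ d + 1) (hr : r ≤ ℓ)
    {s : Fin (r + 1) → Bool} (hs : ∀ j : Fin r, s j.castSucc ≠ s j.succ) (lab : Fin r → κ) :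
    ∃ (Q : MvPolynomial (Fin (ℓ - 1) × (Bool × Fin ℓ → Fin (d + 1))) k) (T : ℕ), Q ≠ 0 ∧
      ∀ f : Fin (ℓ - 1) → (Bool × Fin ℓ → Fin (d + 1)) → Ω, aeval (Function.uncurry f) Q ≠ 0 →
        ∀ (c : κ → Fin (ℓ - 1) → Ω) (x y : Fin ℓ → Ω) (A : Finset (Fin (r + 1) × Fin ℓ → Ω)),
          (∀ u ∈ A, IsPathPoint f c s lab x y u) → A.card < T := by
  classical
  have : Countable (MvPolynomial (Fin (ℓ - 1) × (Bool × Fin ℓ → Fin (d + 1))) k) :=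
    Cardinal.mk_le_aleph0_iff.1 (MvPolynomial.cardinalMk_le_max.trans
      (max_le (max_le Cardinal.mk_le_aleph0 Cardinal.mk_le_aleph0) le_rfl))
  obtain ⟨P, hP⟩ := exists_surjective_nat
    (MvPolynomial (Fin (ℓ - 1) × (Bool × Fin ℓ → Fin (d + 1))) k)
  let Q : ℕ → MvPolynomial (Fin (ℓ - 1) × (Bool × Fin ℓ → Fin (d + 1))) k := fun T =>
    ∏ i ∈ Finset.range T, if P i = 0 then 1 else P i
  have hQ : ∀ T, Q T ≠ 0 := fun T => Finset.prod_ne_zero_iff.2 fun i _ => by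
    split_ifs with h
    exacts [one_ne_zero, h]
  have hQP : ∀ {T i} {z : Fin (ℓ - 1) × (Bool × Fin ℓ → Fin (d + 1)) → Ω}, i < T → P i ≠ 0 →
      aeval z (Q T) ≠ 0 → aeval z (P i) ≠ 0 := by
    intro T i z hi hPi hz h
    refine hz ?_
    rw [map_prod]
    exact Finset.prod_eq_zero (Finset.mem_range.2 hi) (by rw [if_neg hPi, h])
  by_contra! hcon
  choose f hf c x y A hA hAT using fun T => hcon (Q T) T (hQ T)
  have hu : ∀ T, ∃ u : ℕ → Fin (r + 1) × Fin ℓ → Ω, ∀ i < T, u i ∈ A T ∧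
      ∀ j < T, u i = u j → i = j := by
    intro T
    let g := (A T).equivFin.symm
    refine ⟨fun i => if h : i < (A T).card then g ⟨i, h⟩ else 0, fun i hi => ⟨?_, fun j hj => ?_⟩⟩
    · dsimp only
      rw [dif_pos (hi.trans_le (hAT T))]
      exact (g _).2
    · dsimp only
      rw [dif_pos (hi.trans_le (hAT T)), dif_pos (hj.trans_le (hAT T)), Subtype.coe_inj,
        g.injective.eq_iff, Fin.mk.injEq]
      exact id
  choose u hu using hu
  let φ : (ℕ → Ω) →+* Germ (hyperfilter ℕ : Filter ℕ) Ω := Germ.coeRingHom _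
  let _ : Algebra k (Germ (hyperfilter ℕ : Filter ℕ) Ω) :=
    (φ.comp (algebraMap k (ℕ → Ω))).toAlgebra
  have hφ : ∀ a b : ℕ → Ω, φ a = φ b ↔ ∀ᶠ T in hyperfilter ℕ, a T = b T := fun a b =>
    Germ.coe_eq
  have hgt : ∀ i : ℕ, ∀ᶠ T in hyperfilter ℕ, i < T := fun i =>
    Nat.hyperfilter_le_atTop (eventually_gt_atTop i)
  let F : Fin (ℓ - 1) → (Bool × Fin ℓ → Fin (d + 1)) → ℕ → Ω := fun i m T => f T i m
  have hF : AlgebraicIndependent k (Function.uncurry fun i m => φ (F i m)) := by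
    rw [algebraicIndependent_iff]
    intro p hp
    by_contra hp0
    obtain ⟨i, rfl⟩ := hP p
    have h1 : aeval (Function.uncurry fun i m => φ (F i m)) (P i) =
        φ (aeval (Function.uncurry F) (P i)) := by
      rw [aeval_def, aeval_def, hom_eval₂]
      rfl
    rw [h1, ← map_zero φ, hφ] at hp
    obtain ⟨T, hT, hiT⟩ := (hp.and (hgt i)).exists
    refine hQP hiT hp0 (hf T) ?_
    have h2 : (aeval (Function.uncurry F) (P i)) T = aeval (Function.uncurry (f T)) (P i) := by
      have := hom_eval₂ (P i) (algebraMap k (ℕ → Ω)) (Pi.evalRingHom (fun _ : ℕ => Ω) T)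
        (Function.uncurry F)
      exact this
    rw [← h2, hT]
    rfl
  have hfin := finite_setOf_isPathPoint hF hd hr hs (fun b i => φ fun T => c T b i) lab
    (fun t => φ fun T => x T t) (fun t => φ fun T => y T t)
  refine Set.infinite_of_injective_forall_mem (f := fun (n : ℕ) p => φ fun T => u T n p)
    ?_ ?_ hfin
  · intro m n hmn
    have h1 : ∀ p, ∀ᶠ T in hyperfilter ℕ, u T m p = u T n p := fun p =>
      (hφ _ _).1 (congrFun hmn p)
    obtain ⟨T, ⟨hT, hm⟩, hn⟩ := (((eventually_all.2 h1).and (hgt m)).and (hgt n)).exists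
    exact (hu T m hm).2 n hn (funext hT)
  · intro n
    have hn : ∀ᶠ T in hyperfilter ℕ, IsPathPoint (f T) (c T) s lab (x T) (y T) (u T n) :=
      (hgt n).mono fun T hT => hA T _ (hu T n hT).1
    refine ⟨fun t => (hφ _ _).2 (hn.mono fun T h => h.first t),
      fun t => (hφ _ _).2 (hn.mono fun T h => h.last t), fun i j hij => ?_, fun j i => ?_⟩
    · simp only [pathVertex, Prod.mk.injEq, _root_.funext_iff, hφ] at hij
      obtain ⟨T, hT, h⟩ := ((eventually_all.2 hij.2).and hn).exists
      exact h.injective (Prod.ext hij.1 (funext hT))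
    · have h1 := map_polyValue φ (F i) (fun p T => u T n (edgeIndex s j p))
      refine h1.symm.trans ((hφ _ _).2 (hn.mono fun T h => ?_))
      have h2 := map_polyValue (Pi.evalRingHom (fun _ : ℕ => Ω) T) (F i)
        (fun p T => u T n (edgeIndex s j p))
      exact h2.trans (h.value j i)

/-- The bipartite graph between two copies of `Fin ℓ → K` whose edges are the points where the
polynomial map with coefficients `f` takes one of the values `c b`. -/
def algebraicGraph {ℓ d : ℕ} {I κ K : Type} [CommRing K]
    (f : I → (Bool × Fin ℓ → Fin (d + 1)) → K) (c : κ → I → K) :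
    SimpleGraph (Bool × (Fin ℓ → K)) where
  Adj v w := v.1 ≠ w.1 ∧
    ∃ b, ∀ i, polyValue (f i) (fun p => if v.1 = p.1 then v.2 p.2 else w.2 p.2) = c b i
  symm := ⟨by
    rintro ⟨b, v⟩ ⟨b', w⟩ ⟨hb, e, h⟩
    refine ⟨hb.symm, e, fun i => ?_⟩
    rw [← h i]
    congr 1
    funext ⟨a, t⟩
    revert hb
    cases a <;> cases b <;> cases b' <;> simp⟩
  loopless := ⟨fun _ h => h.1 rfl⟩

/-- The number of short paths in an algebraic graph over a finite field is bounded, as long as the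
coefficients avoid a suitable hypersurface. -/
theorem exists_bound_pathCount_algebraicGraph {k Ω : Type} [Field k] [Countable k] [Field Ω]
    [Algebra k Ω] {ℓ r d : ℕ} {κ : Type} [Fintype κ]
    (hd : (2 * ℓ + Fintype.card κ * (ℓ - 1) + 1) * ℓ ≤ d + 1) (hr : r ≤ ℓ) :
    ∃ (Q : MvPolynomial (Fin (ℓ - 1) × (Bool × Fin ℓ → Fin (d + 1))) k) (T : ℕ), Q ≠ 0 ∧
      ∀ (F : Type) [Field F] [Finite F] [Algebra k F], (F →ₐ[k] Ω) →
        ∀ f : Fin (ℓ - 1) → (Bool × Fin ℓ → Fin (d + 1)) → F,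
          MvPolynomial.aeval (Function.uncurry f) Q ≠ 0 →
          ∀ (c : κ → Fin (ℓ - 1) → F) (x y : Bool × (Fin ℓ → F)),
            (algebraicGraph f c).pathCount r x y ≤ T := by
  classical
  choose Q T hQ hT using fun σ : {s : Fin (r + 1) → Bool // ∀ j : Fin r, s j.castSucc ≠ s j.succ} ×
    (Fin r → κ) => exists_bound_card_isPathPoint (k := k) (Ω := Ω) hd hr σ.1.2 σ.2
  refine ⟨∏ σ, Q σ, ∑ σ, T σ, Finset.prod_ne_zero_iff.2 fun σ _ => hQ σ,
    fun F _ _ _ φ f hf c x y => ?_⟩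
  have := Fintype.ofFinite F
  have hφ : Function.Injective φ := φ.toRingHom.injective
  rw [map_prod, Finset.prod_ne_zero_iff] at hf
  let A := fun σ : {s : Fin (r + 1) → Bool // ∀ j : Fin r, s j.castSucc ≠ s j.succ} ×
    (Fin r → κ) => Finset.univ.filter fun u => IsPathPoint f c σ.1.1 σ.2 x.2 y.2 u
  have hA : ∀ σ, (A σ).card ≤ T σ := by
    intro σ
    have h1 : MvPolynomial.aeval (Function.uncurry fun i => φ ∘ f i) (Q σ) ≠ 0 := by
      have h2 : MvPolynomial.aeval (Function.uncurry fun i => φ ∘ f i) (Q σ) =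
          φ (MvPolynomial.aeval (Function.uncurry f) (Q σ)) :=
        (MvPolynomial.comp_aeval_apply _ φ _).symm
      rw [h2]
      exact (map_ne_zero_iff φ hφ).2 (hf σ (Finset.mem_univ _))
    have h2 : ∀ u ∈ A σ, IsPathPoint (fun i => φ ∘ f i) (fun b => φ ∘ c b) σ.1.1 σ.2
        (φ ∘ x.2) (φ ∘ y.2) (φ ∘ u) :=
      fun u hu => (Finset.mem_filter.1 hu).2.map φ.toRingHom
    have h3 := hT σ _ h1 _ _ _ ((A σ).image fun u => φ ∘ u) (Finset.forall_mem_image.2 h2)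
    rw [Finset.card_image_of_injective _ hφ.comp_left] at h3
    exact h3.le
  rw [SimpleGraph.pathCount, Nat.card_eq_fintype_card, Fintype.card_subtype]
  refine (Finset.card_le_card (t := Finset.univ.biUnion fun σ => (A σ).image (pathVertex σ.1.1))
    fun p hp => ?_).trans (Finset.card_biUnion_le.trans
      (Finset.sum_le_sum fun σ _ => Finset.card_image_le.trans (hA σ)))
  obtain ⟨rfl, rfl, hinj, hadj⟩ := (Finset.mem_filter.1 hp).2
  choose hs lab hlab using hadj
  refine Finset.mem_biUnion.2 ⟨⟨⟨fun j => (p j).1, hs⟩, lab⟩, Finset.mem_univ _,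
    Finset.mem_image.2 ⟨fun a => (p a.1).2 a.2, Finset.mem_filter.2 ⟨Finset.mem_univ _,
      fun _ => rfl, fun _ => rfl, hinj, fun j i => ?_⟩, rfl⟩⟩
  rw [← hlab j i]
  congr 1
  funext a
  simp only [edgeIndex, Function.comp_apply]
  split_ifs <;> rfl

theorem SimpleGraph.pathCount_map_le {V W : Type*} [Finite V] {G : SimpleGraph V} (φ : V ↪ W)
    {r T : ℕ} (hr : 0 < r) (hT : ∀ x y, G.pathCount r x y ≤ T) (x y : W) :
    (G.map φ).pathCount r x y ≤ T := by
  rw [pathCount]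
  rcases isEmpty_or_nonempty {p : Fin (r + 1) → W // p 0 = x ∧ p (Fin.last r) = y ∧
    Function.Injective p ∧ ∀ j : Fin r, (G.map φ).Adj (p j.castSucc) (p j.succ)} with h | h
  · rw [Nat.card_of_isEmpty]
    exact Nat.zero_le T
  have key : ∀ p : Fin (r + 1) → W, (∀ j : Fin r, (G.map φ).Adj (p j.castSucc) (p j.succ)) →
      ∃ p' : Fin (r + 1) → V, φ ∘ p' = p := by
    intro p hp
    have : ∀ j, ∃ v, φ v = p j := by
      intro j
      rcases Fin.eq_castSucc_or_eq_last j with ⟨j, rfl⟩ | rfl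
      · obtain ⟨u, v, -, hu, -⟩ := (map_adj φ G _ _).1 (hp j)
        exact ⟨u, hu⟩
      · obtain ⟨m, rfl⟩ := Nat.exists_eq_add_of_lt hr
        obtain ⟨u, v, -, -, hv⟩ := (map_adj φ G _ _).1 (hp (Fin.last _))
        exact ⟨v, hv⟩
    choose p' hp' using this
    exact ⟨p', funext hp'⟩
  obtain ⟨p, rfl, rfl, -, hp⟩ := h
  obtain ⟨q, rfl⟩ := key p hp
  refine (Nat.card_le_card_of_surjective (α := {p : Fin (r + 1) → V // p 0 = q 0 ∧
    p (Fin.last r) = q (Fin.last r) ∧ Function.Injective p ∧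
    ∀ j : Fin r, G.Adj (p j.castSucc) (p j.succ)}) (fun p => ⟨φ ∘ p.1, congrArg φ p.2.1,
      congrArg φ p.2.2.1, φ.injective.comp p.2.2.2.1,
      fun j => (map_adj φ G _ _).2 ⟨_, _, p.2.2.2.2 j, rfl, rfl⟩⟩) ?_).trans (hT _ _)
  rintro ⟨p, h0, hl, hi, hp⟩
  obtain ⟨p, rfl⟩ := key p hp
  refine ⟨⟨p, φ.injective h0, φ.injective hl, hi.of_comp, fun j => ?_⟩, rfl⟩
  obtain ⟨u, v, h, hu, hv⟩ := (map_adj φ G _ _).1 (hp j)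
  rwa [← φ.injective hu, ← φ.injective hv]

/-- Averaging over translates: some translate of a given set of values is taken at least as often
as expected. -/
theorem exists_translate_card_le {α β κ : Type*} [Fintype α] [Fintype β] [Fintype κ] [AddGroup β]
    [DecidableEq β] (g : α → β) {c : κ → β} (hc : Function.Injective c) :
    ∃ τ : β, Fintype.card α * Fintype.card κ ≤
      Fintype.card β * (Finset.univ.filter fun a => ∃ b, g a = c b + τ).card := by
  have hsum : ∑ τ : β, (Finset.univ.filter fun a => ∃ b, g a = c b + τ).card =
      Fintype.card α * Fintype.card κ := by
    simp only [Finset.card_filter]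
    rw [Finset.sum_comm, ← smul_eq_mul, ← Finset.card_univ, ← Finset.sum_const]
    refine Finset.sum_congr rfl fun a _ => ?_
    rw [← Finset.card_filter, ← Finset.card_univ, ← Finset.card_image_of_injective Finset.univ
      (f := fun b => - c b + g a) fun b b' h => hc (neg_injective (add_right_cancel h))]
    congr 1
    ext τ
    simp [eq_neg_add_iff_add_eq, eq_comm]
  obtain ⟨τ, -, hτ⟩ := Finset.exists_max_image Finset.univ
    (fun τ => (Finset.univ.filter fun a => ∃ b, g a = c b + τ).card) ⟨0, Finset.mem_univ _⟩
  refine ⟨τ, ?_⟩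
  rw [← hsum, ← smul_eq_mul, ← Finset.card_univ, ← Finset.sum_const]
  exact Finset.sum_le_sum hτ

theorem card_le_card_edgeSet_algebraicGraph {ℓ d : ℕ} {I κ K : Type} [CommRing K] [Finite K]
    (f : I → (Bool × Fin ℓ → Fin (d + 1)) → K) (c : κ → I → K) :
    Nat.card {e : Bool × Fin ℓ → K // ∃ b, ∀ i, polyValue (f i) e = c b i} ≤
      Nat.card (algebraicGraph f c).edgeSet := by
  refine Nat.card_le_card_of_injective (fun e => ⟨s(edgeEnd e.1 false, edgeEnd e.1 true), ?_⟩) ?_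
  · obtain ⟨e, b, h⟩ := e
    refine ⟨by simp [edgeEnd], b, fun i => ?_⟩
    rw [← h i]
    congr 1
    funext ⟨a, t⟩
    cases a <;> simp [edgeEnd]
  · intro e e' h
    have h := Subtype.ext_iff.1 h
    simp only [edgeEnd, Sym2.eq_iff, Prod.mk.injEq, funext_iff] at h
    refine Subtype.ext (funext fun ⟨a, t⟩ => ?_)
    rcases h with ⟨⟨-, h1⟩, -, h2⟩ | ⟨⟨h1, -⟩, -⟩
    · cases a
      exacts [h1 t, h2 t]
    · cases h1

theorem exists_aeval_ne_zero {σ k F : Type*} [Finite σ] [Field k] [Field F] [Fintype F]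
    [Algebra k F] {Q : MvPolynomial σ k} (hQ : Q ≠ 0) (hF : Q.totalDegree < Fintype.card F) :
    ∃ a : σ → F, MvPolynomial.aeval a Q ≠ 0 := by
  by_contra! h
  refine hQ (MvPolynomial.map_injective (algebraMap k F) (algebraMap k F).injective ?_)
  rw [map_zero]
  refine MvPolynomial.eq_zero_of_eval_zero_at_prod_finset _ (fun _ => Finset.univ) (fun i => ?_)
    fun a _ => ?_
  · refine lt_of_le_of_lt ((MvPolynomial.degreeOf_le_totalDegree _ i).trans ?_) hF
    exact Finset.sup_mono (MvPolynomial.support_map_subset _ _)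
  · rw [MvPolynomial.eval_map, ← MvPolynomial.aeval_def, h]

theorem quarter_mul_rpow_le {ℓ j n : ℕ} (hℓ : 1 ≤ ℓ) (hn : n ≤ 2 ^ (ℓ * (j + 1) + 1)) :
    (1 / 4 : ℝ) * (n : ℝ) ^ (1 + 1 / (ℓ : ℝ)) ≤ 2 ^ ((j + 1) * (ℓ + 1)) := by
  have hℓ' : (1 : ℝ) ≤ ℓ := by exact_mod_cast hℓ
  have h1 : (n : ℝ) ≤ (2 : ℝ) ^ ((ℓ * (j + 1) + 1 : ℕ) : ℝ) := by
    rw [Real.rpow_natCast]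
    exact_mod_cast hn
  have h2 : (n : ℝ) ^ (1 + 1 / (ℓ : ℝ)) ≤ (2 : ℝ) ^ (((j + 1) * (ℓ + 1) + 2 : ℕ) : ℝ) := by
    refine (Real.rpow_le_rpow n.cast_nonneg h1 (by positivity)).trans ?_
    rw [← Real.rpow_mul (by norm_num)]
    refine Real.rpow_le_rpow_of_exponent_le (by norm_num) ?_
    push_cast
    have h3 : 1 / (ℓ : ℝ) ≤ 1 := (div_le_one (by linarith)).2 hℓ'
    have h4 : ((ℓ : ℝ) * (j + 1) + 1) * (1 + 1 / ℓ) = (j + 1) * (ℓ + 1) + 1 + 1 / ℓ := by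
      field_simp
      ring
    rw [h4]
    linarith
  rw [Real.rpow_natCast, pow_add] at h2
  linarith

theorem SimpleGraph.card_edgeSet_map {V W : Type*} (φ : V ↪ W) (G : SimpleGraph V) :
    Nat.card (G.map φ).edgeSet = Nat.card G.edgeSet := by
  rw [edgeSet_map]
  exact Nat.card_image_of_injective φ.sym2Map.injective _

/-- Over a large field with `q` elements, some algebraic graph with `2 * q ^ ℓ` vertices has at
least `Fintype.card κ * q ^ (ℓ + 1)` edges and few short paths. -/
theorem exists_algebraicGraph (k Ω κ : Type) [Field k] [Countable k] [Field Ω] [Algebra k Ω]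
    [Fintype κ] {ℓ : ℕ} (hℓ : 1 ≤ ℓ) :
    ∃ (d D : ℕ) (B : ℕ → ℕ), ∀ (F : Type) [Field F] [Fintype F] [Algebra k F], (F →ₐ[k] Ω) →
      D < Fintype.card F → Fintype.card κ ≤ Fintype.card F ^ (ℓ - 1) →
      ∃ (f : Fin (ℓ - 1) → (Bool × Fin ℓ → Fin (d + 1)) → F) (c : κ → Fin (ℓ - 1) → F),
        Fintype.card κ * Fintype.card F ^ (ℓ + 1) ≤ Nat.card (algebraicGraph f c).edgeSet ∧
        ∀ r ≤ ℓ, ∀ x y, (algebraicGraph f c).pathCount r x y ≤ B r := by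
  classical
  let d := (2 * ℓ + Fintype.card κ * (ℓ - 1) + 1) * ℓ
  choose Q B hQ hB using fun r : Fin (ℓ + 1) => exists_bound_pathCount_algebraicGraph (k := k)
    (Ω := Ω) (κ := κ) (d := d) (Nat.le_succ _) (Nat.lt_succ_iff.1 r.2)
  refine ⟨d, (∏ r, Q r).totalDegree, fun r => B (Fin.ofNat (ℓ + 1) r), fun F _ _ _ φ hD hκ => ?_⟩
  obtain ⟨a, ha⟩ := exists_aeval_ne_zero (Finset.prod_ne_zero_iff.2 fun r _ => hQ r) hD
  rw [map_prod, Finset.prod_ne_zero_iff] at ha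
  obtain ⟨c⟩ : Nonempty (κ ↪ (Fin (ℓ - 1) → F)) :=
    Function.Embedding.nonempty_of_card_le (by simpa using hκ)
  let f : Fin (ℓ - 1) → (Bool × Fin ℓ → Fin (d + 1)) → F := Function.curry a
  obtain ⟨τ, hτ⟩ := exists_translate_card_le
    (fun (e : Bool × Fin ℓ → F) i => polyValue (f i) e) c.injective
  refine ⟨f, fun b => c b + τ, ?_, fun r hr x y => ?_⟩
  · have h1 := card_le_card_edgeSet_algebraicGraph f fun b => c b + τ
    rw [Nat.card_eq_fintype_card, Fintype.card_subtype] at h1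
    simp only [funext_iff] at hτ
    have h2 := hτ.trans (Nat.mul_le_mul_left _ h1)
    refine Nat.le_of_mul_le_mul_left (c := Fintype.card F ^ (ℓ - 1)) ?_
      (pow_pos Fintype.card_pos _)
    simp only [Fintype.card_fun, Fintype.card_prod, Fintype.card_bool, Fintype.card_fin] at h2
    refine (Eq.le ?_).trans h2
    rw [mul_left_comm, ← pow_add, mul_comm]
    congr 2
    omega
  · have hr' : r < ℓ + 1 := Nat.lt_succ_iff.2 hr
    have h := hB ⟨r, hr'⟩ F φ f (ha _ (Finset.mem_univ _)) (fun b => c b + τ) x y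
    beta_reduce
    rwa [show Fin.ofNat (ℓ + 1) r = ⟨r, hr'⟩ from Fin.ext (Nat.mod_eq_of_lt hr')]

/-- For every `ℓ ≥ 2` there are `T` and `n₀` such that for every `n ≥ n₀` there is a
bipartite graph on `n` vertices with at least `(1/4)·n^{1+1/ℓ}` edges in which every
pair of distinct vertices is joined by fewer than `T` paths of length at most `ℓ`. -/
theorem exists_graph_few_short_paths (ℓ : ℕ) (hℓ : 2 ≤ ℓ) :
    ∃ T n0 : ℕ, ∀ n : ℕ, n0 ≤ n →
      ∃ G : SimpleGraph (Fin n), G.Colorable 2 ∧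
        (1 / 4 : ℝ) * (n : ℝ) ^ (1 + 1 / (ℓ : ℝ)) ≤ (Nat.card G.edgeSet : ℝ) ∧
        ∀ x y : Fin n, x ≠ y → (∑ r ∈ Finset.Icc 1 ℓ, G.pathCount r x y) < T := by
  obtain ⟨d, D, B, h⟩ := exists_algebraicGraph (ZMod 2) (AlgebraicClosure (ZMod 2))
    (Fin (2 ^ (ℓ + 1))) (one_le_two.trans hℓ)
  refine ⟨∑ r ∈ Finset.Icc 1 ℓ, B r + 1, 2 * (2 ^ ℓ) ^ (D + ℓ + 1), fun n hn => ?_⟩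
  let j := Nat.log (2 ^ ℓ) (n / 2)
  have hb : 1 < 2 ^ ℓ := Nat.one_lt_two_pow (by omega)
  have hn2 : (2 ^ ℓ) ^ (D + ℓ + 1) ≤ n / 2 := by omega
  have hpos : 0 < (2 ^ ℓ) ^ (D + ℓ + 1) := by positivity
  have hj : D + ℓ + 1 ≤ j := (Nat.le_log_iff_pow_le hb (by omega)).2 hn2
  have hjn : (2 ^ ℓ) ^ j ≤ n / 2 := Nat.pow_log_le_self _ (by omega)
  have hnj : n / 2 < (2 ^ ℓ) ^ (j + 1) := Nat.lt_pow_succ_log_self hb _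
  have := Fintype.ofFinite (GaloisField 2 j)
  have hF : Fintype.card (GaloisField 2 j) = 2 ^ j := by
    rw [← Nat.card_eq_fintype_card, GaloisField.card 2 j (by omega)]
  obtain ⟨f, c, hE, hB⟩ := h (GaloisField 2 j) IsAlgClosed.lift
    (by rw [hF]; exact lt_of_le_of_lt (by omega : D ≤ j) Nat.lt_two_pow_self)
    (by
      rw [hF, Fintype.card_fin, ← pow_mul]
      exact Nat.pow_le_pow_right two_pos
        ((by omega : ℓ + 1 ≤ j).trans (Nat.le_mul_of_pos_right j (by omega))))
  obtain ⟨φ⟩ : Nonempty ((Bool × (Fin ℓ → GaloisField 2 j)) ↪ Fin n) :=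
    Function.Embedding.nonempty_of_card_le (by
      simp only [Fintype.card_prod, Fintype.card_bool, Fintype.card_fun, Fintype.card_fin, hF]
      rw [← pow_mul, mul_comm j, pow_mul]
      omega)
  refine ⟨(algebraicGraph f c).map φ, ?_, ?_, fun x y _ => ?_⟩
  · refine ((SimpleGraph.Coloring.mk (fun x => (Function.invFun φ x).1) ?_ :
      ((algebraicGraph f c).map φ).Coloring Bool)).colorable
    rintro _ _ h
    obtain ⟨u, v, huv, rfl, rfl⟩ := (SimpleGraph.map_adj φ _ _ _).1 h
    rw [Function.leftInverse_invFun φ.injective, Function.leftInverse_invFun φ.injective]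
    exact huv.1
  · rw [SimpleGraph.card_edgeSet_map]
    refine (quarter_mul_rpow_le (j := j) (by omega) ?_).trans
      (le_trans (le_of_eq ?_) (Nat.cast_le.2 hE))
    · rw [pow_succ, pow_mul]
      omega
    · rw [hF, Fintype.card_fin]
      push_cast
      rw [← pow_mul, ← pow_add]
      congr 1
      ring
  · refine Nat.lt_succ_of_le (Finset.sum_le_sum fun r hr => ?_)
    exact SimpleGraph.pathCount_map_le φ (Finset.mem_Icc.1 hr).1 (hB r (Finset.mem_Icc.1 hr).2) x y
end

section
/- Let q be a prime power, and let t ≥ 1, d ≥ 0, m ≥ 1 be integers with d ≥ m − 1 and q ≥ m(m−1)/2. Let x_1, …, x_m be pairwise distinct points of F_q^t. Then the number of polynomials f over F_q in t variables of total degree at most d satisfying f(x_1) = f(x_2) = ⋯ = f(x_m) = 0 equals N/q^m, where N is the total number of polynomials over F_q in t variables of total degree at most d. Equivalently, for f chosen uniformly at random among all such polynomials, the probability that f vanishes at all of x_1, …, x_m is exactly q^{−m}. -/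
/-- Exponent vectors of monomials in `n` variables of total degree at most `d`. -/
abbrev Mon (n d : ℕ) := {a : Fin n → Fin (d + 1) // ∑ i, (a i : ℕ) ≤ d}

/-- A polynomial in `n` variables of total degree at most `d` over `F`, represented by
its (finitely many) coefficients: one for each monomial of total degree at most `d`. -/
abbrev PolyCoeff (F : Type*) (n d : ℕ) := Mon n d → F

/-- Evaluation of a polynomial (given by its coefficients) at a point of `F^n`. -/
def evalPoly {F : Type*} [CommRing F] {n d : ℕ} (c : PolyCoeff F n d)
    (x : Fin n → F) : F :=
  ∑ a : Mon n d, c a * ∏ i, x i ^ (a.val i : ℕ)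

/-- A multivariate polynomial of total degree at most `d` is evaluated by `evalPoly` applied to
its coefficients. -/
theorem evalPoly_coeff {F : Type*} [CommRing F] {n d : ℕ} (p : MvPolynomial (Fin n) F)
    (hp : p.totalDegree ≤ d) (x : Fin n → F) :
    evalPoly (d := d)
      (fun a => p.coeff (Finsupp.equivFunOnFinite.symm fun i => (a.val i : ℕ))) x =
      MvPolynomial.eval x p := by
  rw [MvPolynomial.eval_eq', evalPoly]
  have hinj : Function.Injective fun a : Mon n d =>
      (Finsupp.equivFunOnFinite.symm fun i => (a.val i : ℕ) : Fin n →₀ ℕ) := by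
    intro a b hab
    ext i
    simpa using DFunLike.congr_fun hab i
  refine (Finset.sum_map Finset.univ ⟨_, hinj⟩
    fun e : Fin n →₀ ℕ => p.coeff e * ∏ i, x i ^ e i).symm.trans ?_
  symm
  apply Finset.sum_subset
  · intro e he
    have hdeg : ∑ i, e i ≤ d := by
      have := (MvPolynomial.le_totalDegree he).trans hp
      rwa [Finsupp.sum_fintype _ _ fun _ => rfl] at this
    have hlt : ∀ i, e i < d + 1 := fun i =>
      Nat.lt_succ_of_le ((Finset.single_le_sum (fun _ _ => Nat.zero_le _)
        (Finset.mem_univ i)).trans hdeg)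
    refine Finset.mem_map.2 ⟨⟨fun i => ⟨e i, hlt i⟩, hdeg⟩, Finset.mem_univ _, ?_⟩
    ext i
    rfl
  · intro e _ he
    rw [MvPolynomial.notMem_support_iff.1 he, zero_mul]

/-- Lagrange interpolation: at distinct points there is a product of affine forms, one for each
point other than `x i`, that is `1` at `x i` and vanishes at the other points. -/
theorem exists_mvPolynomial_eval_eq_single {F ι σ : Type*} [Field F] [Fintype ι] [DecidableEq ι]
    (x : ι → σ → F) (hx : Function.Injective x) (i : ι) :
    ∃ p : MvPolynomial σ F, p.totalDegree ≤ Fintype.card ι - 1 ∧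
      ∀ j, MvPolynomial.eval (x j) p = (Pi.single i 1 : ι → F) j := by
  have hsep : ∀ j : {j // j ≠ i}, ∃ k, x i k ≠ x j k := fun j =>
    Function.ne_iff.1 (hx.ne j.2.symm)
  choose k hk using hsep
  refine ⟨∏ j : {j // j ≠ i}, MvPolynomial.C (x i (k j) - x j (k j))⁻¹ *
    (MvPolynomial.X (k j) - MvPolynomial.C (x j (k j))), ?_, fun j => ?_⟩
  · refine (MvPolynomial.totalDegree_finsetProd _ _).trans
      ((Finset.sum_le_card_nsmul _ _ 1 fun j _ => ?_).trans ?_)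
    · refine (MvPolynomial.totalDegree_mul _ _).trans ?_
      rw [MvPolynomial.totalDegree_C, zero_add]
      exact (MvPolynomial.totalDegree_sub_C_le _ _).trans (MvPolynomial.totalDegree_X _).le
    · simp [Fintype.card_subtype_compl]
  · rw [map_prod]
    by_cases hj : j = i
    · subst hj
      rw [Pi.single_eq_same]
      refine Finset.prod_eq_one fun l _ => ?_
      simp [inv_mul_cancel₀ (sub_ne_zero.2 (hk l))]
    · rw [Pi.single_eq_of_ne hj]
      exact Finset.prod_eq_zero (Finset.mem_univ ⟨j, hj⟩) (by simp)

/-- Evaluation of polynomials of total degree at most `d` at finitely many points, as a linear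
map in the coefficients. -/
def evalPolyLinear {F ι : Type*} [CommRing F] {n : ℕ} (d : ℕ) (x : ι → Fin n → F) :
    PolyCoeff F n d →ₗ[F] (ι → F) where
  toFun c i := evalPoly c (x i)
  map_add' c c' := by
    ext i
    simp [evalPoly, add_mul, Finset.sum_add_distrib]
  map_smul' r c := by
    ext i
    simp [evalPoly, Finset.mul_sum, mul_assoc]

theorem evalPolyLinear_surjective {F ι : Type*} [Field F] [Fintype ι] {n d : ℕ}
    (x : ι → Fin n → F) (hx : Function.Injective x) (hd : Fintype.card ι - 1 ≤ d) :
    Function.Surjective (evalPolyLinear d x) := by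
  classical
  rw [← LinearMap.range_eq_top, eq_top_iff, ← (Pi.basisFun F ι).span_eq, Submodule.span_le]
  rintro _ ⟨i, rfl⟩
  obtain ⟨p, hp, hpx⟩ := exists_mvPolynomial_eval_eq_single x hx i
  refine ⟨_, funext fun j => (evalPoly_coeff p (hp.trans hd) (x j)).trans ?_⟩
  rw [hpx, Pi.basisFun_apply]

/-- If `q ≥ C(m,2)`, `d ≥ m - 1`, and `x 1, …, x m` are pairwise distinct points of
`F_q^t`, then the number of polynomials in `t` variables of total degree at most `d`
over `F_q` vanishing at all of `x 1, …, x m`, multiplied by `q^m`, equals the total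
number of such polynomials; equivalently, a uniformly random such polynomial vanishes
at all the `x i` with probability exactly `q^{-m}`. -/
theorem random_polynomial_independence (q t d m : ℕ) (hm : 1 ≤ m)
    (hd : m - 1 ≤ d) (hq : m.choose 2 ≤ q)
    (F : Type) [Field F] [Fintype F] [DecidableEq F] (hcard : Fintype.card F = q)
    (x : Fin m → (Fin t → F)) (hx : Function.Injective x) :
    (Finset.univ.filter
        (fun c : PolyCoeff F t d => ∀ i, evalPoly c (x i) = 0)).card * q ^ m
      = Fintype.card (PolyCoeff F t d) := by
  have hsurj : Function.Surjective (evalPolyLinear d x) :=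
    evalPolyLinear_surjective x hx (by simpa using hd)
  have hker : (Finset.univ.filter
      (fun c : PolyCoeff F t d => ∀ i, evalPoly c (x i) = 0)).card =
      Nat.card (LinearMap.ker (evalPolyLinear d x)) := by
    rw [← Fintype.card_subtype, ← Nat.card_eq_fintype_card]
    exact Nat.card_congr (Equiv.subtypeEquivRight fun c => funext_iff.symm)
  have hquot : Nat.card (PolyCoeff F t d ⧸ LinearMap.ker (evalPolyLinear d x)) = q ^ m := by
    rw [Nat.card_congr ((evalPolyLinear d x).quotKerEquivOfSurjective hsurj).toEquiv]
    simp [hcard]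
  rw [hker, ← hquot, ← Nat.card_eq_fintype_card,
    Submodule.card_eq_card_quotient_mul_card (LinearMap.ker (evalPolyLinear d x))]
end
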